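/- There exists a constant C > 0, depending only on T, α, β, K and δ, such that for every classical solution (v,u,θ,w,b) of the planar compressible MHD system on ℝ × [0,T] with (K,δ)-admissible initial data, one has sup_{0≤t≤T} ∫_ℝ ( |b_x|² + |w_x|² ) dx + ∫₀^T ∫_ℝ ( |b_t|² + |b_xx|² + |w_t|² + |w_xx|² ) dx dt ≤ C. -/

import Mathlib

open MeasureTheory Set Filter

noncomputable section

/-- Viscosity function `μ(z) = 1 + α z^(−α)` (here `μ̃₁ = 1`, `μ̃₂ = α`). -/
def visc (α z : ℝ) : ℝ := 1 + α * z ^ (-α)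

/-- Squared Euclidean norm on `ℝ × ℝ` (used for the transverse fields `w, b ∈ ℝ²`). -/
def sq2 (p : ℝ × ℝ) : ℝ := p.1 ^ 2 + p.2 ^ 2

/-- Partial derivative with respect to the first (spatial) variable. -/
def pdx {E : Type*} [NormedAddCommGroup E] [NormedSpace ℝ E]
    (f : ℝ → ℝ → E) (x t : ℝ) : E := deriv (fun y => f y t) x

/-- Partial derivative with respect to the second (time) variable, taken within `[0, T]`
(so it is one-sided at the endpoints). -/
def pdt (T : ℝ) {E : Type*} [NormedAddCommGroup E] [NormedSpace ℝ E]
    (f : ℝ → ℝ → E) (x t : ℝ) : E := derivWithin (fun s => f x s) (Icc 0 T) t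

/-- A classical solution of the planar compressible MHD system (in Lagrangian coordinates,
with all physical constants normalized to `1` and `μ̃₂ = α`) on `ℝ × [0,T]`:
all the derivatives appearing in the equations exist and are continuous, `v, θ > 0`,
the five equations hold pointwise, the solution tends to `(1,0,1,0,0)` as `|x| → ∞`
uniformly in `t ∈ [0,T]`, and `v−1, u, θ−1, b, w` and their first spatial derivatives
are square-integrable in `x` for each `t ∈ [0,T]`. -/
structure IsClassicalSolution (α β T : ℝ) (v u θ : ℝ → ℝ → ℝ)
    (w b : ℝ → ℝ → ℝ × ℝ) : Prop where
  v_pos : ∀ x : ℝ, ∀ t ∈ Icc (0:ℝ) T, 0 < v x t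
  θ_pos : ∀ x : ℝ, ∀ t ∈ Icc (0:ℝ) T, 0 < θ x t
  diff_x : ∀ x : ℝ, ∀ t ∈ Icc (0:ℝ) T,
    DifferentiableAt ℝ (fun y => v y t) x ∧ DifferentiableAt ℝ (fun y => u y t) x ∧
    DifferentiableAt ℝ (fun y => θ y t) x ∧ DifferentiableAt ℝ (fun y => w y t) x ∧
    DifferentiableAt ℝ (fun y => b y t) x
  diff_xx : ∀ x : ℝ, ∀ t ∈ Icc (0:ℝ) T,
    DifferentiableAt ℝ (fun y => pdx u y t) x ∧ DifferentiableAt ℝ (fun y => pdx θ y t) x ∧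
    DifferentiableAt ℝ (fun y => pdx w y t) x ∧ DifferentiableAt ℝ (fun y => pdx b y t) x
  diff_t : ∀ x : ℝ, ∀ t ∈ Icc (0:ℝ) T,
    DifferentiableWithinAt ℝ (fun s => v x s) (Icc 0 T) t ∧
    DifferentiableWithinAt ℝ (fun s => u x s) (Icc 0 T) t ∧
    DifferentiableWithinAt ℝ (fun s => θ x s) (Icc 0 T) t ∧
    DifferentiableWithinAt ℝ (fun s => w x s) (Icc 0 T) t ∧
    DifferentiableWithinAt ℝ (fun s => b x s) (Icc 0 T) t
  cont : ContinuousOn (fun p : ℝ × ℝ =>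
      (v p.1 p.2, u p.1 p.2, θ p.1 p.2, w p.1 p.2, b p.1 p.2)) (univ ×ˢ Icc 0 T)
  cont_dx : ContinuousOn (fun p : ℝ × ℝ =>
      (pdx v p.1 p.2, pdx u p.1 p.2, pdx θ p.1 p.2, pdx w p.1 p.2, pdx b p.1 p.2))
      (univ ×ˢ Icc 0 T)
  cont_dxx : ContinuousOn (fun p : ℝ × ℝ =>
      (pdx (pdx u) p.1 p.2, pdx (pdx θ) p.1 p.2, pdx (pdx w) p.1 p.2, pdx (pdx b) p.1 p.2))
      (univ ×ˢ Icc 0 T)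
  cont_dt : ContinuousOn (fun p : ℝ × ℝ =>
      (pdt T v p.1 p.2, pdt T u p.1 p.2, pdt T θ p.1 p.2, pdt T w p.1 p.2, pdt T b p.1 p.2))
      (univ ×ˢ Icc 0 T)
  eq_mass : ∀ x : ℝ, ∀ t ∈ Icc (0:ℝ) T, pdt T v x t = pdx u x t
  eq_mom : ∀ x : ℝ, ∀ t ∈ Icc (0:ℝ) T,
    pdt T u x t + pdx (fun y s => θ y s / v y s + sq2 (b y s) / 2) x t
      = pdx (fun y s => visc α (v y s) * pdx u y s / v y s) x t
  eq_w : ∀ x : ℝ, ∀ t ∈ Icc (0:ℝ) T,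
    pdt T w x t - pdx b x t = pdx (fun y s => (v y s)⁻¹ • pdx w y s) x t
  eq_b : ∀ x : ℝ, ∀ t ∈ Icc (0:ℝ) T,
    pdt T (fun y s => v y s • b y s) x t - pdx w x t
      = pdx (fun y s => (v y s)⁻¹ • pdx b y s) x t
  eq_temp : ∀ x : ℝ, ∀ t ∈ Icc (0:ℝ) T,
    pdt T θ x t + θ x t / v x t * pdx u x t
      = pdx (fun y s => θ y s ^ β * pdx θ y s / v y s) x t
        + (visc α (v x t) * pdx u x t ^ 2 + sq2 (pdx w x t) + sq2 (pdx b x t)) / v x t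
  farfield : ∀ ε > (0:ℝ), ∃ M : ℝ, ∀ x : ℝ, ∀ t ∈ Icc (0:ℝ) T, M ≤ |x| →
    |v x t - 1| < ε ∧ |u x t| < ε ∧ |θ x t - 1| < ε ∧
    Real.sqrt (sq2 (b x t)) < ε ∧ Real.sqrt (sq2 (w x t)) < ε
  sq_int : ∀ t ∈ Icc (0:ℝ) T,
    Integrable (fun x => (v x t - 1) ^ 2) ∧ Integrable (fun x => (u x t) ^ 2) ∧
    Integrable (fun x => (θ x t - 1) ^ 2) ∧ Integrable (fun x => sq2 (b x t)) ∧
    Integrable (fun x => sq2 (w x t)) ∧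
    Integrable (fun x => (pdx v x t) ^ 2) ∧ Integrable (fun x => (pdx u x t) ^ 2) ∧
    Integrable (fun x => (pdx θ x t) ^ 2) ∧ Integrable (fun x => sq2 (pdx b x t)) ∧
    Integrable (fun x => sq2 (pdx w x t))

/-- The initial data of a solution are `(K, δ)`-admissible: the `H¹`-type norm of
`(v₀−1, u₀, θ₀−1, b₀, w₀)` is at most `K²` and `v₀ ≥ δ`, `θ₀ ≥ δ`. -/
def Admissible (K δ : ℝ) (v u θ : ℝ → ℝ → ℝ) (w b : ℝ → ℝ → ℝ × ℝ) : Prop :=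
  (∫ x : ℝ, ((v x 0 - 1) ^ 2 + (u x 0) ^ 2 + (θ x 0 - 1) ^ 2 + sq2 (b x 0) + sq2 (w x 0)
      + (pdx v x 0) ^ 2 + (pdx u x 0) ^ 2 + (pdx θ x 0) ^ 2
      + sq2 (pdx b x 0) + sq2 (pdx w x 0))) ≤ K ^ 2 ∧
  (∀ x : ℝ, δ ≤ v x 0) ∧ (∀ x : ℝ, δ ≤ θ x 0)


/-! ### Space and space-time integrals of continuous functions -/

/-- Integral over `[a, b]` of the time slice `f(·, t)`. -/
def sInt (f : ℝ × ℝ → ℝ) (a b t : ℝ) : ℝ := ∫ x in a..b, f (x, t)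

/-- Integral of `f` over the rectangle `[a, b] × [0, t]`. -/
def dInt (f : ℝ × ℝ → ℝ) (a b t : ℝ) : ℝ := ∫ s in (0:ℝ)..t, sInt f a b s

section Integrals

variable {f g : ℝ × ℝ → ℝ} {a b c d t T : ℝ}

@[fun_prop]
lemma continuous_sInt (hf : Continuous f) : Continuous (fun t => sInt f a b t) := by
  unfold sInt
  exact intervalIntegral.continuous_parametric_intervalIntegral_of_continuous'
    (f := fun t x => f (x, t)) (by simpa [Function.uncurry_def] using by fun_prop) a b

lemma intervalIntegrable_slice (hf : Continuous f) :
    IntervalIntegrable (fun x => f (x, t)) volume a b :=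
  (by fun_prop : Continuous fun x => f (x, t)).intervalIntegrable _ _

lemma sInt_mono (hab : a ≤ b) (hf : Continuous f) (hg : Continuous g)
    (h : ∀ x ∈ Icc a b, f (x, t) ≤ g (x, t)) : sInt f a b t ≤ sInt g a b t :=
  intervalIntegral.integral_mono_on hab (intervalIntegrable_slice hf)
    (intervalIntegrable_slice hg) h

lemma sInt_nonneg (hab : a ≤ b) (h : ∀ x ∈ Icc a b, 0 ≤ f (x, t)) : 0 ≤ sInt f a b t :=
  intervalIntegral.integral_nonneg hab h

lemma sInt_add (hf : Continuous f) (hg : Continuous g) :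
    sInt (fun p => f p + g p) a b t = sInt f a b t + sInt g a b t :=
  intervalIntegral.integral_add (intervalIntegrable_slice hf) (intervalIntegrable_slice hg)

lemma sInt_sub (hf : Continuous f) (hg : Continuous g) :
    sInt (fun p => f p - g p) a b t = sInt f a b t - sInt g a b t :=
  intervalIntegral.integral_sub (intervalIntegrable_slice hf) (intervalIntegrable_slice hg)

lemma sInt_const_mul (k : ℝ) : sInt (fun p => k * f p) a b t = k * sInt f a b t :=
  intervalIntegral.integral_const_mul _ _

lemma sInt_const (k : ℝ) : sInt (fun _ => k) a b t = k * (b - a) := by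
  simp [sInt, mul_comm]

lemma sInt_subset (hf : Continuous f) (h0 : ∀ x, 0 ≤ f (x, t)) (hca : c ≤ a) (hab : a ≤ b)
    (hbd : b ≤ d) : sInt f a b t ≤ sInt f c d t :=
  intervalIntegral.integral_mono_interval hca hab hbd (Eventually.of_forall fun x => h0 x)
    (intervalIntegrable_slice hf)

lemma dInt_mono (hab : a ≤ b) (ht : 0 ≤ t) (hf : Continuous f) (hg : Continuous g)
    (h : ∀ x ∈ Icc a b, ∀ s ∈ Icc 0 t, f (x, s) ≤ g (x, s)) : dInt f a b t ≤ dInt g a b t :=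
  intervalIntegral.integral_mono_on ht ((continuous_sInt hf).intervalIntegrable _ _)
    ((continuous_sInt hg).intervalIntegrable _ _)
    fun s hs => sInt_mono hab hf hg fun x hx => h x hx s hs

lemma dInt_nonneg (hab : a ≤ b) (ht : 0 ≤ t) (h : ∀ x ∈ Icc a b, ∀ s ∈ Icc 0 t, 0 ≤ f (x, s)) :
    0 ≤ dInt f a b t :=
  intervalIntegral.integral_nonneg ht fun s hs => sInt_nonneg hab fun x hx => h x hx s hs

lemma dInt_add (hf : Continuous f) (hg : Continuous g) :
    dInt (fun p => f p + g p) a b t = dInt f a b t + dInt g a b t := by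
  unfold dInt
  simp_rw [sInt_add hf hg]
  exact intervalIntegral.integral_add ((continuous_sInt hf).intervalIntegrable _ _)
    ((continuous_sInt hg).intervalIntegrable _ _)

lemma dInt_sub (hf : Continuous f) (hg : Continuous g) :
    dInt (fun p => f p - g p) a b t = dInt f a b t - dInt g a b t := by
  unfold dInt
  simp_rw [sInt_sub hf hg]
  exact intervalIntegral.integral_sub ((continuous_sInt hf).intervalIntegrable _ _)
    ((continuous_sInt hg).intervalIntegrable _ _)

lemma dInt_const_mul (k : ℝ) : dInt (fun p => k * f p) a b t = k * dInt f a b t := by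
  unfold dInt
  simp_rw [sInt_const_mul]
  exact intervalIntegral.integral_const_mul _ _

lemma dInt_const (k : ℝ) : dInt (fun _ => k) a b t = k * (b - a) * t := by
  simp [dInt, sInt_const]
  ring

lemma dInt_mono_time (hf : Continuous f) (hab : a ≤ b) (h0 : ∀ p, 0 ≤ f p) (ht : 0 ≤ t)
    (htT : t ≤ T) : dInt f a b t ≤ dInt f a b T :=
  intervalIntegral.integral_mono_interval le_rfl ht htT
    (Eventually.of_forall fun _ => sInt_nonneg hab fun _ _ => h0 _)
    ((continuous_sInt hf).intervalIntegrable _ _)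

lemma dInt_subset (hf : Continuous f) (h0 : ∀ p, 0 ≤ f p) (hca : c ≤ a) (hab : a ≤ b)
    (hbd : b ≤ d) (ht : 0 ≤ t) : dInt f a b t ≤ dInt f c d t :=
  intervalIntegral.integral_mono_on ht ((continuous_sInt hf).intervalIntegrable _ _)
    ((continuous_sInt hf).intervalIntegrable _ _)
    fun _ _ => sInt_subset hf (fun _ => h0 _) hca hab hbd

lemma dInt_swap (hf : Continuous f) :
    dInt f a b t = ∫ x in a..b, ∫ s in (0:ℝ)..t, f (x, s) := by
  unfold dInt sInt
  refine intervalIntegral_intervalIntegral_swap (F := fun s x => f (x, s)) ?_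
  have hc : Continuous (Function.uncurry fun s x => f (x, s)) := by
    simpa [Function.uncurry_def] using by fun_prop
  exact (hc.continuousOn.integrableOn_compact
    (isCompact_uIcc.prod isCompact_uIcc)).mono_set
      (prod_mono uIoc_subset_uIcc uIoc_subset_uIcc)

end Integrals

/-! ### Calculus lemmas -/

lemma sub_eq_integral_of_hasDerivAt_Ioo {T : ℝ} {g g' : ℝ → ℝ} (hg : Continuous g)
    (hg' : Continuous g') (hd : ∀ t ∈ Ioo 0 T, HasDerivAt g (g' t) t) {t : ℝ}
    (ht : t ∈ Icc 0 T) : g t - g 0 = ∫ s in (0:ℝ)..t, g' s :=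
  (intervalIntegral.integral_eq_sub_of_hasDerivAt_of_le ht.1 hg.continuousOn
    (fun s hs => hd s ⟨hs.1, hs.2.trans_le ht.2⟩) (hg'.intervalIntegrable _ _)).symm

lemma sInt_sub_sInt_zero {T a b : ℝ} {N Nt : ℝ × ℝ → ℝ} (hN : Continuous N)
    (hNt : Continuous Nt)
    (hd : ∀ x, ∀ t ∈ Ioo 0 T, HasDerivAt (fun s => N (x, s)) (Nt (x, t)) t) {t : ℝ}
    (ht : t ∈ Icc 0 T) : sInt N a b t - sInt N a b 0 = dInt Nt a b t := by

  rw [dInt_swap hNt]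
  unfold sInt
  rw [← intervalIntegral.integral_sub (intervalIntegrable_slice hN) (intervalIntegrable_slice hN)]
  refine intervalIntegral.integral_congr fun x _ => ?_
  exact sub_eq_integral_of_hasDerivAt_Ioo (g := fun s => N (x, s)) (g' := fun s => Nt (x, s))
    (by fun_prop) (by fun_prop) (hd x) ht

/-- Integration by parts against a function vanishing at both end points. -/
lemma integral_mul_deriv_eq_neg {a b : ℝ} {p p' F F' : ℝ → ℝ} (hp : ∀ x, HasDerivAt p (p' x) x)
    (hF : ∀ x, HasDerivAt F (F' x) x) (hp' : Continuous p') (hF' : Continuous F')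
    (ha : p a = 0) (hb : p b = 0) :
    ∫ x in a..b, p x * F' x = -∫ x in a..b, p' x * F x := by
  rw [intervalIntegral.integral_mul_deriv_eq_deriv_mul (fun x _ => hp x) (fun x _ => hF x)
    (hp'.intervalIntegrable _ _) (hF'.intervalIntegrable _ _), ha, hb]
  ring

/-- A continuous function with space derivative `fx` and time derivative `ft`: if `ft` has a
continuous space derivative `ftx`, then `ftx` is also the time derivative of `fx`. -/
lemma sub_eq_integral_mixed {T : ℝ} {f fx ft ftx : ℝ × ℝ → ℝ} (hf : Continuous f)
    (hft : Continuous ft) (hftx : Continuous ftx)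
    (dfx : ∀ x t, HasDerivAt (fun y => f (y, t)) (fx (x, t)) x)
    (dft : ∀ x, ∀ t ∈ Ioo 0 T, HasDerivAt (fun s => f (x, s)) (ft (x, t)) t)
    (dftx : ∀ x t, HasDerivAt (fun y => ft (y, t)) (ftx (x, t)) x)
    {t : ℝ} (ht : t ∈ Icc 0 T) (x : ℝ) :
    fx (x, t) - fx (x, 0) = ∫ s in (0:ℝ)..t, ftx (x, s) := by
  have hI : Continuous fun y => ∫ s in (0:ℝ)..t, ftx (y, s) :=
    intervalIntegral.continuous_parametric_intervalIntegral_of_continuous'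
      (f := fun y s => ftx (y, s)) (by simpa [Function.uncurry_def] using hftx) 0 t
  have key : ∀ y, f (y, t) - f (y, 0)
      = f (0, t) - f (0, 0) + ∫ z in (0:ℝ)..y, ∫ s in (0:ℝ)..t, ftx (z, s) := by
    intro y
    rw [← dInt_swap hftx]
    have h1 : ∀ y, f (y, t) - f (y, 0) = ∫ s in (0:ℝ)..t, ft (y, s) := fun y =>
      sub_eq_integral_of_hasDerivAt_Ioo (g := fun s => f (y, s)) (g' := fun s => ft (y, s))
        (by fun_prop) (by fun_prop) (dft y) ht
    have h2 : dInt ftx 0 y t = ∫ s in (0:ℝ)..t, (ft (y, s) - ft (0, s)) := by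
      unfold dInt
      refine intervalIntegral.integral_congr fun s _ => ?_
      exact intervalIntegral.integral_eq_sub_of_hasDerivAt (fun z _ => dftx z s)
        (intervalIntegrable_slice hftx)
    rw [h1, h1, h2, intervalIntegral.integral_sub]
    · ring
    · exact (by fun_prop : Continuous fun s => ft (y, s)).intervalIntegrable _ _
    · exact (by fun_prop : Continuous fun s => ft (0, s)).intervalIntegrable _ _
  have d1 : HasDerivAt (fun y => f (y, t) - f (y, 0)) (fx (x, t) - fx (x, 0)) x :=
    (dfx x t).sub (dfx x 0)
  have d2 : HasDerivAt (fun y => f (0, t) - f (0, 0)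
      + ∫ z in (0:ℝ)..y, ∫ s in (0:ℝ)..t, ftx (z, s)) (∫ s in (0:ℝ)..t, ftx (x, s)) x :=
    ((hI.integral_hasStrictDerivAt 0 x).hasDerivAt).const_add _
  exact d1.unique (d2.congr_of_eventuallyEq (Eventually.of_forall key))

lemma hasDerivAt_mixed {T : ℝ} {f fx ft ftx : ℝ × ℝ → ℝ} (hf : Continuous f)
    (hft : Continuous ft) (hftx : Continuous ftx)
    (dfx : ∀ x t, HasDerivAt (fun y => f (y, t)) (fx (x, t)) x)
    (dft : ∀ x, ∀ t ∈ Ioo 0 T, HasDerivAt (fun s => f (x, s)) (ft (x, t)) t)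
    (dftx : ∀ x t, HasDerivAt (fun y => ft (y, t)) (ftx (x, t)) x)
    (x : ℝ) {t : ℝ} (ht : t ∈ Ioo 0 T) :
    HasDerivAt (fun s => fx (x, s)) (ftx (x, t)) t := by
  have hc : Continuous fun s => ftx (x, s) := by fun_prop
  have d : HasDerivAt (fun s => fx (x, 0) + ∫ r in (0:ℝ)..s, ftx (x, r)) (ftx (x, t)) t :=
    ((hc.integral_hasStrictDerivAt 0 t).hasDerivAt).const_add _
  refine d.congr_of_eventuallyEq ?_
  filter_upwards [Ioo_mem_nhds ht.1 ht.2] with s hs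
  rw [← sub_eq_integral_mixed hf hft hftx dfx dft dftx ⟨hs.1.le, hs.2.le⟩ x]
  ring

lemma hasDerivAt_of_sub_eq_mul {E H : ℝ → ℝ} {s : ℝ} (hH : ContinuousAt H s)
    (h : ∀ᶠ t in nhds s, E t - E s = (t - s) * H t) : HasDerivAt E (H s) s := by
  rw [hasDerivAt_iff_tendsto_slope]
  refine (hH.tendsto.mono_left nhdsWithin_le_nhds).congr' ?_
  filter_upwards [nhdsWithin_le_nhds h, self_mem_nhdsWithin] with t ht hts
  have : t - s ≠ 0 := sub_ne_zero.mpr hts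
  rw [slope_def_field, ht]
  field_simp

/-- The mean of `g(x, ·)` over the segment from `s` to `t`. -/
def segMean (g : ℝ × ℝ → ℝ) (s : ℝ) (p : ℝ × ℝ) : ℝ :=
  ∫ τ in (0:ℝ)..1, g (p.1, s + τ * (p.2 - s))

lemma continuous_segMean {g : ℝ × ℝ → ℝ} (hg : Continuous g) (s : ℝ) :
    Continuous (segMean g s) :=
  intervalIntegral.continuous_parametric_intervalIntegral_of_continuous'
    (f := fun (p : ℝ × ℝ) τ => g (p.1, s + τ * (p.2 - s)))
    (by simpa [Function.uncurry_def] using by fun_prop) 0 1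

lemma segMean_self (g : ℝ × ℝ → ℝ) (s x : ℝ) : segMean g s (x, s) = g (x, s) := by
  simp [segMean]

lemma sub_eq_mul_segMean {T : ℝ} {f ft : ℝ × ℝ → ℝ} (hft : Continuous ft)
    (dft : ∀ x, ∀ t ∈ Ioo 0 T, HasDerivAt (fun s => f (x, s)) (ft (x, t)) t)
    (x : ℝ) {s t : ℝ} (hs : s ∈ Ioo 0 T) (ht : t ∈ Ioo 0 T) :
    f (x, t) - f (x, s) = (t - s) * segMean ft s (x, t) := by
  have hsub : ∀ τ ∈ uIcc (0:ℝ) 1, s + τ * (t - s) ∈ Ioo 0 T := by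
    intro τ hτ
    rw [uIcc_of_le zero_le_one] at hτ
    have := (convex_Ioo (0:ℝ) T) hs ht (sub_nonneg.mpr hτ.2) hτ.1 (by ring)
    simp only [smul_eq_mul] at this
    convert this using 1
    ring
  have h := intervalIntegral.integral_eq_sub_of_hasDerivAt (a := 0) (b := 1)
    (f := fun τ => f (x, s + τ * (t - s))) (f' := fun τ => ft (x, s + τ * (t - s)) * (t - s))
    (fun τ hτ => by
      have h1 := dft x _ (hsub τ hτ)
      have h2 : HasDerivAt (fun τ : ℝ => s + τ * (t - s)) (t - s) τ := by
        simpa using ((hasDerivAt_id τ).mul_const (t - s)).const_add s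
      exact h1.comp τ h2)
    ((by fun_prop : Continuous fun τ => ft (x, s + τ * (t - s)) * (t - s)).intervalIntegrable _ _)
  rw [intervalIntegral.integral_mul_const] at h
  simp only [one_mul, zero_mul, add_zero, add_sub_cancel] at h
  rw [← h, segMean, mul_comm]

/-- Time derivative of a localized weighted Dirichlet energy, without assuming the existence of
the mixed second derivative of `f`. -/
lemma hasDerivAt_dirichlet {T a b : ℝ} {p p' : ℝ → ℝ} {A Ax At f fx fxx ft : ℝ × ℝ → ℝ}
    (hp : ∀ x, HasDerivAt p (p' x) x) (hp' : Continuous p') (ha : p a = 0) (hb : p b = 0)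
    (hA : Continuous A) (hAx : Continuous Ax) (hAt : Continuous At) (hfx : Continuous fx)
    (hfxx : Continuous fxx) (hft : Continuous ft)
    (dAx : ∀ x t, HasDerivAt (fun y => A (y, t)) (Ax (x, t)) x)
    (dAt : ∀ x, ∀ t ∈ Ioo 0 T, HasDerivAt (fun s => A (x, s)) (At (x, t)) t)
    (dfx : ∀ x t, HasDerivAt (fun y => f (y, t)) (fx (x, t)) x)
    (dfxx : ∀ x t, HasDerivAt (fun y => fx (y, t)) (fxx (x, t)) x)
    (dft : ∀ x, ∀ t ∈ Ioo 0 T, HasDerivAt (fun s => f (x, s)) (ft (x, t)) t)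
    {s : ℝ} (hs : s ∈ Ioo 0 T) :
    HasDerivAt (fun t => sInt (fun q => p q.1 * (A q * fx q ^ 2)) a b t)
      (sInt (fun q => p q.1 * (At q * fx q ^ 2)
        - 2 * ((p' q.1 * (A q * fx q) + p q.1 * (Ax q * fx q + A q * fxx q)) * ft q)) a b s) s := by
  have hpc : Continuous p := continuous_iff_continuousAt.2 fun x => (hp x).continuousAt
  have hmA := continuous_segMean hAt s
  have hmf := continuous_segMean hft s
  set H : ℝ × ℝ → ℝ := fun q => p q.1 * (segMean At s q * fx q ^ 2)
    - (p' q.1 * (A (q.1, s) * (fx q + fx (q.1, s)))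
      + p q.1 * (Ax (q.1, s) * (fx q + fx (q.1, s)) + A (q.1, s) * (fxx q + fxx (q.1, s))))
      * segMean ft s q with hHdef
  have hH : Continuous H := by fun_prop
  have main : HasDerivAt (fun t => sInt (fun q => p q.1 * (A q * fx q ^ 2)) a b t)
      (sInt H a b s) s := by
    refine hasDerivAt_of_sub_eq_mul (H := fun t => sInt H a b t)
      (continuous_sInt hH).continuousAt ?_
    filter_upwards [Ioo_mem_nhds hs.1 hs.2] with t ht
    set G : ℝ → ℝ := fun x => p x * (A (x, s) * (fx (x, t) + fx (x, s))) with hG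
    set G' : ℝ → ℝ := fun x => p' x * (A (x, s) * (fx (x, t) + fx (x, s)))
      + p x * (Ax (x, s) * (fx (x, t) + fx (x, s)) + A (x, s) * (fxx (x, t) + fxx (x, s))) with hG'
    have ibp := integral_mul_deriv_eq_neg (a := a) (b := b) (p := G) (p' := G')
      (F := fun x => f (x, t) - f (x, s)) (F' := fun x => fx (x, t) - fx (x, s))
      (fun x => by
        have := (hp x).mul ((dAx x s).mul ((dfxx x t).add (dfxx x s)))
        exact this)
      (fun x => (dfx x t).sub (dfx x s)) (by fun_prop) (by fun_prop)
      (by simp [hG, ha]) (by simp [hG, hb])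
    have e1 : (t - s) * sInt H a b t
        = (∫ x in a..b, p x * ((A (x, t) - A (x, s)) * fx (x, t) ^ 2))
          - ∫ x in a..b, G' x * (f (x, t) - f (x, s)) := by
      rw [← intervalIntegral.integral_sub, ← sInt_const_mul]
      · refine intervalIntegral.integral_congr fun x _ => ?_
        simp only [hHdef, hG']
        rw [sub_eq_mul_segMean hAt dAt x hs ht, sub_eq_mul_segMean hft dft x hs ht]
        ring
      · exact (by fun_prop : Continuous fun x =>
          p x * ((A (x, t) - A (x, s)) * fx (x, t) ^ 2)).intervalIntegrable _ _
      · have : Continuous fun x => G' x * (f (x, t) - f (x, s)) := by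
          have c1 : Continuous fun x => f (x, t) :=
            continuous_iff_continuousAt.2 fun x => (dfx x t).continuousAt
          have c2 : Continuous fun x => f (x, s) :=
            continuous_iff_continuousAt.2 fun x => (dfx x s).continuousAt
          have c3 : Continuous G' := by fun_prop
          exact c3.mul (c1.sub c2)
        exact this.intervalIntegrable _ _
    rw [e1, sub_eq_add_neg _ (∫ x in a..b, G' x * (f (x, t) - f (x, s))), ← ibp,
      ← intervalIntegral.integral_add]
    · unfold sInt
      rw [← intervalIntegral.integral_sub]
      · refine intervalIntegral.integral_congr fun x _ => ?_
        simp only [hG]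
        ring
      · exact (by fun_prop : Continuous fun x =>
          p x * (A (x, t) * fx (x, t) ^ 2)).intervalIntegrable _ _
      · exact (by fun_prop : Continuous fun x =>
          p x * (A (x, s) * fx (x, s) ^ 2)).intervalIntegrable _ _
    · exact (by fun_prop : Continuous fun x =>
          p x * ((A (x, t) - A (x, s)) * fx (x, t) ^ 2)).intervalIntegrable _ _
    · exact (by fun_prop : Continuous fun x =>
          G x * (fx (x, t) - fx (x, s))).intervalIntegrable _ _
  convert main using 1
  refine intervalIntegral.integral_congr fun x _ => ?_
  simp only [hHdef, segMean_self]
  ring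

lemma integral_mul_sq_le {a b : ℝ} (hab : a ≤ b) {f g : ℝ → ℝ} (hf : Continuous f)
    (hg : Continuous g) :
    (∫ x in a..b, f x * g x) ^ 2 ≤ (∫ x in a..b, f x ^ 2) * ∫ x in a..b, g x ^ 2 := by
  have h : ∀ τ : ℝ, 0 ≤ (∫ x in a..b, f x ^ 2) * (τ * τ) + (2 * ∫ x in a..b, f x * g x) * τ
      + ∫ x in a..b, g x ^ 2 := by
    intro τ
    have : (∫ x in a..b, f x ^ 2) * (τ * τ) + (2 * ∫ x in a..b, f x * g x) * τ
        + ∫ x in a..b, g x ^ 2 = ∫ x in a..b, (τ * f x + g x) ^ 2 := by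
      rw [← intervalIntegral.integral_mul_const, ← intervalIntegral.integral_const_mul,
        ← intervalIntegral.integral_mul_const, ← intervalIntegral.integral_add,
        ← intervalIntegral.integral_add]
      · refine intervalIntegral.integral_congr fun x _ => ?_
        ring
      all_goals exact Continuous.intervalIntegrable (by fun_prop) _ _
    rw [this]
    exact intervalIntegral.integral_nonneg hab fun x _ => sq_nonneg _
  have := discrim_le_zero h
  unfold discrim at this
  nlinarith

lemma abs_le_abs_add_integral {a b : ℝ} {h h' : ℝ → ℝ} (hd : ∀ x, HasDerivAt h (h' x) x)
    (hc : Continuous h') {x y : ℝ} (hx : x ∈ Icc a b) (hy : y ∈ Icc a b) :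
    |h x| ≤ |h y| + ∫ z in a..b, |h' z| := by
  have e : ∫ z in y..x, h' z = h x - h y :=
    intervalIntegral.integral_eq_sub_of_hasDerivAt (fun z _ => hd z) (hc.intervalIntegrable _ _)
  have h1 : |∫ z in y..x, h' z| ≤ ∫ z in a..b, |h' z| := by
    refine (intervalIntegral.norm_integral_le_integral_norm_uIoc (f := h')).trans ?_
    simp only [Real.norm_eq_abs]
    rw [intervalIntegral.integral_of_le (hx.1.trans hx.2)]
    refine setIntegral_mono_set ?_ ?_ ?_
    · exact ((continuous_abs.comp hc).intervalIntegrable a b).1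
    · exact Eventually.of_forall fun z => abs_nonneg _
    · refine Eventually.of_forall fun z hz => ?_
      rcases le_total y x with hyx | hyx
      · rw [uIoc_of_le hyx] at hz
        exact ⟨hy.1.trans_lt hz.1, hz.2.trans hx.2⟩
      · rw [uIoc_of_ge hyx] at hz
        exact ⟨hx.1.trans_lt hz.1, hz.2.trans hy.2⟩
  have h2 : |h x| ≤ |h y| + |h x - h y| := by
    have := abs_add_le (h y) (h x - h y)
    simpa using this
  rw [e] at h1
  linarith

lemma exists_le_of_integral_le {a C : ℝ} {h : ℝ → ℝ} (hc : Continuous h)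
    (hI : ∫ x in a..(a + 1), h x ≤ C) : ∃ y ∈ Icc a (a + 1), h y ≤ C := by
  by_contra! hcon
  obtain ⟨y, hy, hmin⟩ := isCompact_Icc.exists_isMinOn (nonempty_Icc.2 (by linarith : a ≤ a + 1))
    hc.continuousOn
  have h1 : ∫ _ in a..(a + 1), h y ≤ ∫ x in a..(a + 1), h x :=
    intervalIntegral.integral_mono_on (by linarith) (by simp) (hc.intervalIntegrable _ _)
      fun x hx => hmin hx
  simp only [intervalIntegral.integral_const, smul_eq_mul] at h1
  have := hcon y hy
  linarith

/-- A one-dimensional Sobolev inequality on unit intervals. -/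
lemma sq_le_integral_add {a : ℝ} {h h' : ℝ → ℝ} (hd : ∀ x, HasDerivAt h (h' x) x)
    (hc : Continuous h') {x : ℝ} (hx : x ∈ Icc a (a + 1)) :
    h x ^ 2 ≤ (∫ z in a..(a + 1), h z ^ 2) + ∫ z in a..(a + 1), 2 * |h z| * |h' z| := by
  have hh : Continuous h := continuous_iff_continuousAt.2 fun x => (hd x).continuousAt
  obtain ⟨y, hy, hyle⟩ := exists_le_of_integral_le (a := a) (h := fun z => h z ^ 2)
    (by fun_prop) le_rfl
  have := abs_le_abs_add_integral (h := fun z => h z ^ 2) (h' := fun z => 2 * h z * h' z)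
    (fun z => by simpa [mul_assoc] using (hd z).fun_pow 2) (by fun_prop) hx hy
  simp only [abs_mul, abs_two, abs_pow, sq_abs] at this
  linarith

/-- Grönwall's inequality in integral form. -/
lemma gronwall_integral {T A : ℝ} {y m : ℝ → ℝ} (hy : Continuous y) (hm : Continuous m)
    (hm0 : ∀ t ∈ Icc 0 T, 0 ≤ m t)
    (h : ∀ t ∈ Icc 0 T, y t ≤ A + ∫ s in (0:ℝ)..t, m s * y s) {t : ℝ} (ht : t ∈ Icc 0 T) :
    y t ≤ A * Real.exp (∫ s in (0:ℝ)..t, m s) := by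
  set M : ℝ → ℝ := fun t => ∫ s in (0:ℝ)..t, m s with hM
  set Y : ℝ → ℝ := fun t => A + ∫ s in (0:ℝ)..t, m s * y s with hY
  have dM : ∀ t, HasDerivAt M (m t) t := fun t => (hm.integral_hasStrictDerivAt 0 t).hasDerivAt
  have dY : ∀ t, HasDerivAt Y (m t * y t) t := fun t =>
    (((by fun_prop : Continuous fun s => m s * y s).integral_hasStrictDerivAt 0 t).hasDerivAt).const_add _
  have dH : ∀ t, HasDerivAt (fun t => Y t * Real.exp (-M t))
      (m t * y t * Real.exp (-M t) + Y t * (Real.exp (-M t) * -m t)) t :=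
    fun t => (dY t).mul ((dM t).neg.exp)
  have anti : AntitoneOn (fun t => Y t * Real.exp (-M t)) (Icc 0 T) := by
    refine antitoneOn_of_hasDerivWithinAt_nonpos (convex_Icc 0 T)
      (fun t _ => (dH t).continuousAt.continuousWithinAt)
      (fun t _ => (dH t).hasDerivWithinAt) ?_
    intro t ht
    rw [interior_Icc] at ht
    have h1 := h t ⟨ht.1.le, ht.2.le⟩
    have h2 := hm0 t ⟨ht.1.le, ht.2.le⟩
    have h3 : m t * y t ≤ m t * Y t := mul_le_mul_of_nonneg_left h1 h2
    have h4 := Real.exp_pos (-M t)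
    nlinarith
  have h0 := anti ⟨le_rfl, ht.1.trans ht.2⟩ ht ht.1
  have hM0 : M 0 = 0 := by simp [hM]
  have hY0 : Y 0 = A := by simp [hY]
  simp only [hM0, hY0, neg_zero, Real.exp_zero, mul_one] at h0
  calc y t ≤ Y t := h t ht
    _ = Y t * Real.exp (-M t) * Real.exp (M t) := by
        rw [mul_assoc, ← Real.exp_add]; simp
    _ ≤ A * Real.exp (M t) := mul_le_mul_of_nonneg_right h0 (Real.exp_pos _).le

/-! ### Solutions extended to all times -/

/-- A classical solution of the system in components, extended continuously to `ℝ × ℝ` and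
constant in time outside `[0, T]`; the time derivatives are only related to the functions
inside `(0, T)`. -/
structure MHD (α β T : ℝ) where
  (v vx u ux ut θ θx θt : ℝ × ℝ → ℝ)
  (b bx bxx bt w wx wxx wt : Fin 2 → ℝ × ℝ → ℝ)
  hv : Continuous v
  hvx : Continuous vx
  hu : Continuous u
  hux : Continuous ux
  hut : Continuous ut
  hθ : Continuous θ
  hθx : Continuous θx
  hθt : Continuous θt
  hb : ∀ i, Continuous (b i)
  hbx : ∀ i, Continuous (bx i)
  hbxx : ∀ i, Continuous (bxx i)
  hbt : ∀ i, Continuous (bt i)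
  hw : ∀ i, Continuous (w i)
  hwx : ∀ i, Continuous (wx i)
  hwxx : ∀ i, Continuous (wxx i)
  hwt : ∀ i, Continuous (wt i)
  v_pos : ∀ p, 0 < v p
  θ_pos : ∀ p, 0 < θ p
  dvx : ∀ x t, HasDerivAt (fun y => v (y, t)) (vx (x, t)) x
  dux : ∀ x t, HasDerivAt (fun y => u (y, t)) (ux (x, t)) x
  dθx : ∀ x t, HasDerivAt (fun y => θ (y, t)) (θx (x, t)) x
  dbx : ∀ i x t, HasDerivAt (fun y => b i (y, t)) (bx i (x, t)) x
  dbxx : ∀ i x t, HasDerivAt (fun y => bx i (y, t)) (bxx i (x, t)) x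
  dwx : ∀ i x t, HasDerivAt (fun y => w i (y, t)) (wx i (x, t)) x
  dwxx : ∀ i x t, HasDerivAt (fun y => wx i (y, t)) (wxx i (x, t)) x
  dvt : ∀ x, ∀ t ∈ Ioo 0 T, HasDerivAt (fun s => v (x, s)) (ux (x, t)) t
  dut : ∀ x, ∀ t ∈ Ioo 0 T, HasDerivAt (fun s => u (x, s)) (ut (x, t)) t
  dθt : ∀ x, ∀ t ∈ Ioo 0 T, HasDerivAt (fun s => θ (x, s)) (θt (x, t)) t
  dbt : ∀ i x, ∀ t ∈ Ioo 0 T, HasDerivAt (fun s => b i (x, s)) (bt i (x, t)) t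
  dwt : ∀ i x, ∀ t ∈ Ioo 0 T, HasDerivAt (fun s => w i (x, s)) (wt i (x, t)) t
  dmom : ∀ x t, HasDerivAt (fun y => visc α (v (y, t)) * ux (y, t) / v (y, t)
    - (θ (y, t) / v (y, t) + (b 0 (y, t) ^ 2 + b 1 (y, t) ^ 2) / 2)) (ut (x, t)) x
  dflux_w : ∀ i x t, HasDerivAt (fun y => wx i (y, t) / v (y, t)) (wt i (x, t) - bx i (x, t)) x
  dflux_b : ∀ i x t, HasDerivAt (fun y => bx i (y, t) / v (y, t))
    (v (x, t) * bt i (x, t) + ux (x, t) * b i (x, t) - wx i (x, t)) x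
  dtemp : ∀ x t, HasDerivAt (fun y => θ (y, t) ^ β * θx (y, t) / v (y, t))
    (θt (x, t) + θ (x, t) / v (x, t) * ux (x, t)
      - (visc α (v (x, t)) * ux (x, t) ^ 2 + (wx 0 (x, t) ^ 2 + wx 1 (x, t) ^ 2)
        + (bx 0 (x, t) ^ 2 + bx 1 (x, t) ^ 2)) / v (x, t)) x
  far : ∀ ε > (0:ℝ), ∃ M : ℝ, ∀ x t, M ≤ |x| → |v (x, t) - 1| < ε ∧ |u (x, t)| < ε ∧
    |θ (x, t) - 1| < ε ∧ ∀ i, |b i (x, t)| < ε ∧ |w i (x, t)| < ε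

namespace MHD

variable {α β T : ℝ}

attribute [fun_prop] hv hvx hu hux hut hθ hθx hθt hb hbx hbxx hbt hw hwx hwxx hwt

/-- Bounds on the initial data in terms of integrals over bounded intervals. -/
def Adm (s : MHD α β T) (K δ : ℝ) : Prop :=
  (∀ x y, x ≤ y → sInt (fun p => (s.v p - 1) ^ 2 + s.u p ^ 2 + (s.θ p - 1) ^ 2
    + (s.b 0 p ^ 2 + s.b 1 p ^ 2) + (s.w 0 p ^ 2 + s.w 1 p ^ 2) + s.vx p ^ 2 + s.ux p ^ 2
    + s.θx p ^ 2 + (s.bx 0 p ^ 2 + s.bx 1 p ^ 2) + (s.wx 0 p ^ 2 + s.wx 1 p ^ 2)) x y 0 ≤ K ^ 2) ∧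
  (∀ x, δ ≤ s.v (x, 0)) ∧ (∀ x, δ ≤ s.θ (x, 0))

end MHD

section Extension

variable {α β T : ℝ} {v u θ : ℝ → ℝ → ℝ} {w b : ℝ → ℝ → ℝ × ℝ}

/-- Projection of the time variable to `[0, T]`. -/
def clampTime (T t : ℝ) : ℝ := max 0 (min t T)

lemma clampTime_mem (hT : 0 < T) (t : ℝ) : clampTime T t ∈ Icc 0 T :=
  ⟨le_max_left _ _, max_le hT.le (min_le_right _ _)⟩

lemma clampTime_eq {t : ℝ} (ht : t ∈ Icc 0 T) : clampTime T t = t := by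
  simp [clampTime, ht.1, ht.2]

lemma continuous_clamp {E : Type*} [TopologicalSpace E] (hT : 0 < T) {f : ℝ → ℝ → E}
    (hf : ContinuousOn (fun p : ℝ × ℝ => f p.1 p.2) (univ ×ˢ Icc 0 T)) :
    Continuous fun p : ℝ × ℝ => f p.1 (clampTime T p.2) := by
  have hc : Continuous fun p : ℝ × ℝ => (p.1, clampTime T p.2) := by
    unfold clampTime
    fun_prop
  exact hf.comp_continuous hc fun p => ⟨mem_univ _, clampTime_mem hT _⟩

lemma hasDerivAt_clamp {E : Type*} [NormedAddCommGroup E] [NormedSpace ℝ E] {f : ℝ → ℝ → E}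
    {x t : ℝ} (ht : t ∈ Ioo 0 T)
    (hf : DifferentiableWithinAt ℝ (fun s => f x s) (Icc 0 T) t) :
    HasDerivAt (fun s => f x (clampTime T s)) (pdt T f x (clampTime T t)) t := by
  have ht' : t ∈ Icc 0 T := ⟨ht.1.le, ht.2.le⟩
  rw [clampTime_eq ht']
  have h := hf.hasDerivWithinAt.hasDerivAt (Icc_mem_nhds ht.1 ht.2)
  refine h.congr_of_eventuallyEq ?_
  filter_upwards [Ioo_mem_nhds ht.1 ht.2] with s hs
  rw [clampTime_eq ⟨hs.1.le, hs.2.le⟩]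

/-- Component of a pair, indexed by `Fin 2`. -/
def comp (i : Fin 2) : ℝ × ℝ →L[ℝ] ℝ :=
  if i = 0 then ContinuousLinearMap.fst ℝ ℝ ℝ else ContinuousLinearMap.snd ℝ ℝ ℝ

@[simp] lemma comp_zero (p : ℝ × ℝ) : comp 0 p = p.1 := rfl

@[simp] lemma comp_one (p : ℝ × ℝ) : comp 1 p = p.2 := rfl

lemma abs_comp_le (i : Fin 2) (p : ℝ × ℝ) : |comp i p| ≤ Real.sqrt (sq2 p) := by
  refine Real.abs_le_sqrt ?_
  unfold sq2
  fin_cases i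
  · simpa using sq_nonneg p.2
  · simpa using sq_nonneg p.1

namespace IsClassicalSolution

lemma hasDerivAt_mom (h : IsClassicalSolution α β T v u θ w b) (x : ℝ) {t : ℝ}
    (ht : t ∈ Icc 0 T) :
    HasDerivAt (fun y => visc α (v y t) * pdx u y t / v y t
      - (θ y t / v y t + (comp 0 (b y t) ^ 2 + comp 1 (b y t) ^ 2) / 2)) (pdt T u x t) x := by
  obtain ⟨h1, -, h3, -, h5⟩ := h.diff_x x t ht
  obtain ⟨h6, -⟩ := h.diff_xx x t ht
  have hv := h.v_pos x t ht
  have d1 : DifferentiableAt ℝ (fun y => visc α (v y t) * pdx u y t / v y t) x := by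
    unfold visc
    exact ((((h1.rpow_const (Or.inl hv.ne')).const_mul α).const_add 1).mul h6).div h1 hv.ne'
  have hb0 : DifferentiableAt ℝ (fun y => (b y t).1) x := h5.fst
  have hb1 : DifferentiableAt ℝ (fun y => (b y t).2) x := h5.snd
  have d2 : DifferentiableAt ℝ (fun y => θ y t / v y t + sq2 (b y t) / 2) x := by
    unfold sq2
    exact (h3.div h1 hv.ne').add (((hb0.pow 2).add (hb1.pow 2)).div_const 2)
  have e := h.eq_mom x t ht
  have := d1.hasDerivAt.sub d2.hasDerivAt
  unfold pdx at e this
  rw [← e, add_sub_cancel_right] at this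
  exact this

lemma hasDerivAt_flux_w (h : IsClassicalSolution α β T v u θ w b) (i : Fin 2) (x : ℝ) {t : ℝ}
    (ht : t ∈ Icc 0 T) : HasDerivAt (fun y => comp i (pdx w y t) / v y t)
      (comp i (pdt T w x t) - comp i (pdx b x t)) x := by
  obtain ⟨h1, -⟩ := h.diff_x x t ht
  obtain ⟨-, -, h6, -⟩ := h.diff_xx x t ht
  have d := ((h1.inv (h.v_pos x t ht).ne').smul h6).hasDerivAt
  have e := h.eq_w x t ht
  unfold pdx at e d ⊢
  simp only [Pi.smul_def', Pi.inv_apply] at d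
  rw [← e] at d
  have := (comp i).hasFDerivAt.comp_hasDerivAt x d
  rw [map_sub] at this
  refine this.congr_of_eventuallyEq (Eventually.of_forall fun y => ?_)
  simp [div_eq_inv_mul]

lemma hasDerivAt_flux_b (h : IsClassicalSolution α β T v u θ w b) (hT : 0 < T) (i : Fin 2)
    (x : ℝ) {t : ℝ} (ht : t ∈ Icc 0 T) : HasDerivAt (fun y => comp i (pdx b y t) / v y t)
      (v x t * comp i (pdt T b x t) + pdx u x t * comp i (b x t) - comp i (pdx w x t)) x := by
  obtain ⟨h1, -⟩ := h.diff_x x t ht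
  obtain ⟨-, -, -, h6⟩ := h.diff_xx x t ht
  obtain ⟨h2, -, -, -, h3⟩ := h.diff_t x t ht
  have d := ((h1.inv (h.v_pos x t ht).ne').smul h6).hasDerivAt
  have e := h.eq_b x t ht
  have e2 : pdt T (fun y s => v y s • b y s) x t = v x t • pdt T b x t + pdx u x t • b x t := by
    rw [← h.eq_mass x t ht]
    exact (h2.hasDerivWithinAt.smul h3.hasDerivWithinAt).derivWithin
      (uniqueDiffOn_Icc hT t ht)
  rw [e2] at e
  unfold pdx at e d ⊢
  simp only [Pi.smul_def', Pi.inv_apply] at d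
  rw [← e] at d
  have := (comp i).hasFDerivAt.comp_hasDerivAt x d
  rw [map_sub, map_add, map_smul, map_smul, smul_eq_mul, smul_eq_mul] at this
  refine this.congr_of_eventuallyEq (Eventually.of_forall fun y => ?_)
  simp [div_eq_inv_mul]

lemma hasDerivAt_flux_θ (h : IsClassicalSolution α β T v u θ w b) (x : ℝ) {t : ℝ}
    (ht : t ∈ Icc 0 T) : HasDerivAt (fun y => θ y t ^ β * pdx θ y t / v y t)
      (pdt T θ x t + θ x t / v x t * pdx u x t
        - (visc α (v x t) * pdx u x t ^ 2
          + (comp 0 (pdx w x t) ^ 2 + comp 1 (pdx w x t) ^ 2)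
          + (comp 0 (pdx b x t) ^ 2 + comp 1 (pdx b x t) ^ 2)) / v x t) x := by
  obtain ⟨h1, -, h3, -⟩ := h.diff_x x t ht
  obtain ⟨-, h6, -⟩ := h.diff_xx x t ht
  have d := (((h3.rpow_const (p := β) (Or.inl (h.θ_pos x t ht).ne')).mul h6).div h1
    (h.v_pos x t ht).ne').hasDerivAt
  have e := h.eq_temp x t ht
  unfold sq2 at e
  simp only [comp_zero, comp_one]
  rw [e, add_sub_cancel_right]
  exact d

/-- The extension of a classical solution to all times. -/
def toMHD (h : IsClassicalSolution α β T v u θ w b) (hT : 0 < T) : MHD α β T where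
  v p := v p.1 (clampTime T p.2)
  vx p := pdx v p.1 (clampTime T p.2)
  u p := u p.1 (clampTime T p.2)
  ux p := pdx u p.1 (clampTime T p.2)
  ut p := pdt T u p.1 (clampTime T p.2)
  θ p := θ p.1 (clampTime T p.2)
  θx p := pdx θ p.1 (clampTime T p.2)
  θt p := pdt T θ p.1 (clampTime T p.2)
  b i p := comp i (b p.1 (clampTime T p.2))
  bx i p := comp i (pdx b p.1 (clampTime T p.2))
  bxx i p := comp i (pdx (pdx b) p.1 (clampTime T p.2))
  bt i p := comp i (pdt T b p.1 (clampTime T p.2))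
  w i p := comp i (w p.1 (clampTime T p.2))
  wx i p := comp i (pdx w p.1 (clampTime T p.2))
  wxx i p := comp i (pdx (pdx w) p.1 (clampTime T p.2))
  wt i p := comp i (pdt T w p.1 (clampTime T p.2))
  hv := continuous_clamp hT h.cont.fst
  hvx := continuous_clamp hT h.cont_dx.fst
  hu := continuous_clamp hT h.cont.snd.fst
  hux := continuous_clamp hT h.cont_dx.snd.fst
  hut := continuous_clamp hT h.cont_dt.snd.fst
  hθ := continuous_clamp hT h.cont.snd.snd.fst
  hθx := continuous_clamp hT h.cont_dx.snd.snd.fst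
  hθt := continuous_clamp hT h.cont_dt.snd.snd.fst
  hb i := (comp i).continuous.comp (continuous_clamp hT h.cont.snd.snd.snd.snd)
  hbx i := (comp i).continuous.comp (continuous_clamp hT h.cont_dx.snd.snd.snd.snd)
  hbxx i := (comp i).continuous.comp (continuous_clamp hT h.cont_dxx.snd.snd.snd)
  hbt i := (comp i).continuous.comp (continuous_clamp hT h.cont_dt.snd.snd.snd.snd)
  hw i := (comp i).continuous.comp (continuous_clamp hT h.cont.snd.snd.snd.fst)
  hwx i := (comp i).continuous.comp (continuous_clamp hT h.cont_dx.snd.snd.snd.fst)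
  hwxx i := (comp i).continuous.comp (continuous_clamp hT h.cont_dxx.snd.snd.fst)
  hwt i := (comp i).continuous.comp (continuous_clamp hT h.cont_dt.snd.snd.snd.fst)
  v_pos _ := h.v_pos _ _ (clampTime_mem hT _)
  θ_pos _ := h.θ_pos _ _ (clampTime_mem hT _)
  dvx x t := (h.diff_x x _ (clampTime_mem hT t)).1.hasDerivAt
  dux x t := (h.diff_x x _ (clampTime_mem hT t)).2.1.hasDerivAt
  dθx x t := (h.diff_x x _ (clampTime_mem hT t)).2.2.1.hasDerivAt
  dbx i x t := (comp i).hasFDerivAt.comp_hasDerivAt x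
    (h.diff_x x _ (clampTime_mem hT t)).2.2.2.2.hasDerivAt
  dbxx i x t := (comp i).hasFDerivAt.comp_hasDerivAt x
    (h.diff_xx x _ (clampTime_mem hT t)).2.2.2.hasDerivAt
  dwx i x t := (comp i).hasFDerivAt.comp_hasDerivAt x
    (h.diff_x x _ (clampTime_mem hT t)).2.2.2.1.hasDerivAt
  dwxx i x t := (comp i).hasFDerivAt.comp_hasDerivAt x
    (h.diff_xx x _ (clampTime_mem hT t)).2.2.1.hasDerivAt
  dvt x t ht := by
    rw [← h.eq_mass x _ (clampTime_mem hT _)]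
    exact hasDerivAt_clamp ht (h.diff_t x t ⟨ht.1.le, ht.2.le⟩).1
  dut x t ht := hasDerivAt_clamp ht (h.diff_t x t ⟨ht.1.le, ht.2.le⟩).2.1
  dθt x t ht := hasDerivAt_clamp ht (h.diff_t x t ⟨ht.1.le, ht.2.le⟩).2.2.1
  dbt i x t ht := (comp i).hasFDerivAt.comp_hasDerivAt t
    (hasDerivAt_clamp ht (h.diff_t x t ⟨ht.1.le, ht.2.le⟩).2.2.2.2)
  dwt i x t ht := (comp i).hasFDerivAt.comp_hasDerivAt t
    (hasDerivAt_clamp ht (h.diff_t x t ⟨ht.1.le, ht.2.le⟩).2.2.2.1)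
  dmom x t := h.hasDerivAt_mom x (clampTime_mem hT t)
  dflux_w i x t := h.hasDerivAt_flux_w i x (clampTime_mem hT t)
  dflux_b i x t := h.hasDerivAt_flux_b hT i x (clampTime_mem hT t)
  dtemp x t := h.hasDerivAt_flux_θ x (clampTime_mem hT t)
  far ε hε := by
    obtain ⟨M, hM⟩ := h.farfield ε hε
    refine ⟨M, fun x t hx => ?_⟩
    obtain ⟨h1, h2, h3, h4, h5⟩ := hM x _ (clampTime_mem hT t) hx
    exact ⟨h1, h2, h3, fun i => ⟨(abs_comp_le i _).trans_lt h4, (abs_comp_le i _).trans_lt h5⟩⟩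

lemma adm_toMHD (h : IsClassicalSolution α β T v u θ w b) (hT : 0 < T) {K δ : ℝ}
    (ha : Admissible K δ v u θ w b) : (h.toMHD hT).Adm K δ := by
  have h0 : (0:ℝ) ∈ Icc 0 T := ⟨le_rfl, hT.le⟩
  refine ⟨fun x y hxy => ?_, fun x => ?_, fun x => ?_⟩
  · obtain ⟨i1, i2, i3, i4, i5, i6, i7, i8, i9, i10⟩ := h.sq_int 0 h0
    refine le_trans ?_ ha.1
    simp only [sInt, toMHD, clampTime_eq h0, comp_zero, comp_one]
    rw [intervalIntegral.integral_of_le hxy]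
    refine setIntegral_le_integral (((((((((i1.add i2).add i3).add i4).add i5).add i6).add i7).add
      i8).add i9).add i10) (Eventually.of_forall fun z => ?_)
    simp only [Pi.zero_apply]
    positivity
  · simpa [toMHD, clampTime_eq h0] using ha.2.1 x
  · simpa [toMHD, clampTime_eq h0] using ha.2.2 x

end IsClassicalSolution

end Extension

/-! ### Cut-off functions -/

/-- The function `1 - (x / R)²`, positive on `(-R, R)`; its square is the cut-off used below. -/
def cut (R x : ℝ) : ℝ := 1 - (x / R) ^ 2

/-- Derivative of `cut R ^ 2`. -/
def cutD (R x : ℝ) : ℝ := -(4 * x / R ^ 2) * cut R x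

section Cut

variable {R x : ℝ}

@[fun_prop]
lemma continuous_cut : Continuous (cut R) := by unfold cut; fun_prop

@[fun_prop]
lemma continuous_cutD : Continuous (cutD R) := by unfold cutD; fun_prop

lemma hasDerivAt_cut (R x : ℝ) : HasDerivAt (cut R) (-(2 * x / R ^ 2)) x := by
  unfold cut
  have := (((hasDerivAt_id x).div_const R).pow 2).const_sub 1
  refine this.congr_deriv ?_
  simp
  ring

lemma hasDerivAt_cut_sq (R x : ℝ) : HasDerivAt (fun y => cut R y ^ 2) (cutD R x) x := by
  refine ((hasDerivAt_cut R x).fun_pow 2).congr_deriv ?_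
  simp [cutD]
  ring

lemma cut_self (hR : 0 < R) : cut R R = 0 := by simp [cut, hR.ne']

lemma cut_neg_self (hR : 0 < R) : cut R (-R) = 0 := by simp [cut, hR.ne']

lemma cut_nonneg (hR : 0 < R) (hx : x ∈ Icc (-R) R) : 0 ≤ cut R x := by
  have : (x / R) ^ 2 ≤ 1 := by
    rw [sq_le_one_iff_abs_le_one, abs_div, abs_of_pos hR, div_le_one hR]
    exact abs_le.2 hx
  unfold cut
  linarith

lemma cut_le_one : cut R x ≤ 1 := by
  unfold cut
  nlinarith [sq_nonneg (x / R)]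

lemma half_le_cut_sq (hR : 0 < R) (hx : |x| ≤ R / 2) : 1 / 2 ≤ cut R x ^ 2 := by
  have h : (x / R) ^ 2 ≤ 1 / 4 := by
    have h1 : |x / R| ≤ 1 / 2 := by
      rw [abs_div, abs_of_pos hR, div_le_iff₀ hR]
      linarith
    have := sq_abs (x / R)
    have := abs_nonneg (x / R)
    nlinarith
  have : 3 / 4 ≤ cut R x := by unfold cut; linarith
  nlinarith

lemma abs_cutD (hR : 0 < R) (hx : x ∈ Icc (-R) R) : |cutD R x| = 4 * |x| / R ^ 2 * cut R x := by
  unfold cutD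
  rw [abs_mul, abs_neg, abs_div, abs_mul, abs_of_nonneg (cut_nonneg hR hx),
    abs_of_pos (by positivity : 0 < R ^ 2)]
  norm_num

lemma abs_cutD_le (hR : 0 < R) (hx : x ∈ Icc (-R) R) : |cutD R x| ≤ 4 / R * cut R x := by
  rw [abs_cutD hR hx]
  refine mul_le_mul_of_nonneg_right ?_ (cut_nonneg hR hx)
  rw [div_le_div_iff₀ (by positivity) hR]
  have : |x| ≤ R := abs_le.2 hx
  nlinarith [mul_le_mul_of_nonneg_left this hR.le]

end Cut

/-! ### Qualitative bounds -/

/-- Boundedness on the strip `ℝ × [0, T]`. -/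
def BddStrip (T : ℝ) (g : ℝ × ℝ → ℝ) : Prop := ∃ B : ℝ, ∀ x, ∀ t ∈ Icc 0 T, |g (x, t)| ≤ B

namespace BddStrip

variable {T : ℝ} {f g : ℝ × ℝ → ℝ}

lemma mul (hf : BddStrip T f) (hg : BddStrip T g) : BddStrip T fun p => f p * g p := by
  obtain ⟨A, hA⟩ := hf
  obtain ⟨B, hB⟩ := hg
  refine ⟨A * B, fun x t ht => ?_⟩
  rw [abs_mul]
  exact mul_le_mul (hA x t ht) (hB x t ht) (abs_nonneg _) ((abs_nonneg _).trans (hA x t ht))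

lemma add (hf : BddStrip T f) (hg : BddStrip T g) : BddStrip T fun p => f p + g p := by
  obtain ⟨A, hA⟩ := hf
  obtain ⟨B, hB⟩ := hg
  exact ⟨A + B, fun x t ht => (abs_add_le _ _).trans (add_le_add (hA x t ht) (hB x t ht))⟩

lemma sub (hf : BddStrip T f) (hg : BddStrip T g) : BddStrip T fun p => f p - g p := by
  obtain ⟨A, hA⟩ := hf
  obtain ⟨B, hB⟩ := hg
  exact ⟨A + B, fun x t ht => (abs_sub _ _).trans (add_le_add (hA x t ht) (hB x t ht))⟩

lemma const (c : ℝ) : BddStrip T fun _ => c := ⟨|c|, fun _ _ _ => le_rfl⟩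

lemma eventually (hf : BddStrip T f) :
    ∀ᶠ B in atTop, ∀ x, ∀ t ∈ Icc 0 T, |f (x, t)| ≤ B := by
  obtain ⟨A, hA⟩ := hf
  filter_upwards [eventually_ge_atTop A] with B hB x t ht
  exact (hA x t ht).trans hB

lemma of_far (hf : Continuous f) {M A : ℝ} (h : ∀ x t, M ≤ |x| → |f (x, t)| ≤ A) :
    BddStrip T f := by
  obtain ⟨C, hC⟩ := ((isCompact_Icc (a := -M) (b := M)).prod
    (isCompact_Icc (a := 0) (b := T))).exists_bound_of_continuousOn hf.continuousOn
  refine ⟨max A C, fun x t ht => ?_⟩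
  rcases le_total M |x| with hx | hx
  · exact (h x t hx).trans (le_max_left _ _)
  · exact (hC (x, t) ⟨abs_le.1 hx, ht⟩).trans (le_max_right _ _)

/-- Composition with a function continuous on `(0, ∞)`. -/
lemma comp (hf0 : ∀ p, 0 < f p) (hf : BddStrip T f) (hf' : BddStrip T fun p => (f p)⁻¹)
    {h : ℝ → ℝ} (hh : ContinuousOn h (Ioi 0)) : BddStrip T fun p => h (f p) := by
  obtain ⟨B, hB⟩ := ((hf.eventually.and hf'.eventually).and (eventually_ge_atTop 1)).exists
  have hB0 : 0 < B := by linarith [hB.2]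
  obtain ⟨C, hC⟩ := (isCompact_Icc (a := B⁻¹) (b := B)).exists_bound_of_continuousOn
    (hh.mono fun z hz => lt_of_lt_of_le (by positivity) hz.1)
  refine ⟨C, fun x t ht => hC _ ⟨?_, (le_abs_self _).trans (hB.1.1 x t ht)⟩⟩
  exact inv_le_of_inv_le₀ (hf0 _) ((le_abs_self _).trans (hB.1.2 x t ht))

end BddStrip

lemma abs_inv_sub_one_le {z : ℝ} (h : |z - 1| < 1 / 3) : |z⁻¹| ≤ 2 := by
  have := abs_lt.1 h
  rw [abs_of_pos (inv_pos.2 (by linarith))]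
  exact inv_le_of_inv_le₀ (by norm_num) (by linarith)

namespace MHD

variable {α β T : ℝ} (s : MHD α β T)

lemma bdd_v : BddStrip T s.v := by
  obtain ⟨M, hM⟩ := s.far 1 one_pos
  refine .of_far s.hv (M := M) (A := 2) fun x t hx => ?_
  have := abs_lt.1 (hM x t hx).1
  exact abs_le.2 ⟨by linarith, by linarith⟩

lemma bdd_inv_v : BddStrip T fun p => (s.v p)⁻¹ := by
  obtain ⟨M, hM⟩ := s.far (1 / 3) (by norm_num)
  exact .of_far (s.hv.inv₀ fun p => (s.v_pos p).ne') (M := M)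
    fun x t hx => abs_inv_sub_one_le (hM x t hx).1

lemma bdd_θ : BddStrip T s.θ := by
  obtain ⟨M, hM⟩ := s.far 1 one_pos
  refine .of_far s.hθ (M := M) (A := 2) fun x t hx => ?_
  have := abs_lt.1 (hM x t hx).2.2.1
  exact abs_le.2 ⟨by linarith, by linarith⟩

lemma bdd_inv_θ : BddStrip T fun p => (s.θ p)⁻¹ := by
  obtain ⟨M, hM⟩ := s.far (1 / 3) (by norm_num)
  exact .of_far (s.hθ.inv₀ fun p => (s.θ_pos p).ne') (M := M)
    fun x t hx => abs_inv_sub_one_le (hM x t hx).2.2.1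

lemma bdd_u : BddStrip T s.u := by
  obtain ⟨M, hM⟩ := s.far 1 one_pos
  exact .of_far s.hu (M := M) fun x t hx => (hM x t hx).2.1.le

lemma bdd_b (i : Fin 2) : BddStrip T (s.b i) := by
  obtain ⟨M, hM⟩ := s.far 1 one_pos
  exact .of_far (s.hb i) (M := M) fun x t hx => ((hM x t hx).2.2.2 i).1.le

lemma bdd_w (i : Fin 2) : BddStrip T (s.w i) := by
  obtain ⟨M, hM⟩ := s.far 1 one_pos
  exact .of_far (s.hw i) (M := M) fun x t hx => ((hM x t hx).2.2.2 i).2.le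

/-! ### Auxiliary quantities -/

/-- Viscosity coefficient along the solution. -/
def mu (p : ℝ × ℝ) : ℝ := visc α (s.v p)

/-- Total pressure. -/
def P (p : ℝ × ℝ) : ℝ := s.θ p / s.v p + (s.b 0 p ^ 2 + s.b 1 p ^ 2) / 2

/-- Total stress. -/
def sig (p : ℝ × ℝ) : ℝ := s.mu p * s.ux p / s.v p - s.P p

/-- Sum of the squares of the transverse gradients. -/
def tr (p : ℝ × ℝ) : ℝ := (s.wx 0 p ^ 2 + s.wx 1 p ^ 2) + (s.bx 0 p ^ 2 + s.bx 1 p ^ 2)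

/-- Dissipation (before division by `v`). -/
def S (p : ℝ × ℝ) : ℝ := s.mu p * s.ux p ^ 2 + s.tr p

lemma continuousOn_visc : ContinuousOn (visc α) (Ioi 0) := by
  unfold visc
  exact continuousOn_const.add (continuousOn_const.mul
    (continuousOn_id.rpow_const fun z hz => Or.inl (ne_of_gt hz)))

@[fun_prop]
lemma continuous_mu : Continuous s.mu :=
  continuousOn_visc.comp_continuous s.hv s.v_pos

@[fun_prop]
lemma continuous_P : Continuous s.P := by
  unfold P
  fun_prop (disch := intro; exact (s.v_pos _).ne')

@[fun_prop]
lemma continuous_sig : Continuous s.sig := by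
  unfold sig
  fun_prop (disch := intro; exact (s.v_pos _).ne')

@[fun_prop]
lemma continuous_tr : Continuous s.tr := by
  unfold tr
  fun_prop

@[fun_prop]
lemma continuous_S : Continuous s.S := by
  unfold S
  fun_prop

lemma one_le_mu (hα : 0 ≤ α) (p : ℝ × ℝ) : 1 ≤ s.mu p := by
  have := Real.rpow_nonneg (s.v_pos p).le (-α)
  unfold mu visc
  nlinarith [mul_nonneg hα this]

lemma tr_nonneg (p : ℝ × ℝ) : 0 ≤ s.tr p := by
  unfold tr
  positivity

lemma S_nonneg (hα : 0 ≤ α) (p : ℝ × ℝ) : 0 ≤ s.S p := by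
  have := s.one_le_mu hα p
  have := s.tr_nonneg p
  unfold S
  positivity

/-! ### The localized energy inequality -/

section Energy

variable (f f' Φ : ℝ → ℝ)

/-- Energy density with entropy `Φ`. -/
def energy (p : ℝ × ℝ) : ℝ :=
  (s.u p ^ 2 + s.v p * (s.b 0 p ^ 2 + s.b 1 p ^ 2) + (s.w 0 p ^ 2 + s.w 1 p ^ 2)) / 2
    + Φ (s.θ p) + (s.v p - 1 - Real.log (s.v p))

/-- Dissipation rate of the energy with entropy of derivative `f`. -/
def dissip (p : ℝ × ℝ) : ℝ :=
  (1 - f (s.θ p)) * s.S p / s.v p + f' (s.θ p) * s.θ p ^ β * s.θx p ^ 2 / s.v p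

/-- Source term in the energy balance. -/
def source (p : ℝ × ℝ) : ℝ := ((1 - f (s.θ p)) * s.θ p - 1) * s.ux p / s.v p

/-- Time derivative of the energy density. -/
def energyT (p : ℝ × ℝ) : ℝ :=
  s.u p * s.ut p + s.ux p * (s.b 0 p ^ 2 + s.b 1 p ^ 2) / 2
    + s.v p * (s.b 0 p * s.bt 0 p + s.b 1 p * s.bt 1 p)
    + (s.w 0 p * s.wt 0 p + s.w 1 p * s.wt 1 p) + f (s.θ p) * s.θt p
    + (s.ux p - s.ux p / s.v p)

/-- Energy flux. -/
def eflux (p : ℝ × ℝ) : ℝ :=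
  s.u p * (s.sig p + 1) + (s.w 0 p * s.b 0 p + s.w 1 p * s.b 1 p)
    + (s.b 0 p * (s.bx 0 p / s.v p) + s.b 1 p * (s.bx 1 p / s.v p))
    + (s.w 0 p * (s.wx 0 p / s.v p) + s.w 1 p * (s.wx 1 p / s.v p))
    + f (s.θ p) * (s.θ p ^ β * s.θx p / s.v p)

/-- Space derivative of the energy flux. -/
def efluxX (p : ℝ × ℝ) : ℝ :=
  (s.ux p * (s.sig p + 1) + s.u p * s.ut p)
    + ((s.wx 0 p * s.b 0 p + s.w 0 p * s.bx 0 p) + (s.wx 1 p * s.b 1 p + s.w 1 p * s.bx 1 p))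
    + ((s.bx 0 p * (s.bx 0 p / s.v p)
        + s.b 0 p * (s.v p * s.bt 0 p + s.ux p * s.b 0 p - s.wx 0 p))
      + (s.bx 1 p * (s.bx 1 p / s.v p)
        + s.b 1 p * (s.v p * s.bt 1 p + s.ux p * s.b 1 p - s.wx 1 p)))
    + ((s.wx 0 p * (s.wx 0 p / s.v p) + s.w 0 p * (s.wt 0 p - s.bx 0 p))
      + (s.wx 1 p * (s.wx 1 p / s.v p) + s.w 1 p * (s.wt 1 p - s.bx 1 p)))
    + (f' (s.θ p) * s.θx p * (s.θ p ^ β * s.θx p / s.v p)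
      + f (s.θ p) * (s.θt p + s.θ p / s.v p * s.ux p - s.S p / s.v p))

variable {f f' Φ}

lemma energyT_eq (p : ℝ × ℝ) :
    s.energyT f p = s.efluxX f f' p - s.dissip f f' p + s.source f p := by
  have := (s.v_pos p).ne'
  unfold energyT efluxX dissip source S tr sig P
  field_simp
  ring

lemma hasDerivAt_eflux (hf : ∀ z, 0 < z → HasDerivAt f (f' z) z) (x t : ℝ) :
    HasDerivAt (fun y => s.eflux f (y, t)) (s.efluxX f f' (x, t)) x := by
  have h1 : HasDerivAt (fun y => s.sig (y, t)) (s.ut (x, t)) x := s.dmom x t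
  have h2 := (s.dtemp x t)
  have h3 : HasDerivAt (fun y => f (s.θ (y, t))) (f' (s.θ (x, t)) * s.θx (x, t)) x :=
    (hf _ (s.θ_pos _)).comp x (s.dθx x t)
  have := ((((((s.dux x t).mul (h1.add_const 1)).add
    (((s.dwx 0 x t).mul (s.dbx 0 x t)).add ((s.dwx 1 x t).mul (s.dbx 1 x t)))).add
    (((s.dbx 0 x t).mul (s.dflux_b 0 x t)).add ((s.dbx 1 x t).mul (s.dflux_b 1 x t)))).add
    (((s.dwx 0 x t).mul (s.dflux_w 0 x t)).add ((s.dwx 1 x t).mul (s.dflux_w 1 x t)))).add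
    (h3.mul h2))
  refine (this.congr_deriv ?_)
  unfold efluxX S tr mu
  ring

lemma hasDerivAt_energy (hΦ : ∀ z, 0 < z → HasDerivAt Φ (f z) z) (x : ℝ) {t : ℝ}
    (ht : t ∈ Ioo 0 T) :
    HasDerivAt (fun τ => s.energy Φ (x, τ)) (s.energyT f (x, t)) t := by
  have hv := s.v_pos (x, t)
  have h3 : HasDerivAt (fun τ => Φ (s.θ (x, τ))) (f (s.θ (x, t)) * s.θt (x, t)) t :=
    (hΦ _ (s.θ_pos _)).comp t (s.dθt x t ht)
  have h4 := (s.dvt x t ht).log hv.ne'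
  have := (((((s.dut x t ht).fun_pow 2).add ((s.dvt x t ht).mul
    (((s.dbt 0 x t ht).fun_pow 2).add ((s.dbt 1 x t ht).fun_pow 2)))).add
    (((s.dwt 0 x t ht).fun_pow 2).add ((s.dwt 1 x t ht).fun_pow 2))).div_const 2 |>.add h3).add
    (((s.dvt x t ht).sub_const 1).sub h4)
  refine this.congr_deriv ?_
  unfold energyT
  simp
  ring

lemma continuous_comp_θ {h : ℝ → ℝ} (hh : ContinuousOn h (Ioi 0)) :
    Continuous fun p => h (s.θ p) := hh.comp_continuous s.hθ s.θ_pos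

lemma continuous_comp_v {h : ℝ → ℝ} (hh : ContinuousOn h (Ioi 0)) :
    Continuous fun p => h (s.v p) := hh.comp_continuous s.hv s.v_pos

@[fun_prop]
lemma continuous_rpow_θ (r : ℝ) : Continuous fun p => s.θ p ^ r :=
  s.continuous_comp_θ (continuousOn_id.rpow_const fun _ hz => Or.inl (ne_of_gt hz))

@[fun_prop]
lemma continuous_log_v : Continuous fun p => Real.log (s.v p) :=
  s.hv.log fun p => (s.v_pos p).ne'

end Energy

end MHD

namespace MHD

variable {α β T : ℝ} (s : MHD α β T)

/-- A weight function `f = Φ'` on `(0, ∞)`, increasing and less than `1`. -/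
structure IsWeight (f f' Φ : ℝ → ℝ) : Prop where
  df : ∀ z, 0 < z → HasDerivAt f (f' z) z
  dΦ : ∀ z, 0 < z → HasDerivAt Φ (f z) z
  cont : ContinuousOn f' (Ioi 0)
  lt_one : ∀ z, 0 < z → f z < 1
  pos : ∀ z, 0 < z → 0 < f' z

namespace IsWeight

variable {f f' Φ : ℝ → ℝ}

lemma cont_f (hf : IsWeight f f' Φ) : ContinuousOn f (Ioi 0) :=
  fun z hz => (hf.df z hz).continuousAt.continuousWithinAt

lemma cont_Φ (hf : IsWeight f f' Φ) : ContinuousOn Φ (Ioi 0) :=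
  fun z hz => (hf.dΦ z hz).continuousAt.continuousWithinAt

end IsWeight

variable {f f' Φ : ℝ → ℝ}

lemma continuous_dissip (hf : IsWeight f f' Φ) : Continuous (s.dissip f f') := by
  obtain ⟨F, hF, eF⟩ : ∃ F, Continuous F ∧ ∀ p, f (s.θ p) = F p :=
    ⟨_, s.continuous_comp_θ hf.cont_f, fun _ => rfl⟩
  obtain ⟨G, hG, eG⟩ : ∃ F, Continuous F ∧ ∀ p, f' (s.θ p) = F p :=
    ⟨_, s.continuous_comp_θ hf.cont, fun _ => rfl⟩
  unfold dissip
  simp only [eF, eG]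
  fun_prop (disch := intro; exact (s.v_pos _).ne')

lemma continuous_source (hf : IsWeight f f' Φ) : Continuous (s.source f) := by
  obtain ⟨F, hF, eF⟩ : ∃ F, Continuous F ∧ ∀ p, f (s.θ p) = F p :=
    ⟨_, s.continuous_comp_θ hf.cont_f, fun _ => rfl⟩
  unfold source
  simp only [eF]
  fun_prop (disch := intro; exact (s.v_pos _).ne')

lemma continuous_energyT (hf : IsWeight f f' Φ) : Continuous (s.energyT f) := by
  obtain ⟨F, hF, eF⟩ : ∃ F, Continuous F ∧ ∀ p, f (s.θ p) = F p :=
    ⟨_, s.continuous_comp_θ hf.cont_f, fun _ => rfl⟩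
  unfold energyT
  simp only [eF]
  fun_prop (disch := intro; exact (s.v_pos _).ne')

lemma continuous_energy (hf : IsWeight f f' Φ) : Continuous (s.energy Φ) := by
  obtain ⟨H, hH, eH⟩ : ∃ F, Continuous F ∧ ∀ p, Φ (s.θ p) = F p :=
    ⟨_, s.continuous_comp_θ hf.cont_Φ, fun _ => rfl⟩
  unfold energy
  simp only [eH]
  fun_prop

lemma continuous_efluxX (hf : IsWeight f f' Φ) : Continuous (s.efluxX f f') := by
  obtain ⟨F, hF, eF⟩ : ∃ F, Continuous F ∧ ∀ p, f (s.θ p) = F p :=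
    ⟨_, s.continuous_comp_θ hf.cont_f, fun _ => rfl⟩
  obtain ⟨G, hG, eG⟩ : ∃ F, Continuous F ∧ ∀ p, f' (s.θ p) = F p :=
    ⟨_, s.continuous_comp_θ hf.cont, fun _ => rfl⟩
  unfold efluxX
  simp only [eF, eG]
  fun_prop (disch := intro; exact (s.v_pos _).ne')

lemma continuous_eflux (hf : IsWeight f f' Φ) : Continuous (s.eflux f) := by
  obtain ⟨F, hF, eF⟩ : ∃ F, Continuous F ∧ ∀ p, f (s.θ p) = F p :=
    ⟨_, s.continuous_comp_θ hf.cont_f, fun _ => rfl⟩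
  unfold eflux
  simp only [eF]
  fun_prop (disch := intro; exact (s.v_pos _).ne')

lemma dissip_nonneg (hα : 0 ≤ α) (hf : IsWeight f f' Φ) (p : ℝ × ℝ) : 0 ≤ s.dissip f f' p := by
  have h1 := hf.lt_one _ (s.θ_pos p)
  have h2 := (hf.pos _ (s.θ_pos p)).le
  have h3 := s.S_nonneg hα p
  have h4 := s.v_pos p
  have h5 := s.θ_pos p
  have h6 : 0 ≤ 1 - f (s.θ p) := by linarith
  unfold dissip
  positivity

lemma exists_bounds (hf : IsWeight f f' Φ) :
    ∃ B : ℝ, 1 ≤ B ∧ ∀ x, ∀ t ∈ Icc 0 T,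
      s.v (x, t) ≤ B ∧ (1 - f (s.θ (x, t)))⁻¹ ≤ B ∧
      (f' (s.θ (x, t)) * s.θ (x, t) ^ β)⁻¹ ≤ B ∧
      |s.u (x, t) * (s.mu (x, t) * (s.v (x, t))⁻¹)| ≤ B ∧
      (∀ i, |s.b i (x, t) * (s.v (x, t))⁻¹| ≤ B) ∧
      (∀ i, |s.w i (x, t) * (s.v (x, t))⁻¹| ≤ B) ∧
      |f (s.θ (x, t)) * s.θ (x, t) ^ β * (s.v (x, t))⁻¹| ≤ B ∧
      |1 - s.P (x, t)| ≤ B ∧ (∀ i, |s.b i (x, t)| ≤ B) := by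
  have pw : ContinuousOn (fun z : ℝ => z ^ β) (Ioi 0) :=
    continuousOn_id.rpow_const fun z hz => Or.inl (ne_of_gt hz)
  have b1 : BddStrip T fun p => (1 - f (s.θ p))⁻¹ :=
    s.bdd_θ.comp s.θ_pos s.bdd_inv_θ (h := fun z => (1 - f z)⁻¹)
      ((continuousOn_const.sub hf.cont_f).inv₀ fun z hz => by
        have := hf.lt_one z hz
        exact (by linarith : 0 < 1 - f z).ne')
  have b2 : BddStrip T fun p => (f' (s.θ p) * s.θ p ^ β)⁻¹ :=
    s.bdd_θ.comp s.θ_pos s.bdd_inv_θ (h := fun z => (f' z * z ^ β)⁻¹)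
      ((hf.cont.mul pw).inv₀ fun z hz =>
        (mul_pos (hf.pos z hz) (Real.rpow_pos_of_pos hz _)).ne')
  have b3 : BddStrip T s.mu := s.bdd_v.comp s.v_pos s.bdd_inv_v continuousOn_visc
  have b4 : BddStrip T fun p => f (s.θ p) * s.θ p ^ β :=
    s.bdd_θ.comp s.θ_pos s.bdd_inv_θ (h := fun z => f z * z ^ β) (hf.cont_f.mul pw)
  have bsq : ∀ i, BddStrip T fun p => s.b i p * s.b i p := fun i => (s.bdd_b i).mul (s.bdd_b i)
  have b5 : BddStrip T fun p => 1 - (s.θ p * (s.v p)⁻¹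
      + (s.b 0 p * s.b 0 p + s.b 1 p * s.b 1 p) * 2⁻¹) :=
    (BddStrip.const 1).sub ((s.bdd_θ.mul s.bdd_inv_v).add
      (((bsq 0).add (bsq 1)).mul (BddStrip.const _)))
  obtain ⟨B, h0, h1, h2, h3, h4, h5, h6, h7, h8, h9⟩ := ((eventually_ge_atTop (1:ℝ)).and
    (s.bdd_v.eventually.and (b1.eventually.and (b2.eventually.and
    ((s.bdd_u.mul (b3.mul s.bdd_inv_v)).eventually.and
    ((eventually_all.2 fun i => ((s.bdd_b i).mul s.bdd_inv_v).eventually).and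
    ((eventually_all.2 fun i => ((s.bdd_w i).mul s.bdd_inv_v).eventually).and
    ((b4.mul s.bdd_inv_v).eventually.and (b5.eventually.and
    (eventually_all.2 fun i => (s.bdd_b i).eventually)))))))))).exists
  refine ⟨B, h0, fun x t ht => ⟨(le_abs_self _).trans (h1 x t ht),
    (le_abs_self _).trans (h2 x t ht), (le_abs_self _).trans (h3 x t ht), h4 x t ht,
    fun i => h5 i x t ht, fun i => h6 i x t ht, h7 x t ht, ?_, fun i => h9 i x t ht⟩⟩
  convert h8 x t ht using 2
  unfold P
  ring

lemma abs_cut_mul_le {B R ζ c y : ℝ} (hB : 1 ≤ B) (hR : 0 < R) (hζ : 0 ≤ ζ) (hc : |c| ≤ B) :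
    4 / R * ζ * |c * y| ≤ (ζ ^ 2 * (B⁻¹ ^ 2 * y ^ 2)) / 2 + 8 * B ^ 4 / R ^ 2 := by
  have hB0 : 0 < B := by linarith
  have h1 : 4 / R * ζ * |c * y| ≤ 4 / R * ζ * (B * |y|) := by
    rw [abs_mul]
    gcongr
  have h2 := sq_nonneg (ζ * |y| / B - 4 * B ^ 2 / R)
  have h3 : (ζ * |y| / B - 4 * B ^ 2 / R) ^ 2
      = 2 * ((ζ ^ 2 * (B⁻¹ ^ 2 * y ^ 2)) / 2 + 8 * B ^ 4 / R ^ 2 - 4 / R * ζ * (B * |y|)) := by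
    have : y ^ 2 = |y| ^ 2 := (sq_abs y).symm
    rw [this]
    field_simp
    ring
  linarith

lemma le_dissip (hα : 0 ≤ α) (hf : IsWeight f f' Φ) {B : ℝ} (hB : 1 ≤ B) {p : ℝ × ℝ}
    (h1 : s.v p ≤ B) (h2 : (1 - f (s.θ p))⁻¹ ≤ B) (h3 : (f' (s.θ p) * s.θ p ^ β)⁻¹ ≤ B) :
    B⁻¹ ^ 2 * (s.ux p ^ 2 + s.tr p + s.θx p ^ 2) ≤ s.dissip f f' p := by
  have hB0 : 0 < B := by linarith
  have hv := s.v_pos p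
  have e1 : 0 < 1 - f (s.θ p) := by linarith [hf.lt_one _ (s.θ_pos p)]
  have e2 : 0 < f' (s.θ p) * s.θ p ^ β :=
    mul_pos (hf.pos _ (s.θ_pos p)) (Real.rpow_pos_of_pos (s.θ_pos p) _)
  have g1 : B⁻¹ ≤ 1 - f (s.θ p) := inv_le_of_inv_le₀ e1 h2
  have g2 : B⁻¹ ≤ f' (s.θ p) * s.θ p ^ β := inv_le_of_inv_le₀ e2 h3
  have g3 : B⁻¹ ≤ (s.v p)⁻¹ := inv_anti₀ hv h1
  have g4 : s.ux p ^ 2 + s.tr p ≤ s.S p := by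
    unfold S
    nlinarith [s.one_le_mu hα p, sq_nonneg (s.ux p)]
  have g5 : 0 ≤ s.ux p ^ 2 + s.tr p := add_nonneg (sq_nonneg _) (s.tr_nonneg p)
  have g6 : 0 ≤ (1 - f (s.θ p)) * s.S p := mul_nonneg e1.le (s.S_nonneg hα p)
  have i1 : B⁻¹ ^ 2 * (s.ux p ^ 2 + s.tr p) ≤ (1 - f (s.θ p)) * s.S p / s.v p := by
    calc _ = B⁻¹ * (s.ux p ^ 2 + s.tr p) * B⁻¹ := by ring
      _ ≤ (1 - f (s.θ p)) * s.S p * (s.v p)⁻¹ := by gcongr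
  have i2 : B⁻¹ ^ 2 * s.θx p ^ 2 ≤ f' (s.θ p) * s.θ p ^ β * s.θx p ^ 2 / s.v p := by
    calc _ = B⁻¹ * s.θx p ^ 2 * B⁻¹ := by ring
      _ ≤ (f' (s.θ p) * s.θ p ^ β) * s.θx p ^ 2 * (s.v p)⁻¹ := by gcongr
  unfold dissip
  linarith

lemma exists_eflux_bound (hα : 0 ≤ α) (hT : 0 < T) (hf : IsWeight f f' Φ) :
    ∃ R₀ > 0, ∀ R ≥ R₀, ∃ c : ℝ, 0 ≤ c ∧ 2 * R * T * c ≤ 1 ∧ ∀ x ∈ Icc (-R) R, ∀ t ∈ Icc 0 T,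
      |cutD R x * s.eflux f (x, t)| ≤ (cut R x ^ 2 * s.dissip f f' (x, t)) / 2 + c := by
  obtain ⟨B, hB, hbd⟩ := s.exists_bounds hf
  have hB0 : 0 < B := by linarith
  set ε : ℝ := 1 / (24 * T) with hε
  have hε0 : 0 < ε := by positivity
  obtain ⟨M, hM⟩ := s.far (ε / (3 * B)) (by positivity)
  have hfarbd : BddStrip T fun p => s.u p * (1 - s.P p) + (s.w 0 p * s.b 0 p
      + s.w 1 p * s.b 1 p) :=
    (s.bdd_u.mul ⟨B, fun x t ht => (hbd x t ht).2.2.2.2.2.2.2.1⟩).add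
      (((s.bdd_w 0).mul (s.bdd_b 0)).add ((s.bdd_w 1).mul (s.bdd_b 1)))
  obtain ⟨A, hA, hA0⟩ := (hfarbd.eventually.and (eventually_ge_atTop (0:ℝ))).exists
  have hM0 : 0 ≤ |M| := abs_nonneg M
  set Q : ℝ := 96 * T * B ^ 4 + 8 * T * |M| * A with hQ
  have hQ0 : 0 ≤ Q := by positivity
  refine ⟨1 + 2 * Q, by positivity, fun R hR => ?_⟩
  have hR0 : 0 < R := by linarith
  refine ⟨6 * (8 * B ^ 4 / R ^ 2) + (4 * ε / R + 4 * |M| * A / R ^ 2), by positivity, ?_, ?_⟩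
  · have : 2 * R * T * (6 * (8 * B ^ 4 / R ^ 2) + (4 * ε / R + 4 * |M| * A / R ^ 2))
        = Q / R + 1 / 3 := by
      rw [hQ, hε]
      field_simp
      ring
    rw [this]
    have : Q / R ≤ 1 / 2 := by
      rw [div_le_iff₀ hR0]
      linarith
    linarith
  · intro x hx t ht
    obtain ⟨h1, h2, h3, h4, h5, h6, h7, h8, h9⟩ := hbd x t ht
    have hζ := cut_nonneg hR0 hx
    have hD := s.le_dissip hα hf hB h1 h2 h3
    have hfar : |cutD R x| * |s.u (x, t) * (1 - s.P (x, t)) + (s.w 0 (x, t) * s.b 0 (x, t)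
        + s.w 1 (x, t) * s.b 1 (x, t))| ≤ 4 * ε / R + 4 * |M| * A / R ^ 2 := by
      rcases le_total M |x| with hMx | hMx
      · obtain ⟨-, f2, -, f4⟩ := hM x t hMx
        have k1 : |s.u (x, t) * (1 - s.P (x, t)) + (s.w 0 (x, t) * s.b 0 (x, t)
            + s.w 1 (x, t) * s.b 1 (x, t))| ≤ ε := by
          have e : ε = ε / (3 * B) * B + (ε / (3 * B) * B + ε / (3 * B) * B) := by
            field_simp
            ring
          rw [e]
          refine (abs_add_le _ _).trans (add_le_add ?_ ((abs_add_le _ _).trans (add_le_add ?_ ?_)))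
          · rw [abs_mul]
            exact mul_le_mul f2.le h8 (abs_nonneg _) (by positivity)
          · rw [abs_mul]
            exact mul_le_mul (f4 0).2.le (h9 0) (abs_nonneg _) (by positivity)
          · rw [abs_mul]
            exact mul_le_mul (f4 1).2.le (h9 1) (abs_nonneg _) (by positivity)
        have k2 : |cutD R x| ≤ 4 / R := (abs_cutD_le hR0 hx).trans
          (mul_le_of_le_one_right (by positivity) cut_le_one)
        calc _ ≤ 4 / R * ε := mul_le_mul k2 k1 (abs_nonneg _) (by positivity)
          _ = 4 * ε / R := by ring
          _ ≤ _ := le_add_of_nonneg_right (by positivity)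
      · have k2 : |cutD R x| ≤ 4 * |M| / R ^ 2 := by
          rw [abs_cutD hR0 hx]
          refine (mul_le_of_le_one_right (by positivity) cut_le_one).trans ?_
          have := hMx.trans (le_abs_self M)
          gcongr
        calc _ ≤ 4 * |M| / R ^ 2 * A := mul_le_mul k2 (hA x t ht) (abs_nonneg _) (by positivity)
          _ = 4 * |M| * A / R ^ 2 := by ring
          _ ≤ _ := le_add_of_nonneg_left (by positivity)
    have e : s.eflux f (x, t) = (s.u (x, t) * (s.mu (x, t) * (s.v (x, t))⁻¹)) * s.ux (x, t)
        + (s.b 0 (x, t) * (s.v (x, t))⁻¹) * s.bx 0 (x, t)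
        + (s.b 1 (x, t) * (s.v (x, t))⁻¹) * s.bx 1 (x, t)
        + (s.w 0 (x, t) * (s.v (x, t))⁻¹) * s.wx 0 (x, t)
        + (s.w 1 (x, t) * (s.v (x, t))⁻¹) * s.wx 1 (x, t)
        + (f (s.θ (x, t)) * s.θ (x, t) ^ β * (s.v (x, t))⁻¹) * s.θx (x, t)
        + (s.u (x, t) * (1 - s.P (x, t)) + (s.w 0 (x, t) * s.b 0 (x, t)
        + s.w 1 (x, t) * s.b 1 (x, t))) := by
      unfold eflux sig
      ring
    have t1 := abs_cut_mul_le (y := s.ux (x, t)) hB hR0 hζ h4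
    have t2 := abs_cut_mul_le (y := s.bx 0 (x, t)) hB hR0 hζ (h5 0)
    have t3 := abs_cut_mul_le (y := s.bx 1 (x, t)) hB hR0 hζ (h5 1)
    have t4 := abs_cut_mul_le (y := s.wx 0 (x, t)) hB hR0 hζ (h6 0)
    have t5 := abs_cut_mul_le (y := s.wx 1 (x, t)) hB hR0 hζ (h6 1)
    have t6 := abs_cut_mul_le (y := s.θx (x, t)) hB hR0 hζ h7
    have hD2 := mul_le_mul_of_nonneg_left hD (sq_nonneg (cut R x))
    have hlin : ∀ a : ℝ, |cutD R x| * |a| ≤ 4 / R * cut R x * |a| := fun a =>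
      mul_le_mul_of_nonneg_right (abs_cutD_le hR0 hx) (abs_nonneg _)
    rw [abs_mul, e]
    set a1 := (s.u (x, t) * (s.mu (x, t) * (s.v (x, t))⁻¹)) * s.ux (x, t)
    set a2 := (s.b 0 (x, t) * (s.v (x, t))⁻¹) * s.bx 0 (x, t)
    set a3 := (s.b 1 (x, t) * (s.v (x, t))⁻¹) * s.bx 1 (x, t)
    set a4 := (s.w 0 (x, t) * (s.v (x, t))⁻¹) * s.wx 0 (x, t)
    set a5 := (s.w 1 (x, t) * (s.v (x, t))⁻¹) * s.wx 1 (x, t)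
    set a6 := (f (s.θ (x, t)) * s.θ (x, t) ^ β * (s.v (x, t))⁻¹) * s.θx (x, t)
    set a7 := s.u (x, t) * (1 - s.P (x, t)) + (s.w 0 (x, t) * s.b 0 (x, t)
        + s.w 1 (x, t) * s.b 1 (x, t))
    have tri : |a1 + a2 + a3 + a4 + a5 + a6 + a7| ≤ |a1| + |a2| + |a3| + |a4| + |a5| + |a6| + |a7| := by
      have := abs_add_le (a1 + a2 + a3 + a4 + a5 + a6) a7
      have := abs_add_le (a1 + a2 + a3 + a4 + a5) a6
      have := abs_add_le (a1 + a2 + a3 + a4) a5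
      have := abs_add_le (a1 + a2 + a3) a4
      have := abs_add_le (a1 + a2) a3
      have := abs_add_le a1 a2
      linarith
    have tri' := mul_le_mul_of_nonneg_left tri (abs_nonneg (cutD R x))
    simp only [mul_add] at tri'
    have htr : cut R x ^ 2 * (B⁻¹ ^ 2 * (s.ux (x, t) ^ 2 + s.tr (x, t) + s.θx (x, t) ^ 2))
        = cut R x ^ 2 * (B⁻¹ ^ 2 * s.ux (x, t) ^ 2) + cut R x ^ 2 * (B⁻¹ ^ 2 * s.bx 0 (x, t) ^ 2)
        + cut R x ^ 2 * (B⁻¹ ^ 2 * s.bx 1 (x, t) ^ 2)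
        + cut R x ^ 2 * (B⁻¹ ^ 2 * s.wx 0 (x, t) ^ 2)
        + cut R x ^ 2 * (B⁻¹ ^ 2 * s.wx 1 (x, t) ^ 2)
        + cut R x ^ 2 * (B⁻¹ ^ 2 * s.θx (x, t) ^ 2) := by
      unfold tr
      ring
    rw [htr] at hD2
    linarith [hlin a1, hlin a2, hlin a3, hlin a4, hlin a5, hlin a6]

/-- The localized energy inequality. -/
theorem localized_energy (hα : 0 ≤ α) (hT : 0 < T) (hf : IsWeight f f' Φ) :
    ∃ R₀ > 0, ∀ R ≥ R₀, ∀ t ∈ Icc 0 T,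
      sInt (fun p => cut R p.1 ^ 2 * s.energy Φ p) (-R) R t
        + dInt (fun p => cut R p.1 ^ 2 * s.dissip f f' p) (-R) R t / 2
      ≤ sInt (fun p => cut R p.1 ^ 2 * s.energy Φ p) (-R) R 0
        + dInt (fun p => cut R p.1 ^ 2 * s.source f p) (-R) R t + 1 := by
  obtain ⟨R₀, hR₀, h⟩ := s.exists_eflux_bound hα hT hf
  refine ⟨R₀, hR₀, fun R hR t ht => ?_⟩
  obtain ⟨c, hc0, hc, hcb⟩ := h R hR
  have hRpos : 0 < R := by linarith
  have hab : -R ≤ R := by linarith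
  have cN := s.continuous_energy hf
  have cNt := s.continuous_energyT hf
  have cD := s.continuous_dissip hf
  have cX := s.continuous_source hf
  have cF := s.continuous_eflux hf
  have cFx := s.continuous_efluxX hf
  have e1 := sInt_sub_sInt_zero (a := -R) (b := R) (N := fun p => cut R p.1 ^ 2 * s.energy Φ p)
    (Nt := fun p => cut R p.1 ^ 2 * s.energyT f p) (by fun_prop) (by fun_prop)
    (fun x τ hτ => (s.hasDerivAt_energy hf.dΦ x hτ).const_mul (cut R x ^ 2)) ht
  have e2 : dInt (fun p => cut R p.1 ^ 2 * s.energyT f p) (-R) R t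
      = dInt (fun p => cut R p.1 ^ 2 * s.efluxX f f' p) (-R) R t
        - dInt (fun p => cut R p.1 ^ 2 * s.dissip f f' p) (-R) R t
        + dInt (fun p => cut R p.1 ^ 2 * s.source f p) (-R) R t := by
    rw [← dInt_sub (by fun_prop) (by fun_prop), ← dInt_add (by fun_prop) (by fun_prop)]
    congr 1
    funext p
    rw [s.energyT_eq (f' := f')]
    ring
  have e3 : dInt (fun p => cut R p.1 ^ 2 * s.efluxX f f' p) (-R) R t
      ≤ dInt (fun p => 1 / 2 * (cut R p.1 ^ 2 * s.dissip f f' p) + c) (-R) R t := by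
    have : dInt (fun p => cut R p.1 ^ 2 * s.efluxX f f' p) (-R) R t
        = dInt (fun p => -1 * (cutD R p.1 * s.eflux f p)) (-R) R t := by
      rw [dInt_const_mul, neg_one_mul]
      unfold dInt
      rw [← intervalIntegral.integral_neg]
      refine intervalIntegral.integral_congr fun τ _ => ?_
      exact integral_mul_deriv_eq_neg (hasDerivAt_cut_sq R)
        (fun x => s.hasDerivAt_eflux hf.df x τ) (by fun_prop) (by fun_prop)
        (by simp [cut_neg_self hRpos]) (by simp [cut_self hRpos])
    rw [this]
    refine dInt_mono hab ht.1 (by fun_prop) (by fun_prop) fun x hx τ hτ => ?_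
    have := hcb x hx τ ⟨hτ.1, hτ.2.trans ht.2⟩
    have := neg_abs_le (cutD R x * s.eflux f (x, τ))
    simp only
    linarith
  rw [dInt_add (by fun_prop) (by fun_prop), dInt_const_mul, dInt_const] at e3
  have e4 : c * (R - -R) * t ≤ 1 := by
    refine le_trans ?_ hc
    nlinarith [mul_le_mul_of_nonneg_left ht.2 (mul_nonneg hc0 hRpos.le)]
  linarith

end MHD

/-! ### The basic energy estimate -/

section Localization

variable {g : ℝ × ℝ → ℝ} {C R₀ t : ℝ}

lemma sInt_le_two_mul_of_cut (hg : Continuous g) (h0 : ∀ p, 0 ≤ g p)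
    (h : ∀ R, 0 < R → R₀ ≤ R → sInt (fun p => cut R p.1 ^ 2 * g p) (-R) R t ≤ C) {a b : ℝ}
    (hab : a ≤ b) : sInt g a b t ≤ 2 * C := by
  obtain ⟨R, hR, hR0, ha, hb⟩ : ∃ R, 0 < R ∧ R₀ ≤ R ∧ 2 * |a| ≤ R ∧ 2 * |b| ≤ R :=
    ⟨|R₀| + 2 * |a| + 2 * |b| + 1, by positivity,
      by linarith [le_abs_self R₀, abs_nonneg a, abs_nonneg b],
      by linarith [abs_nonneg R₀, abs_nonneg b], by linarith [abs_nonneg R₀, abs_nonneg a]⟩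
  have h1 : sInt g a b t ≤ sInt (fun p => 2 * (cut R p.1 ^ 2 * g p)) a b t := by
    refine sInt_mono hab hg (by fun_prop) fun x hx => ?_
    have hx' : |x| ≤ R / 2 := by
      refine (abs_le_max_abs_abs hx.1 hx.2).trans (max_le ?_ ?_) <;> linarith
    have := mul_le_mul_of_nonneg_right (half_le_cut_sq hR hx') (h0 (x, t))
    simp only
    linarith
  rw [sInt_const_mul] at h1
  have h2 : sInt (fun p => cut R p.1 ^ 2 * g p) a b t
      ≤ sInt (fun p => cut R p.1 ^ 2 * g p) (-R) R t :=
    sInt_subset (by fun_prop) (fun x => mul_nonneg (sq_nonneg _) (h0 _))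
      (by linarith [neg_abs_le a, abs_nonneg a]) hab (by linarith [le_abs_self b, abs_nonneg b])
  linarith [h R hR hR0]

lemma dInt_le_two_mul_of_cut (hg : Continuous g) (h0 : ∀ p, 0 ≤ g p) (ht : 0 ≤ t)
    (h : ∀ R, 0 < R → R₀ ≤ R → dInt (fun p => cut R p.1 ^ 2 * g p) (-R) R t ≤ C) {a b : ℝ}
    (hab : a ≤ b) : dInt g a b t ≤ 2 * C := by
  obtain ⟨R, hR, hR0, ha, hb⟩ : ∃ R, 0 < R ∧ R₀ ≤ R ∧ 2 * |a| ≤ R ∧ 2 * |b| ≤ R :=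
    ⟨|R₀| + 2 * |a| + 2 * |b| + 1, by positivity,
      by linarith [le_abs_self R₀, abs_nonneg a, abs_nonneg b],
      by linarith [abs_nonneg R₀, abs_nonneg b], by linarith [abs_nonneg R₀, abs_nonneg a]⟩
  have h1 : dInt g a b t ≤ dInt (fun p => 2 * (cut R p.1 ^ 2 * g p)) a b t := by
    refine dInt_mono hab ht hg (by fun_prop) fun x hx τ _ => ?_
    have hx' : |x| ≤ R / 2 := by
      refine (abs_le_max_abs_abs hx.1 hx.2).trans (max_le ?_ ?_) <;> linarith
    have := mul_le_mul_of_nonneg_right (half_le_cut_sq hR hx') (h0 (x, τ))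
    simp only
    linarith
  rw [dInt_const_mul] at h1
  have h2 : dInt (fun p => cut R p.1 ^ 2 * g p) a b t
      ≤ dInt (fun p => cut R p.1 ^ 2 * g p) (-R) R t :=
    dInt_subset (by fun_prop) (fun p => mul_nonneg (sq_nonneg _) (h0 _))
      (by linarith [neg_abs_le a, abs_nonneg a]) hab (by linarith [le_abs_self b, abs_nonneg b]) ht
  linarith [h R hR hR0]

lemma sInt_cut_le {R : ℝ} (hg : Continuous g) (h0 : ∀ p, 0 ≤ g p) (hR : 0 < R) :
    sInt (fun p => cut R p.1 ^ 2 * g p) (-R) R t ≤ sInt g (-R) R t := by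
  refine sInt_mono (by linarith) (by fun_prop) hg fun x hx => ?_
  have h1 := cut_nonneg hR hx
  have h2 : cut R x ≤ 1 := cut_le_one
  exact mul_le_of_le_one_left (h0 _) (by nlinarith)

end Localization

/-- The convex function `z - 1 - log z`. -/
def ent (z : ℝ) : ℝ := z - 1 - Real.log z

lemma ent_nonneg {z : ℝ} (hz : 0 < z) : 0 ≤ ent z := by
  have := Real.log_le_sub_one_of_pos hz
  unfold ent
  linarith

lemma ent_le {z : ℝ} (hz : 0 < z) : ent z ≤ (z - 1) ^ 2 / z := by
  have := Real.one_sub_inv_le_log_of_pos hz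
  have e : (z - 1) ^ 2 / z = z - 1 - (1 - z⁻¹) := by
    field_simp
  unfold ent
  linarith

lemma isWeight_ent : MHD.IsWeight (fun z => 1 - z⁻¹) (fun z => (z ^ 2)⁻¹) ent where
  df z hz := by simpa using (hasDerivAt_inv hz.ne').const_sub 1
  dΦ z hz := ((hasDerivAt_id z).sub_const 1).sub (Real.hasDerivAt_log hz.ne')
  cont := (continuousOn_pow 2).inv₀ fun z hz => (pow_pos hz 2).ne'
  lt_one z hz := by simpa using hz
  pos z hz := by positivity

namespace MHD

variable {α β T K δ : ℝ}

/-- The physical energy density. -/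
def bas (s : MHD α β T) : ℝ × ℝ → ℝ := s.energy ent

@[fun_prop]
lemma continuous_bas (s : MHD α β T) : Continuous s.bas := s.continuous_energy isWeight_ent

lemma energy_nonneg (s : MHD α β T) {Φ : ℝ → ℝ} (h : ∀ z, 0 < z → 0 ≤ Φ z) (p : ℝ × ℝ) :
    0 ≤ s.energy Φ p := by
  have h1 := h _ (s.θ_pos p)
  have h2 := ent_nonneg (s.v_pos p)
  have h3 := s.v_pos p
  unfold ent at h2
  unfold energy
  positivity

lemma bas_nonneg (s : MHD α β T) (p : ℝ × ℝ) : 0 ≤ s.bas p :=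
  s.energy_nonneg (fun _ hz => ent_nonneg hz) p

lemma Adm.v_zero_le {s : MHD α β T} (hs : s.Adm K δ) (x : ℝ) : s.v (x, 0) ≤ 2 + 2 * K ^ 2 := by
  have h := sq_le_integral_add (a := x) (h := fun y => s.v (y, 0) - 1)
    (h' := fun y => s.vx (y, 0)) (fun y => (s.dvx y 0).sub_const 1) (by fun_prop)
    (x := x) ⟨le_rfl, by linarith⟩
  have h2 := hs.1 x (x + 1) (by linarith)
  have h3 : (∫ z in x..(x + 1), (s.v (z, 0) - 1) ^ 2)
      + (∫ z in x..(x + 1), 2 * |s.v (z, 0) - 1| * |s.vx (z, 0)|) ≤ 2 * K ^ 2 := by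
    rw [← intervalIntegral.integral_add
      (Continuous.intervalIntegrable (by fun_prop) _ _)
      (Continuous.intervalIntegrable (by fun_prop) _ _)]
    refine le_trans ?_ (mul_le_mul_of_nonneg_left h2 zero_le_two)
    rw [← sInt_const_mul]
    refine intervalIntegral.integral_mono_on (by linarith)
      (Continuous.intervalIntegrable (by fun_prop) _ _)
      (Continuous.intervalIntegrable (by fun_prop) _ _) fun z _ => ?_
    have := two_mul_le_add_sq |s.v (z, 0) - 1| |s.vx (z, 0)|
    rw [sq_abs, sq_abs] at this
    nlinarith [sq_nonneg (s.u (z, 0)), sq_nonneg (s.θ (z, 0) - 1), sq_nonneg (s.b 0 (z, 0)),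
      sq_nonneg (s.b 1 (z, 0)), sq_nonneg (s.w 0 (z, 0)), sq_nonneg (s.w 1 (z, 0)),
      sq_nonneg (s.vx (z, 0)), sq_nonneg (s.ux (z, 0)), sq_nonneg (s.θx (z, 0)),
      sq_nonneg (s.bx 0 (z, 0)), sq_nonneg (s.bx 1 (z, 0)), sq_nonneg (s.wx 0 (z, 0)),
      sq_nonneg (s.wx 1 (z, 0))]
  nlinarith [sq_nonneg (s.v (x, 0) - 1 - 1)]

lemma exists_bas_zero_le (hδ : 0 < δ) : ∃ C > 0, ∀ s : MHD α β T, s.Adm K δ →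
    ∀ a b, a ≤ b → sInt s.bas a b 0 ≤ C := by
  refine ⟨(2 + 2 * K ^ 2 + δ⁻¹) * K ^ 2 + 1, by positivity, fun s hs a b hab => ?_⟩
  refine le_trans (le_trans ?_ (mul_le_mul_of_nonneg_left (hs.1 a b hab)
    (by positivity : 0 ≤ 2 + 2 * K ^ 2 + δ⁻¹))) (le_add_of_nonneg_right zero_le_one)
  rw [← sInt_const_mul]
  refine sInt_mono hab (by fun_prop) (by fun_prop) fun x _ => ?_
  have hv := hs.v_zero_le x
  have i1 : ent (s.v (x, 0)) ≤ δ⁻¹ * (s.v (x, 0) - 1) ^ 2 := by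
    refine (ent_le (s.v_pos _)).trans ?_
    rw [div_eq_inv_mul]
    have := inv_anti₀ hδ (hs.2.1 x)
    gcongr
  have i2 : ent (s.θ (x, 0)) ≤ δ⁻¹ * (s.θ (x, 0) - 1) ^ 2 := by
    refine (ent_le (s.θ_pos _)).trans ?_
    rw [div_eq_inv_mul]
    have := inv_anti₀ hδ (hs.2.2 x)
    gcongr
  have i3 : s.v (x, 0) * (s.b 0 (x, 0) ^ 2 + s.b 1 (x, 0) ^ 2)
      ≤ (2 + 2 * K ^ 2) * (s.b 0 (x, 0) ^ 2 + s.b 1 (x, 0) ^ 2) := by gcongr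
  have hδ' : 0 < δ⁻¹ := by positivity
  have hK : 0 ≤ K ^ 2 := sq_nonneg K
  unfold bas energy
  change _ + ent (s.θ (x, 0)) + ent (s.v (x, 0)) ≤ _
  generalize s.v (x, 0) = v at *
  generalize s.θ (x, 0) = θ at *
  set L := 2 + 2 * K ^ 2 + δ⁻¹ with hL
  have hL1 : 1 ≤ L := by linarith
  have hL2 : δ⁻¹ ≤ L := by linarith
  have hL3 : 2 + 2 * K ^ 2 ≤ L := by linarith
  have j1 := mul_le_mul_of_nonneg_right hL2 (sq_nonneg (v - 1))
  have j2 := mul_le_mul_of_nonneg_right hL2 (sq_nonneg (θ - 1))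
  have j3 := mul_le_mul_of_nonneg_right hL3 (by positivity :
    0 ≤ s.b 0 (x, 0) ^ 2 + s.b 1 (x, 0) ^ 2)
  have j4 := mul_le_mul_of_nonneg_right hL1 (by positivity :
    0 ≤ s.w 0 (x, 0) ^ 2 + s.w 1 (x, 0) ^ 2 + s.u (x, 0) ^ 2)
  have j5 : 0 ≤ L * (s.vx (x, 0) ^ 2 + s.ux (x, 0) ^ 2
    + s.θx (x, 0) ^ 2 + (s.bx 0 (x, 0) ^ 2 + s.bx 1 (x, 0) ^ 2)
    + (s.wx 0 (x, 0) ^ 2 + s.wx 1 (x, 0) ^ 2)) := by positivity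
  have j6 : 0 ≤ s.w 0 (x, 0) ^ 2 + s.w 1 (x, 0) ^ 2 + s.u (x, 0) ^ 2 := by positivity
  have j7 : 0 ≤ L * (s.b 0 (x, 0) ^ 2 + s.b 1 (x, 0) ^ 2) := by positivity
  linarith

/-- The basic energy estimate. -/
lemma exists_bas_le (hα : 0 ≤ α) (hT : 0 < T) (hδ : 0 < δ) : ∃ C > 0, ∀ s : MHD α β T,
    s.Adm K δ → ∀ t ∈ Icc 0 T, ∀ a b, a ≤ b → sInt s.bas a b t ≤ C := by
  obtain ⟨C, hC, h⟩ := exists_bas_zero_le (α := α) (β := β) (T := T) (K := K) hδ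
  refine ⟨2 * (C + 1), by positivity, fun s hs t ht a b hab => ?_⟩
  obtain ⟨R₀, -, hR⟩ := s.localized_energy hα hT isWeight_ent
  refine sInt_le_two_mul_of_cut (R₀ := R₀) s.continuous_bas s.bas_nonneg (fun R hR0 hRR => ?_) hab
  have h1 := hR R hRR t ht
  have h2 : 0 ≤ dInt (fun p => cut R p.1 ^ 2
      * s.dissip (fun z => 1 - z⁻¹) (fun z => (z ^ 2)⁻¹) p) (-R) R t :=
    dInt_nonneg (by linarith) ht.1 fun x _ τ _ =>
      mul_nonneg (sq_nonneg _) (s.dissip_nonneg hα isWeight_ent _)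
  have h3 : dInt (fun p => cut R p.1 ^ 2 * s.source (fun z => 1 - z⁻¹) p) (-R) R t = 0 := by
    have : (fun p : ℝ × ℝ => cut R p.1 ^ 2 * s.source (fun z => 1 - z⁻¹) p) = fun _ => 0 := by
      funext p
      have := (s.θ_pos p).ne'
      simp [source, this]
    rw [this, dInt_const, zero_mul, zero_mul]
  have h4 := sInt_cut_le (t := 0) s.continuous_bas s.bas_nonneg hR0
  have h5 := h s hs (-R) R (by linarith)
  unfold bas at *
  linarith

end MHD

/-! ### Lower bound for the specific volume -/

/-- Primitive of `visc α z / z`. -/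
def viscPrim (α z : ℝ) : ℝ := Real.log z - z ^ (-α)

lemma hasDerivAt_viscPrim {α z : ℝ} (hz : 0 < z) :
    HasDerivAt (viscPrim α) (visc α z / z) z := by
  refine ((Real.hasDerivAt_log hz.ne').sub
    (Real.hasDerivAt_rpow_const (p := -α) (Or.inl hz.ne'))).congr_deriv ?_
  unfold visc
  rw [Real.rpow_sub_one hz.ne']
  field_simp
  ring

lemma viscPrim_mono {α y z : ℝ} (hα : 0 ≤ α) (hy : 0 < y) (hyz : y ≤ z) :
    viscPrim α y ≤ viscPrim α z :=
  sub_le_sub (Real.log_le_log hy hyz) (Real.rpow_le_rpow_of_nonpos hy hyz (by linarith))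

lemma exp_viscPrim_le {α z : ℝ} (hz : 0 < z) : Real.exp (viscPrim α z) ≤ z := by
  calc _ ≤ Real.exp (Real.log z) := by
        refine Real.exp_le_exp.2 (sub_le_self _ (Real.rpow_nonneg hz.le _))
    _ = z := Real.exp_log hz

lemma le_exp_viscPrim_mul {α c z : ℝ} (hα : 0 ≤ α) (hc : 0 < c) (hcz : c ≤ z) :
    z ≤ Real.exp (viscPrim α z) * Real.exp (c ^ (-α)) := by
  have hz : 0 < z := hc.trans_le hcz
  rw [← Real.exp_add]
  nth_rewrite 1 [← Real.exp_log hz]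
  refine Real.exp_le_exp.2 ?_
  have := Real.rpow_le_rpow_of_nonpos hc hcz (by linarith : -α ≤ 0)
  unfold viscPrim
  linarith

lemma le_two_mul_ent_add {z : ℝ} (hz : 0 < z) : z ≤ 2 * ent z + 2 := by
  have h1 := Real.log_le_sub_one_of_pos (by positivity : 0 < z / 2)
  rw [Real.log_div hz.ne' two_ne_zero] at h1
  have h2 := Real.log_two_lt_d9
  unfold ent
  linarith

lemma exp_neg_le_of_ent_le {z A : ℝ} (hz : 0 < z) (h : ent z ≤ A) : Real.exp (-(A + 1)) ≤ z := by
  rw [← Real.le_log_iff_exp_le hz]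
  unfold ent at h
  linarith

namespace MHD

variable {α β T K δ : ℝ} (s : MHD α β T)

lemma sq_u_le_bas (p : ℝ × ℝ) : s.u p ^ 2 / 2 ≤ s.bas p := by
  have h1 := ent_nonneg (s.θ_pos p)
  have h2 := ent_nonneg (s.v_pos p)
  have h3 := mul_nonneg (s.v_pos p).le (by positivity : 0 ≤ s.b 0 p ^ 2 + s.b 1 p ^ 2)
  have h4 : 0 ≤ s.w 0 p ^ 2 + s.w 1 p ^ 2 := by positivity
  change _ ≤ _ + ent (s.θ p) + ent (s.v p)
  linarith

lemma ent_v_le_bas (p : ℝ × ℝ) : ent (s.v p) ≤ s.bas p := by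
  have h1 := ent_nonneg (s.θ_pos p)
  have h3 := mul_nonneg (s.v_pos p).le (by positivity : 0 ≤ s.b 0 p ^ 2 + s.b 1 p ^ 2)
  have h4 : 0 ≤ s.w 0 p ^ 2 + s.w 1 p ^ 2 := by positivity
  have h5 := sq_nonneg (s.u p)
  change _ ≤ _ + ent (s.θ p) + ent (s.v p)
  linarith

lemma ent_θ_add_le_bas (p : ℝ × ℝ) :
    ent (s.θ p) + s.v p * (s.b 0 p ^ 2 + s.b 1 p ^ 2) / 2 ≤ s.bas p := by
  have h2 := ent_nonneg (s.v_pos p)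
  have h4 : 0 ≤ s.w 0 p ^ 2 + s.w 1 p ^ 2 := by positivity
  have h5 := sq_nonneg (s.u p)
  change _ ≤ _ + ent (s.θ p) + ent (s.v p)
  linarith

lemma P_nonneg (p : ℝ × ℝ) : 0 ≤ s.P p := by
  have := s.v_pos p
  have := s.θ_pos p
  unfold P
  positivity

lemma v_mul_P_le (p : ℝ × ℝ) : s.v p * s.P p ≤ 2 + 2 * s.bas p := by
  have h1 := s.ent_θ_add_le_bas p
  have h2 := le_two_mul_ent_add (s.θ_pos p)
  have h3 := s.v_pos p
  have h4 : s.v p * s.P p = s.θ p + s.v p * (s.b 0 p ^ 2 + s.b 1 p ^ 2) / 2 := by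
    unfold P
    field_simp
  have h5 : 0 ≤ s.v p * (s.b 0 p ^ 2 + s.b 1 p ^ 2) / 2 := by positivity
  linarith

/-- Time integral of the pressure at a fixed point. -/
def Q (p : ℝ × ℝ) : ℝ := ∫ τ in (0:ℝ)..p.2, s.P (p.1, τ)

@[fun_prop]
lemma continuous_Q : Continuous s.Q := by
  unfold Q
  exact intervalIntegral.continuous_parametric_intervalIntegral_of_continuous
    (f := fun (p : ℝ × ℝ) τ => s.P (p.1, τ)) (by unfold Function.uncurry; fun_prop) (by fun_prop)

lemma Q_nonneg (x : ℝ) {t : ℝ} (ht : 0 ≤ t) : 0 ≤ s.Q (x, t) :=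
  intervalIntegral.integral_nonneg ht fun _ _ => s.P_nonneg _

lemma hasDerivAt_Q (x t : ℝ) : HasDerivAt (fun τ => s.Q (x, τ)) (s.P (x, t)) t :=
  ((by fun_prop : Continuous fun τ => s.P (x, τ)).integral_hasStrictDerivAt 0 t).hasDerivAt

/-- The integrated momentum equation. -/
lemma viscPrim_v_eq {t : ℝ} (ht : t ∈ Icc 0 T) (a x : ℝ) :
    viscPrim α (s.v (x, t)) = viscPrim α (s.v (x, 0)) + (∫ τ in (0:ℝ)..t, s.sig (a, τ))
      + s.Q (x, t) + (sInt s.u a x t - sInt s.u a x 0) := by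
  rw [sInt_sub_sInt_zero s.hu s.hut s.dut ht]
  have e1 : ∀ τ, sInt s.ut a x τ = s.sig (x, τ) - s.sig (a, τ) := fun τ =>
    intervalIntegral.integral_eq_sub_of_hasDerivAt (fun y _ => s.dmom y τ)
      (intervalIntegrable_slice s.hut)
  have e2 : viscPrim α (s.v (x, t)) - viscPrim α (s.v (x, 0))
      = ∫ τ in (0:ℝ)..t, (s.sig (x, τ) + s.P (x, τ)) := by
    refine sub_eq_integral_of_hasDerivAt_Ioo (T := T) (g := fun τ => viscPrim α (s.v (x, τ)))
      ?_ (by fun_prop) (fun τ hτ => ?_) ht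
    · exact (s.continuous_comp_v fun z hz =>
        (hasDerivAt_viscPrim hz).continuousAt.continuousWithinAt).comp (by fun_prop :
        Continuous fun τ : ℝ => (x, τ))
    · refine ((hasDerivAt_viscPrim (s.v_pos _)).comp τ (s.dvt x τ hτ)).congr_deriv ?_
      unfold sig mu
      ring
  have i1 : ∀ y, IntervalIntegrable (fun τ => s.sig (y, τ)) volume 0 t := fun y =>
    Continuous.intervalIntegrable (by fun_prop) _ _
  rw [intervalIntegral.integral_add (i1 x) (Continuous.intervalIntegrable (by fun_prop) _ _)] at e2
  unfold dInt
  simp_rw [e1]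
  rw [intervalIntegral.integral_sub (i1 x) (i1 a)]
  unfold Q
  linarith

lemma abs_sInt_u_le {C : ℝ} {a x t : ℝ} (hx : x ∈ Icc a (a + 1))
    (hC : sInt s.bas a x t ≤ C) : |sInt s.u a x t| ≤ 1 + C := by
  have h1 : |sInt s.u a x t| ≤ sInt (fun p => 1 + s.bas p) a x t := by
    refine (intervalIntegral.abs_integral_le_integral_abs hx.1).trans ?_
    refine intervalIntegral.integral_mono_on hx.1 (Continuous.intervalIntegrable (by fun_prop) _ _)
      (Continuous.intervalIntegrable (by fun_prop) _ _) fun y _ => ?_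
    have := s.sq_u_le_bas (y, t)
    have h := sq_abs (s.u (y, t))
    nlinarith [sq_nonneg (|s.u (y, t)| - 1)]
  rw [sInt_add (by fun_prop) (by fun_prop), sInt_const] at h1
  linarith [hx.2]

lemma exists_abs_viscPrim_sub_le (hα : 0 ≤ α) (hδ : 0 < δ) {C : ℝ} (hC : 0 < C) : ∃ C' > 0,
    ∀ s : MHD α β T, s.Adm K δ →
    (∀ t ∈ Icc 0 T, ∀ a b, a ≤ b → sInt s.bas a b t ≤ C) →
    ∀ a, ∀ x ∈ Icc a (a + 1), ∀ t ∈ Icc 0 T,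
      |viscPrim α (s.v (x, t)) - ((∫ τ in (0:ℝ)..t, s.sig (a, τ)) + s.Q (x, t))| ≤ C' := by
  refine ⟨|viscPrim α δ| + |viscPrim α (2 + 2 * K ^ 2)| + 2 * (1 + C), by positivity,
    fun s hs hE a x hx t ht => ?_⟩
  have e := s.viscPrim_v_eq ht a x
  have h1 := s.abs_sInt_u_le hx (hE t ht a x hx.1)
  have h2 := s.abs_sInt_u_le hx (hE 0 ⟨le_rfl, ht.1.trans ht.2⟩ a x hx.1)
  have h3 := viscPrim_mono hα hδ (hs.2.1 x)
  have h4 := viscPrim_mono hα (s.v_pos (x, 0)) (hs.v_zero_le x)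
  rw [abs_le] at h1 h2 ⊢
  have := neg_abs_le (viscPrim α δ)
  have := le_abs_self (viscPrim α (2 + 2 * K ^ 2))
  have := abs_nonneg (viscPrim α δ)
  have := abs_nonneg (viscPrim α (2 + 2 * K ^ 2))
  constructor <;> linarith [h1.1, h1.2, h2.1, h2.2]

lemma exists_inv_exp_sig_le (hα : 0 ≤ α) {C C' : ℝ} (hC : 0 < C) : ∃ A > 0,
    ∀ s : MHD α β T, (∀ t ∈ Icc 0 T, ∀ a b, a ≤ b → sInt s.bas a b t ≤ C) → ∀ a,
    (∀ x ∈ Icc a (a + 1), ∀ t ∈ Icc 0 T,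
      |viscPrim α (s.v (x, t)) - ((∫ τ in (0:ℝ)..t, s.sig (a, τ)) + s.Q (x, t))| ≤ C') →
    ∀ t ∈ Icc 0 T, Real.exp (-∫ τ in (0:ℝ)..t, s.sig (a, τ)) ≤ A := by
  set g0 := Real.exp (viscPrim α (Real.exp (-(C + 1 + 1)))) with hg0
  have hg0p : 0 < g0 := Real.exp_pos _
  set ε := g0 / (C + 1) with hε
  have hε0 : 0 < ε := by positivity
  set k := Real.exp C' with hk
  have hk0 : 0 < k := Real.exp_pos _
  set m := k / ε * (k * (2 + 2 * C)) with hm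
  have hm0 : 0 < m := by positivity
  refine ⟨k / ε * Real.exp (m * T), by positivity, fun s hE a hv t ht => ?_⟩
  set Z : ℝ → ℝ := fun t => Real.exp (-∫ τ in (0:ℝ)..t, s.sig (a, τ)) with hZ
  have cI : Continuous fun t => ∫ τ in (0:ℝ)..t, s.sig (a, τ) :=
    intervalIntegral.continuous_primitive
      (fun _ _ => Continuous.intervalIntegrable (by fun_prop) _ _) 0
  have cZ : Continuous Z := by
    simp only [hZ]
    exact Real.continuous_exp.comp cI.neg
  have hZ0 : ∀ t, 0 < Z t := fun t => Real.exp_pos _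
  have a1 : a ≤ a + 1 := by linarith
  have ceQ : Continuous fun p => Real.exp (s.Q p) := by fun_prop
  -- comparison of `exp Q` with `v`
  have up : ∀ x ∈ Icc a (a + 1), ∀ t ∈ Icc 0 T,
      Real.exp (viscPrim α (s.v (x, t))) * Z t ≤ k * Real.exp (s.Q (x, t)) := by
    intro x hx t ht
    rw [hZ, hk]
    simp only
    rw [← Real.exp_add, ← Real.exp_add]
    refine Real.exp_le_exp.2 ?_
    linarith [(abs_le.1 (hv x hx t ht)).2]
  have low : ∀ x ∈ Icc a (a + 1), ∀ t ∈ Icc 0 T,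
      Real.exp (s.Q (x, t)) ≤ k * (Z t * s.v (x, t)) := by
    intro x hx t ht
    have : Real.exp (s.Q (x, t)) ≤ k * (Z t * Real.exp (viscPrim α (s.v (x, t)))) := by
      rw [hZ, hk]
      simp only
      rw [← Real.exp_add, ← Real.exp_add]
      refine Real.exp_le_exp.2 ?_
      linarith [(abs_le.1 (hv x hx t ht)).1]
    refine this.trans ?_
    have := exp_viscPrim_le (α := α) (s.v_pos (x, t))
    have := hZ0 t
    gcongr
  have step : ∀ t ∈ Icc 0 T, Z t ≤ k / ε + ∫ τ in (0:ℝ)..t, m * Z τ := by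
    intro t ht
    have b1 : ε * Z t ≤ k * sInt (fun p => Real.exp (s.Q p)) a (a + 1) t := by
      have p1 : sInt (fun p => ε * Z t * (C + 1 - s.bas p)) a (a + 1) t
          ≤ sInt (fun p => k * Real.exp (s.Q p)) a (a + 1) t := by
        refine sInt_mono a1 (by fun_prop) (by fun_prop) fun x hx => ?_
        refine le_trans ?_ (up x hx t ht)
        have q1 := s.ent_v_le_bas (x, t)
        have q2 := ent_nonneg (s.v_pos (x, t))
        have q3 := hZ0 t
        rw [mul_right_comm]
        refine mul_le_mul_of_nonneg_right ?_ q3.le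
        rcases le_total (ent (s.v (x, t))) (C + 1) with hle | hle
        · have r1 := viscPrim_mono hα (Real.exp_pos _) (exp_neg_le_of_ent_le (s.v_pos _) hle)
          refine le_trans ?_ (Real.exp_le_exp.2 r1)
          rw [← hg0]
          calc ε * (C + 1 - s.bas (x, t)) ≤ ε * (C + 1) := by
                refine mul_le_mul_of_nonneg_left ?_ hε0.le
                linarith
            _ = g0 := by rw [hε]; field_simp
        · refine le_trans ?_ (Real.exp_pos _).le
          exact mul_nonpos_of_nonneg_of_nonpos hε0.le (by linarith)
      rw [sInt_const_mul, sInt_const_mul, sInt_sub (by fun_prop) (by fun_prop), sInt_const] at p1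
      refine le_trans ?_ p1
      have := hE t ht a (a + 1) a1
      have := mul_pos hε0 (hZ0 t)
      nlinarith
    have b2 : sInt (fun p => Real.exp (s.Q p)) a (a + 1) t
        ≤ 1 + ∫ τ in (0:ℝ)..t, k * (2 + 2 * C) * Z τ := by
      have p1 := sInt_sub_sInt_zero (a := a) (b := a + 1) (T := T) ceQ
        (Nt := fun p => Real.exp (s.Q p) * s.P p) (by fun_prop)
        (fun x τ _ => (s.hasDerivAt_Q x τ).exp) ht
      have p2 : sInt (fun p => Real.exp (s.Q p)) a (a + 1) 0 = 1 := by
        simp [sInt, Q]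
      have p3 : dInt (fun p => Real.exp (s.Q p) * s.P p) a (a + 1) t
          ≤ ∫ τ in (0:ℝ)..t, k * (2 + 2 * C) * Z τ := by
        refine intervalIntegral.integral_mono_on ht.1
          ((continuous_sInt (by fun_prop)).intervalIntegrable _ _)
          ((continuous_const.mul cZ).intervalIntegrable _ _) fun τ hτ => ?_
        have hτT : τ ∈ Icc 0 T := ⟨hτ.1, hτ.2.trans ht.2⟩
        have r1 : sInt (fun p => Real.exp (s.Q p) * s.P p) a (a + 1) τ
            ≤ sInt (fun p => k * Z τ * (2 + 2 * s.bas p)) a (a + 1) τ := by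
          refine sInt_mono a1 (by fun_prop) (by fun_prop) fun x hx => ?_
          have l1 := mul_le_mul_of_nonneg_right (low x hx τ hτT) (s.P_nonneg (x, τ))
          have l2 := mul_le_mul_of_nonneg_left (s.v_mul_P_le (x, τ))
            (mul_pos hk0 (hZ0 τ)).le
          linarith
        rw [sInt_const_mul, sInt_add (by fun_prop) (by fun_prop), sInt_const, sInt_const_mul] at r1
        have r2 := hE τ hτT a (a + 1) a1
        have := mul_pos hk0 (hZ0 τ)
        nlinarith
      linarith
    have b3 : Z t ≤ k / ε * (1 + ∫ τ in (0:ℝ)..t, k * (2 + 2 * C) * Z τ) := by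
      have := mul_le_mul_of_nonneg_left b2 hk0.le
      rw [div_mul_eq_mul_div, le_div_iff₀ hε0]
      linarith
    refine b3.trans (le_of_eq ?_)
    rw [intervalIntegral.integral_const_mul, intervalIntegral.integral_const_mul, hm]
    ring
  have := gronwall_integral cZ continuous_const (fun _ _ => hm0.le) step ht
  refine this.trans ?_
  refine mul_le_mul_of_nonneg_left (Real.exp_le_exp.2 ?_) (by positivity)
  simp only [intervalIntegral.integral_const, smul_eq_mul, sub_zero]
  nlinarith [ht.2]

/-- The specific volume is bounded from below, and from above in terms of the pressure. -/
lemma exists_le_v (hα : 0 ≤ α) (hT : 0 < T) (hδ : 0 < δ) : ∃ c > 0, ∃ C > 0,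
    ∀ s : MHD α β T, s.Adm K δ → ∀ x, ∀ t ∈ Icc 0 T,
      c ≤ s.v (x, t) ∧ s.v (x, t) ≤ C * Real.exp (s.Q (x, t)) := by
  obtain ⟨C, hC, hE⟩ := exists_bas_le (α := α) (β := β) (K := K) hα hT hδ
  obtain ⟨C', hC', hh⟩ := exists_abs_viscPrim_sub_le (β := β) (T := T) (K := K) hα hδ hC
  obtain ⟨A, hA, hY⟩ := exists_inv_exp_sig_le (α := α) (β := β) (C' := C') hα hC
  set k := Real.exp C' with hk
  have hk0 : 0 < k := Real.exp_pos _
  set c := (k * A)⁻¹ with hc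
  have hc0 : 0 < c := by positivity
  refine ⟨c, hc0, k * (k * (2 + 2 * C)) * Real.exp (c ^ (-α)), by positivity,
    fun s hs x t ht => ?_⟩
  have hEs := hE s hs
  have hhs := hh s hs hEs x
  set I₀ := ∫ τ in (0:ℝ)..t, s.sig (x, τ) with hI0
  have hYt : Real.exp (-I₀) ≤ A := hY s hEs x hhs t ht
  have x1 : x ≤ x + 1 := by linarith
  have low : ∀ y ∈ Icc x (x + 1), Real.exp I₀ ≤ k * s.v (y, t) := by
    intro y hy
    have h1 := exp_viscPrim_le (α := α) (s.v_pos (y, t))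
    refine le_trans ?_ (mul_le_mul_of_nonneg_left h1 hk0.le)
    rw [hk, ← Real.exp_add]
    refine Real.exp_le_exp.2 ?_
    linarith [(abs_le.1 (hhs y hy t ht)).1, s.Q_nonneg y ht.1]
  have hcv : c ≤ s.v (x, t) := by
    have h1 := low x ⟨le_rfl, x1⟩
    have h2 : A⁻¹ ≤ Real.exp I₀ := by
      rw [Real.exp_neg] at hYt
      exact inv_le_of_inv_le₀ (Real.exp_pos _) hYt
    rw [hc, mul_inv, inv_mul_le_iff₀ hk0]
    exact h2.trans h1
  refine ⟨hcv, ?_⟩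
  have hIu : Real.exp I₀ ≤ k * (2 + 2 * C) := by
    have h1 : sInt (fun _ => Real.exp I₀) x (x + 1) t
        ≤ sInt (fun p => k * (2 + 2 * s.bas p)) x (x + 1) t := by
      refine sInt_mono x1 (by fun_prop) (by fun_prop) fun y hy => ?_
      refine (low y hy).trans (mul_le_mul_of_nonneg_left ?_ hk0.le)
      linarith [le_two_mul_ent_add (s.v_pos (y, t)), s.ent_v_le_bas (y, t)]
    rw [sInt_const, sInt_const_mul, sInt_add (by fun_prop) (by fun_prop), sInt_const,
      sInt_const_mul] at h1
    have := hEs t ht x (x + 1) x1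
    nlinarith
  have h1 : Real.exp (viscPrim α (s.v (x, t))) ≤ k * Real.exp I₀ * Real.exp (s.Q (x, t)) := by
    rw [hk, ← Real.exp_add, ← Real.exp_add]
    refine Real.exp_le_exp.2 ?_
    linarith [(abs_le.1 (hhs x ⟨le_rfl, x1⟩ t ht)).2]
  have h2 := le_exp_viscPrim_mul hα hc0 hcv
  calc s.v (x, t) ≤ Real.exp (viscPrim α (s.v (x, t))) * Real.exp (c ^ (-α)) := h2
    _ ≤ (k * Real.exp I₀ * Real.exp (s.Q (x, t))) * Real.exp (c ^ (-α)) := by gcongr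
    _ ≤ (k * (k * (2 + 2 * C)) * Real.exp (s.Q (x, t))) * Real.exp (c ^ (-α)) := by gcongr
    _ = _ := by ring

end MHD

/-! ### Lower bound for the temperature -/

lemma nonpos_of_hasDerivAt_of_left_min {f : ℝ → ℝ} {d x a : ℝ} (hd : HasDerivAt f d x)
    (hax : a < x) (h : ∀ y ∈ Ioo a x, f x ≤ f y) : d ≤ 0 := by
  have h1 := (hasDerivAt_iff_tendsto_slope.1 hd).mono_left
    (nhdsWithin_mono x (fun y (hy : y ∈ Iio x) => ne_of_lt hy))
  refine le_of_tendsto h1 ?_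
  filter_upwards [Ioo_mem_nhdsLT hax] with y hy
  rw [slope_def_field]
  exact div_nonpos_of_nonneg_of_nonpos (sub_nonneg.2 (h y hy)) (sub_nonpos.2 hy.2.le)

lemma nonneg_of_hasDerivAt_of_right {f : ℝ → ℝ} {d x : ℝ} (hd : HasDerivAt f d x)
    (hx : f x = 0) (h : ∀ y, x < y → ∃ z ∈ Ioo x y, 0 ≤ f z) : 0 ≤ d := by
  have h1 := (hasDerivAt_iff_tendsto_slope.1 hd).mono_left
    (nhdsWithin_mono x (fun y (hy : y ∈ Ioi x) => ne_of_gt hy))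
  refine ge_of_tendsto_of_frequently h1 ?_
  rw [(nhdsGT_basis x).frequently_iff]
  intro y hy
  obtain ⟨z, hz, hz0⟩ := h y hy
  refine ⟨z, hz, ?_⟩
  rw [slope_def_field, hx, sub_zero]
  exact div_nonneg hz0 (sub_nonneg.2 hz.1.le)

namespace MHD

variable {α β T K δ : ℝ}

lemma θ_ge_of_le_v (s : MHD α β T) (hα : 0 ≤ α) {c : ℝ} (hc : 0 < c) (hδ : 0 < δ)
    (hs : s.Adm K δ) (hv : ∀ x, ∀ t ∈ Icc 0 T, c ≤ s.v (x, t)) (x : ℝ) {t : ℝ}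
    (ht : t ∈ Ico 0 T) : (2 + 2 / δ + (1 / (4 * c) + 1) * t)⁻¹ ≤ s.θ (x, t) := by
  set A := 2 + 2 / δ with hA
  set B := 1 / (4 * c) + 1 with hB
  have hA0 : 0 < A := by positivity
  have hB0 : 0 < B := by positivity
  have hg : ∀ τ, 0 ≤ τ → (A + B * τ)⁻¹ ≤ A⁻¹ := fun τ hτ =>
    inv_anti₀ hA0 (le_add_of_nonneg_right (by positivity))
  have hA2 : A⁻¹ ≤ 1 / 2 := by
    rw [inv_le_comm₀ hA0 (by norm_num), hA]
    have : 0 < 2 / δ := by positivity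
    norm_num
    linarith
  have hAδ : A⁻¹ < δ := by
    rw [inv_lt_comm₀ hA0 hδ, hA, div_eq_mul_inv]
    have : 0 < δ⁻¹ := by positivity
    linarith
  by_contra! hlt
  obtain ⟨M, hM⟩ := s.far (1 / 2) (by norm_num)
  set R := |M| + |x| + 1 with hR
  have hR0 : 0 < R := by positivity
  have hMR : M < R := by linarith [le_abs_self M, abs_nonneg x]
  obtain ⟨hx1, hx2⟩ := abs_lt.1 (by linarith [abs_nonneg M] : |x| < R)
  have hcont : ContinuousOn (fun p : ℝ × ℝ => s.θ p - (A + B * p.2)⁻¹)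
      (Icc (-R) R ×ˢ Icc 0 t) := by
    refine s.hθ.continuousOn.sub (ContinuousOn.inv₀ (by fun_prop) fun p hp => ?_)
    have := hp.2.1
    positivity
  obtain ⟨⟨x₀, t₀⟩, ⟨hx₀, ht₀⟩, hmin⟩ := (isCompact_Icc.prod isCompact_Icc).exists_isMinOn
    ⟨(x, t), ⟨hx1.le, hx2.le⟩, ht.1, le_rfl⟩ hcont
  simp only at hx₀ ht₀
  have hmin' : ∀ y ∈ Icc (-R) R, ∀ τ ∈ Icc 0 t,
      s.θ (x₀, t₀) - (A + B * t₀)⁻¹ ≤ s.θ (y, τ) - (A + B * τ)⁻¹ :=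
    fun y hy τ hτ => hmin (⟨hy, hτ⟩ : (y, τ) ∈ Icc (-R) R ×ˢ Icc 0 t)
  have hneg : s.θ (x₀, t₀) < (A + B * t₀)⁻¹ := by
    have := hmin' x ⟨hx1.le, hx2.le⟩ t ⟨ht.1, le_rfl⟩
    linarith
  have hx₀M : |x₀| < M := by
    by_contra! h
    have := (abs_lt.1 (hM x₀ t₀ h).2.2.1).1
    linarith [hg t₀ ht₀.1]
  obtain ⟨hx₀1, hx₀2⟩ := abs_lt.1 (hx₀M.trans hMR)
  have ht₀0 : 0 < t₀ := by
    refine lt_of_le_of_ne ht₀.1 fun h => ?_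
    rw [← h] at hneg
    have := hs.2.2 x₀
    simp only [mul_zero, add_zero] at hneg
    linarith
  have ht₀T : t₀ ∈ Ioo 0 T := ⟨ht₀0, ht₀.2.trans_lt ht.2⟩
  have hθx : s.θx (x₀, t₀) = 0 := by
    refine IsLocalMin.hasDerivAt_eq_zero (f := fun y => s.θ (y, t₀)) ?_ (s.dθx x₀ t₀)
    filter_upwards [Ioo_mem_nhds hx₀1 hx₀2] with y hy
    linarith [hmin' y ⟨hy.1.le, hy.2.le⟩ t₀ ht₀]
  have hflux : 0 ≤ s.θt (x₀, t₀) + s.θ (x₀, t₀) / s.v (x₀, t₀) * s.ux (x₀, t₀)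
      - s.S (x₀, t₀) / s.v (x₀, t₀) := by
    refine nonneg_of_hasDerivAt_of_right (s.dtemp x₀ t₀ |>.congr_deriv ?_) (by simp [hθx])
      fun y hy => ?_
    · unfold S tr mu
      ring
    · have hyR : x₀ < min y R := lt_min hy hx₀2
      obtain ⟨z, hz, e⟩ := exists_hasDerivAt_eq_slope (fun y => s.θ (y, t₀))
        (fun y => s.θx (y, t₀)) hyR (by fun_prop) (fun z _ => s.dθx z t₀)
      refine ⟨z, ⟨hz.1, hz.2.trans_le (min_le_left _ _)⟩, ?_⟩
      have h1 := hmin' (min y R) ⟨hx₀1.le.trans hyR.le, min_le_right _ _⟩ t₀ ht₀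
      have h2 : 0 ≤ s.θx (z, t₀) := by
        rw [e]
        exact div_nonneg (by linarith) (by linarith)
      have := s.v_pos (z, t₀)
      have := Real.rpow_nonneg (s.θ_pos (z, t₀)).le β
      positivity
  have hg0 : 0 < A + B * t₀ := by positivity
  have htime : s.θt (x₀, t₀) - (-(B * 1) / (A + B * t₀) ^ 2) ≤ 0 := by
    refine nonpos_of_hasDerivAt_of_left_min ((s.dθt x₀ t₀ ht₀T).sub
      ((((hasDerivAt_id t₀).const_mul B).const_add A).inv hg0.ne')) ht₀0 fun τ hτ => ?_
    exact hmin' x₀ hx₀ τ ⟨hτ.1.le, hτ.2.le.trans ht₀.2⟩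
  set θ := s.θ (x₀, t₀) with hθd
  set V := s.v (x₀, t₀) with hVd
  set U := s.ux (x₀, t₀) with hUd
  have hV : c ≤ V := hv x₀ t₀ ⟨ht₀0.le, ht₀T.2.le⟩
  have hV0 : 0 < V := s.v_pos _
  have hθ0 : 0 < θ := s.θ_pos _
  have hS : U ^ 2 ≤ s.S (x₀, t₀) := by
    have := s.one_le_mu hα (x₀, t₀)
    have := s.tr_nonneg (x₀, t₀)
    unfold S
    nlinarith [sq_nonneg U]
  set G := (A + B * t₀)⁻¹ with hG
  have hG0 : 0 < G := by positivity
  have e1 : -(B * 1) / (A + B * t₀) ^ 2 = - (B * G ^ 2) := by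
    rw [hG]; field_simp
  rw [e1] at htime
  have e2 : -(G ^ 2 / (4 * c)) ≤ s.θt (x₀, t₀) := by
    have h1 : -(θ ^ 2 / 4) / V ≤ (s.S (x₀, t₀) - θ * U) / V := by
      gcongr
      nlinarith [sq_nonneg (U - θ / 2)]
    have h2 : G ^ 2 / 4 / c ≥ θ ^ 2 / 4 / V := by gcongr
    have h3 : (s.S (x₀, t₀) - θ * U) / V = s.S (x₀, t₀) / V - θ / V * U := by ring
    have h4 : G ^ 2 / 4 / c = G ^ 2 / (4 * c) := by field_simp
    rw [neg_div] at h1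
    linarith
  have e3 : B * G ^ 2 = G ^ 2 / (4 * c) + G ^ 2 := by rw [hB]; field_simp
  nlinarith [sq_nonneg G, pow_pos hG0 2]

lemma exists_le_θ (hα : 0 ≤ α) (hT : 0 < T) (hδ : 0 < δ) : ∃ c > 0, ∀ s : MHD α β T,
    s.Adm K δ → ∀ x, ∀ t ∈ Icc 0 T, c ≤ s.θ (x, t) := by
  obtain ⟨c, hc, C, hC, h⟩ := exists_le_v (β := β) (K := K) hα hT hδ
  refine ⟨(2 + 2 / δ + (1 / (4 * c) + 1) * T)⁻¹, by positivity, fun s hs x => ?_⟩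
  have h1 : ∀ t ∈ Ico 0 T, (2 + 2 / δ + (1 / (4 * c) + 1) * T)⁻¹ ≤ s.θ (x, t) := fun t ht => by
    refine le_trans ?_ (s.θ_ge_of_le_v hα hc hδ hs (fun x t ht => (h s hs x t ht).1) x ht)
    have := ht.1
    have := ht.2.le
    gcongr
  have h2 : Continuous fun t => s.θ (x, t) := by fun_prop
  intro t ht
  rw [← closure_Ico hT.ne] at ht
  exact closure_minimal h1 (isClosed_le continuous_const h2) ht

end MHD

/-! ### Dissipation estimates -/

/-- Entropy function growing linearly, with derivative bounded away from `1`. -/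
def rent (m z : ℝ) : ℝ := (z - 1 - (z ^ (1 - m) - 1) / (1 - m)) / 2

section Rent

variable {m z : ℝ}

lemma isWeight_rent (hm : 0 < m) (hm1 : m ≤ 1 / 2) :
    MHD.IsWeight (fun z => (1 - z ^ (-m)) / 2) (fun z => m / 2 * z ^ (-m - 1)) (rent m) where
  df z hz := by
    refine (((Real.hasDerivAt_rpow_const (p := -m) (Or.inl hz.ne')).const_sub 1).div_const
      2).congr_deriv ?_
    ring
  dΦ z hz := by
    refine ((((hasDerivAt_id z).sub_const 1).sub (((Real.hasDerivAt_rpow_const (p := 1 - m)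
      (Or.inl hz.ne')).sub_const 1).div_const (1 - m))).div_const 2).congr_deriv ?_
    have : 1 - m ≠ 0 := by linarith
    rw [show 1 - m - 1 = -m by ring]
    field_simp
  cont := continuousOn_const.mul (continuousOn_id.rpow_const fun z hz => Or.inl (ne_of_gt hz))
  lt_one z hz := by
    have := Real.rpow_pos_of_pos hz (-m)
    linarith
  pos z hz := by positivity

lemma rent_nonneg (hm : 0 < m) (hm1 : m ≤ 1 / 2) (hz : 0 < z) : 0 ≤ rent m z := by
  have h := rpow_one_add_le_one_add_mul_self (s := z - 1) (p := 1 - m) (by linarith)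
    (by linarith) (by linarith)
  rw [add_sub_cancel] at h
  have : (z ^ (1 - m) - 1) / (1 - m) ≤ z - 1 := by
    rw [div_le_iff₀ (by linarith)]
    linarith
  unfold rent
  linarith

lemma rent_le_ent (hm1 : m ≤ 1 / 2) (hz : 0 < z) : rent m z ≤ ent z := by
  have h := Real.add_one_le_exp (Real.log z * (1 - m))
  rw [← Real.rpow_def_of_pos hz] at h
  have : Real.log z ≤ (z ^ (1 - m) - 1) / (1 - m) := by
    rw [le_div_iff₀ (by linarith)]
    linarith
  have := ent_nonneg hz
  unfold ent rent at *
  linarith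

lemma sq_sub_one_le (hz : 0 < z) : (z - 1) ^ 2 ≤ 2 * (1 + z) * ent z := by
  have hs := Real.sqrt_pos.2 hz
  have h1 := Real.log_le_sub_one_of_pos hs
  rw [Real.log_sqrt hz.le] at h1
  have h2 := Real.sq_sqrt hz.le
  set y := √z
  have h3 : (y - 1) ^ 2 ≤ ent z := by
    unfold ent
    nlinarith
  have h4 : (z - 1) ^ 2 = (y + 1) ^ 2 * (y - 1) ^ 2 := by
    rw [← h2]
    ring
  rw [h4]
  refine mul_le_mul ?_ h3 (sq_nonneg _) (by positivity)
  nlinarith [sq_nonneg (y - 1)]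

lemma abs_rent_source_le (hm : 0 < m) (hm1 : m ≤ 1 / 2) (hz : 0 < z) :
    |(1 - (1 - z ^ (-m)) / 2) * z - 1| ≤ |z - 1| := by
  have e : z ^ (-m) * z = z ^ (1 - m) := by
    rw [← Real.rpow_add_one hz.ne']
    ring_nf
  have e2 : (1 - (1 - z ^ (-m)) / 2) * z - 1 = ((z - 1) + (z ^ (1 - m) - 1)) / 2 := by
    rw [← e]
    ring
  rw [e2]
  rcases le_total 1 z with h | h
  · have h1 := Real.rpow_le_rpow_of_exponent_le h (by linarith : 1 - m ≤ 1)
    have h2 := Real.one_le_rpow h (by linarith : 0 ≤ 1 - m)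
    rw [Real.rpow_one] at h1
    rw [abs_of_nonneg (by linarith), abs_of_nonneg (by linarith)]
    linarith
  · have h1 := Real.rpow_le_rpow_of_exponent_ge hz h (by linarith : 1 - m ≤ 1)
    have h2 := Real.rpow_le_one hz.le h (by linarith : 0 ≤ 1 - m)
    rw [Real.rpow_one] at h1
    rw [abs_of_nonpos (by linarith), abs_of_nonpos (by linarith)]
    linarith

lemma exists_le_mul_rpow_add {p ε : ℝ} (hp : 1 < p) (hε : 0 < ε) :
    ∃ C > 0, ∀ z : ℝ, 0 < z → z ≤ ε * z ^ p + C := by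
  refine ⟨(ε⁻¹) ^ (p - 1)⁻¹, by positivity, fun z hz => ?_⟩
  rcases le_total z ((ε⁻¹) ^ (p - 1)⁻¹) with h | h
  · have := Real.rpow_pos_of_pos hz p
    nlinarith
  · have h1 : ε⁻¹ ≤ z ^ (p - 1) := by
      have := Real.rpow_le_rpow (by positivity) h (by linarith : 0 ≤ p - 1)
      rwa [← Real.rpow_mul (by positivity), inv_mul_cancel₀ (by linarith), Real.rpow_one] at this
    have h2 : z ^ p = z ^ (p - 1) * z := by
      rw [← Real.rpow_add_one hz.ne']
      ring_nf
    have h3 : z ≤ ε * z ^ p := by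
      rw [h2]
      have := mul_le_mul_of_nonneg_left h1 hε.le
      rw [mul_inv_cancel₀ hε.ne'] at this
      nlinarith
    have : (0:ℝ) < (ε⁻¹) ^ (p - 1)⁻¹ := by positivity
    linarith

end Rent

namespace MHD

variable {α β T K δ : ℝ}

section Defs

variable (s : MHD α β T)

/-- Weighted squared temperature gradient. -/
def heat (r : ℝ) (p : ℝ × ℝ) : ℝ := s.θ p ^ r * s.θx p ^ 2 / s.v p

/-- Squared gradient of the unknowns, with weight `θ ^ r` for the temperature. -/
def grad (r : ℝ) (p : ℝ × ℝ) : ℝ := (s.ux p ^ 2 + s.tr p) / s.v p + s.heat r p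

@[fun_prop]
lemma continuous_heat (r : ℝ) : Continuous (s.heat r) := by
  unfold heat
  fun_prop (disch := intro; exact (s.v_pos _).ne')

@[fun_prop]
lemma continuous_grad (r : ℝ) : Continuous (s.grad r) := by
  unfold grad
  fun_prop (disch := intro; exact (s.v_pos _).ne')

lemma heat_nonneg (r : ℝ) (p : ℝ × ℝ) : 0 ≤ s.heat r p := by
  have := s.v_pos p
  have := s.θ_pos p
  unfold heat
  positivity

lemma grad_nonneg (r : ℝ) (p : ℝ × ℝ) : 0 ≤ s.grad r p := by
  have := s.v_pos p
  have := s.tr_nonneg p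
  have := s.heat_nonneg r p
  unfold grad
  positivity

lemma sInt_v_le {C a t : ℝ} (h : sInt s.bas a (a + 1) t ≤ C) :
    sInt s.v a (a + 1) t ≤ 2 + 2 * C := by
  have h1 : sInt s.v a (a + 1) t ≤ sInt (fun p => 2 + 2 * s.bas p) a (a + 1) t :=
    sInt_mono (by linarith) (by fun_prop) (by fun_prop) fun x _ => by
      linarith [le_two_mul_ent_add (s.v_pos (x, t)), s.ent_v_le_bas (x, t)]
  rw [sInt_add (by fun_prop) (by fun_prop), sInt_const, sInt_const_mul] at h1
  linarith

lemma sInt_θ_le {C a t : ℝ} (h : sInt s.bas a (a + 1) t ≤ C) :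
    sInt s.θ a (a + 1) t ≤ 2 + 2 * C := by
  have h1 : sInt s.θ a (a + 1) t ≤ sInt (fun p => 2 + 2 * s.bas p) a (a + 1) t :=
    sInt_mono (by linarith) (by fun_prop) (by fun_prop) fun x _ => by
      have h2 := s.ent_θ_add_le_bas (x, t)
      have h3 := mul_nonneg (s.v_pos (x, t)).le
        (by positivity : 0 ≤ s.b 0 (x, t) ^ 2 + s.b 1 (x, t) ^ 2)
      linarith [le_two_mul_ent_add (s.θ_pos (x, t))]
  rw [sInt_add (by fun_prop) (by fun_prop), sInt_const, sInt_const_mul] at h1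
  linarith

lemma hasDerivAt_rpow_θ (r x t : ℝ) : HasDerivAt (fun y => s.θ (y, t) ^ r)
    (r * s.θ (x, t) ^ (r - 1) * s.θx (x, t)) x := by
  refine ((s.dθx x t).rpow_const (p := r) (Or.inl (s.θ_pos _).ne')).congr_deriv ?_
  ring

/-- Weighted pointwise bound for a power of the temperature. -/
lemma weight_sq_mul_rpow_le {C p a t : ℝ} (hp : 0 ≤ p) (hC : 0 < C)
    (hE : sInt s.bas a (a + 1) t ≤ C) {ζ ζ' : ℝ → ℝ} (hζ : ∀ x, HasDerivAt ζ (ζ' x) x)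
    (hζ' : Continuous ζ') (h0 : ∀ x ∈ Icc a (a + 1), 0 ≤ ζ x) (h1 : ∀ x ∈ Icc a (a + 1), ζ x ≤ 1)
    (hb : ∀ x ∈ Icc a (a + 1), |ζ' x| * s.θ (x, t) ^ (p / 2) ≤ 1) {x : ℝ}
    (hx : x ∈ Icc a (a + 1)) :
    ζ x ^ 2 * s.θ (x, t) ^ p ≤ (2 * ((2 + 2 * C) ^ (p / 2) + 1) ^ 2 + p ^ 2 * (1 + C))
      * (1 + sInt (fun q => ζ q.1 ^ 2 * s.heat (p - 2) q) a (a + 1) t) := by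
  have cζ : Continuous ζ := continuous_iff_continuousAt.2 fun x => (hζ x).continuousAt
  have a1 : a ≤ a + 1 := by linarith
  obtain ⟨y, hy, hyθ⟩ := exists_le_of_integral_le (h := fun y => s.θ (y, t)) (by fun_prop)
    (s.sInt_θ_le hE)
  set G := (2 + 2 * C) ^ (p / 2) with hG
  set W := sInt (fun q => ζ q.1 ^ 2 * s.heat (p - 2) q) a (a + 1) t with hW
  have hW0 : 0 ≤ W := sInt_nonneg a1 fun x _ => mul_nonneg (sq_nonneg _) (s.heat_nonneg _ _)
  have hG0 : 0 ≤ G := by positivity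
  have cθ : ∀ r : ℝ, Continuous fun z => s.θ (z, t) ^ r := fun r =>
    (s.continuous_rpow_θ r).comp (by fun_prop : Continuous fun z : ℝ => (z, t))
  have ch : Continuous fun z => ζ' z * s.θ (z, t) ^ (p / 2)
      + ζ z * (p / 2 * s.θ (z, t) ^ (p / 2 - 1) * s.θx (z, t)) :=
    (hζ'.mul (cθ _)).add (cζ.mul ((continuous_const.mul (cθ _)).mul (by fun_prop)))
  have key := abs_le_abs_add_integral (h := fun z => ζ z * s.θ (z, t) ^ (p / 2))
    (h' := fun z => ζ' z * s.θ (z, t) ^ (p / 2)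
      + ζ z * (p / 2 * s.θ (z, t) ^ (p / 2 - 1) * s.θx (z, t)))
    (fun z => (hζ z).mul (s.hasDerivAt_rpow_θ (p / 2) z t))
    ch hx hy
  simp only [abs_mul] at key
  rw [abs_of_nonneg (h0 x hx), abs_of_nonneg (h0 y hy),
    abs_of_pos (Real.rpow_pos_of_pos (s.θ_pos (x, t)) _),
    abs_of_pos (Real.rpow_pos_of_pos (s.θ_pos (y, t)) _)] at key
  have k1 : ζ y * s.θ (y, t) ^ (p / 2) ≤ G := by
    have : s.θ (y, t) ^ (p / 2) ≤ G :=
      Real.rpow_le_rpow (s.θ_pos _).le hyθ (by linarith)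
    exact (mul_le_of_le_one_left (Real.rpow_nonneg (s.θ_pos _).le _) (h1 y hy)).trans this
  set F : ℝ → ℝ := fun z => ζ z * s.θ (z, t) ^ (p / 2 - 1) * |s.θx (z, t)| / √(s.v (z, t)) with hF
  have cF : Continuous F := by
    exact ((cζ.mul (cθ _)).mul (by fun_prop)).div (by fun_prop)
      fun z => (Real.sqrt_pos.2 (s.v_pos _)).ne'
  have k2 : (∫ z in a..(a + 1), |ζ' z * s.θ (z, t) ^ (p / 2)
      + ζ z * (p / 2 * s.θ (z, t) ^ (p / 2 - 1) * s.θx (z, t))|)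
      ≤ 1 + p / 2 * ∫ z in a..(a + 1), F z * √(s.v (z, t)) := by
    have e : 1 + p / 2 * (∫ z in a..(a + 1), F z * √(s.v (z, t)))
        = ∫ z in a..(a + 1), (1 + p / 2 * (F z * √(s.v (z, t)))) := by
      rw [intervalIntegral.integral_add (by simp)
        (Continuous.intervalIntegrable (by fun_prop) _ _), intervalIntegral.integral_const_mul]
      simp
    rw [e]
    refine intervalIntegral.integral_mono_on a1 (ch.abs.intervalIntegrable _ _) (Continuous.intervalIntegrable (by fun_prop) _ _) fun z hz => ?_
    refine (abs_add_le _ _).trans (add_le_add ?_ ?_)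
    · rw [abs_mul, abs_of_pos (Real.rpow_pos_of_pos (s.θ_pos (z, t)) _)]
      exact hb z hz
    · have hs := Real.sqrt_pos.2 (s.v_pos (z, t))
      rw [hF]
      simp only [abs_mul]
      rw [abs_of_nonneg (h0 z hz), abs_of_pos (Real.rpow_pos_of_pos (s.θ_pos (z, t)) _),
        abs_of_nonneg (by linarith : 0 ≤ p / 2)]
      field_simp
      exact le_rfl
  set I := ∫ z in a..(a + 1), F z * √(s.v (z, t)) with hI
  have k3 : I ^ 2 ≤ W * (2 + 2 * C) := by
    refine (integral_mul_sq_le a1 cF (by fun_prop)).trans ?_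
    have e1 : (∫ z in a..(a + 1), F z ^ 2) = W := by
      refine intervalIntegral.integral_congr fun z _ => ?_
      have hθ := s.θ_pos (z, t)
      simp only [hF, heat]
      rw [div_pow, Real.sq_sqrt (s.v_pos _).le, mul_pow, mul_pow, sq_abs,
        ← Real.rpow_natCast (s.θ (z, t) ^ (p / 2 - 1)), ← Real.rpow_mul hθ.le]
      rw [show (p / 2 - 1) * ((2:ℕ):ℝ) = p - 2 by push_cast; ring]
      ring
    have e2 : (∫ z in a..(a + 1), √(s.v (z, t)) ^ 2) ≤ 2 + 2 * C := by
      refine le_trans (le_of_eq ?_) (s.sInt_v_le hE)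
      exact intervalIntegral.integral_congr fun z _ => Real.sq_sqrt (s.v_pos _).le
    rw [e1]
    exact mul_le_mul_of_nonneg_left e2 hW0
  have k4 : ζ x ^ 2 * s.θ (x, t) ^ p = (ζ x * s.θ (x, t) ^ (p / 2)) ^ 2 := by
    rw [mul_pow, ← Real.rpow_natCast (s.θ (x, t) ^ (p / 2)), ← Real.rpow_mul (s.θ_pos _).le]
    norm_num
  rw [k4]
  set X := ζ x * s.θ (x, t) ^ (p / 2) with hX
  have hX0 : 0 ≤ X := mul_nonneg (h0 x hx) (Real.rpow_nonneg (s.θ_pos _).le _)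
  have k5 : X ≤ (G + 1) + p / 2 * I := by linarith
  have k6 : X ^ 2 ≤ 2 * (G + 1) ^ 2 + 2 * (p / 2 * I) ^ 2 := by
    nlinarith [sq_nonneg (G + 1 - p / 2 * I), pow_le_pow_left₀ hX0 k5 2]
  have k7 : 2 * (p / 2 * I) ^ 2 ≤ p ^ 2 * (1 + C) * W := by
    nlinarith [mul_le_mul_of_nonneg_left k3 (sq_nonneg p)]
  have k8 : 0 ≤ 2 * (G + 1) ^ 2 * W := by positivity
  have k9 : 0 ≤ p ^ 2 * (1 + C) := by positivity
  linarith

end Defs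

end MHD

lemma dInt_add_le {f g h : ℝ × ℝ → ℝ} {a b T k l D : ℝ} (hT : 0 ≤ T) (hf : Continuous f)
    (hg : Continuous g) (hh : Continuous h)
    (H : ∀ t ∈ Icc 0 T, sInt f a b t + k * sInt g a b t ≤ l * sInt h a b t + D) :
    dInt f a b T + k * dInt g a b T ≤ l * dInt h a b T + D * T := by
  have cf := continuous_sInt (a := a) (b := b) hf
  have cg := continuous_sInt (a := a) (b := b) hg
  have ch := continuous_sInt (a := a) (b := b) hh
  have i1 : IntervalIntegrable (sInt f a b) volume 0 T := cf.intervalIntegrable _ _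
  have i2 : IntervalIntegrable (fun t => k * sInt g a b t) volume 0 T :=
    (cg.const_mul k).intervalIntegrable _ _
  have i3 : IntervalIntegrable (fun t => l * sInt h a b t) volume 0 T :=
    (ch.const_mul l).intervalIntegrable _ _
  have i4 : IntervalIntegrable (fun _ => D) volume 0 T := intervalIntegrable_const
  have key := intervalIntegral.integral_mono_on hT (i1.add i2) (i3.add i4) H
  rw [intervalIntegral.integral_add i1 i2, intervalIntegral.integral_add i3 i4,
    intervalIntegral.integral_const_mul, intervalIntegral.integral_const_mul,
    intervalIntegral.integral_const, sub_zero, smul_eq_mul, mul_comm T D] at key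
  exact key

namespace MHD

variable {α β T K δ : ℝ}

lemma source_rent_le (s : MHD α β T) (hα : 0 ≤ α) {m c : ℝ} (hm : 0 < m) (hm1 : m ≤ 1 / 2)
    (hc : 0 < c) {p : ℝ × ℝ} (hv : c ≤ s.v p) :
    s.source (fun z => (1 - z ^ (-m)) / 2) p
      ≤ s.S p / (8 * s.v p) + 4 / c * ((1 + s.θ p) * s.bas p) := by
  have hv0 := s.v_pos p
  have hθ := s.θ_pos p
  have h1 := abs_rent_source_le hm hm1 hθ
  set X := (1 - (1 - s.θ p ^ (-m)) / 2) * s.θ p - 1 with hX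
  have h2 : X ^ 2 ≤ 2 * (1 + s.θ p) * s.bas p := by
    refine (sq_le_sq.2 h1).trans ((sq_sub_one_le hθ).trans ?_)
    refine mul_le_mul_of_nonneg_left ?_ (by positivity)
    have := mul_nonneg hv0.le (by positivity : 0 ≤ s.b 0 p ^ 2 + s.b 1 p ^ 2)
    linarith [s.ent_θ_add_le_bas p]
  have h3 : s.ux p ^ 2 ≤ s.S p := by
    have := s.one_le_mu hα p
    have := s.tr_nonneg p
    unfold S
    nlinarith [sq_nonneg (s.ux p)]
  have h4 : X * s.ux p ≤ s.S p / 8 + 4 * ((1 + s.θ p) * s.bas p) := by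
    nlinarith [sq_nonneg (4 * X - s.ux p)]
  have hb := s.bas_nonneg p
  calc s.source (fun z => (1 - z ^ (-m)) / 2) p = X * s.ux p / s.v p := rfl
    _ ≤ (s.S p / 8 + 4 * ((1 + s.θ p) * s.bas p)) / s.v p := by gcongr
    _ = s.S p / (8 * s.v p) + 4 * ((1 + s.θ p) * s.bas p) / s.v p := by field_simp
    _ ≤ s.S p / (8 * s.v p) + 4 * ((1 + s.θ p) * s.bas p) / c := by gcongr
    _ = _ := by ring

lemma le_dissip_rent (s : MHD α β T) (hα : 0 ≤ α) (m : ℝ) (p : ℝ × ℝ) :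
    s.S p / (2 * s.v p) + m / 2 * s.heat (β - m - 1) p
      ≤ s.dissip (fun z => (1 - z ^ (-m)) / 2) (fun z => m / 2 * z ^ (-m - 1)) p := by
  have hv0 := s.v_pos p
  have hθ := s.θ_pos p
  have hS := s.S_nonneg hα p
  have e : s.θ p ^ (β - m - 1) = s.θ p ^ (-m - 1) * s.θ p ^ β := by
    rw [← Real.rpow_add hθ]
    ring_nf
  have h1 : s.S p / (2 * s.v p) ≤ (1 - (1 - s.θ p ^ (-m)) / 2) * s.S p / s.v p := by
    have : s.S p / (2 * s.v p) = 1 / 2 * s.S p / s.v p := by field_simp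
    rw [this]
    have := Real.rpow_pos_of_pos hθ (-m)
    gcongr
    linarith
  have h2 : m / 2 * s.heat (β - m - 1) p
      = m / 2 * s.θ p ^ (-m - 1) * s.θ p ^ β * s.θx p ^ 2 / s.v p := by
    unfold heat
    rw [e]
    ring
  rw [h2]
  unfold dissip
  linarith

lemma energy_rent_le (s : MHD α β T) {m : ℝ} (hm1 : m ≤ 1 / 2) (p : ℝ × ℝ) :
    s.energy (rent m) p ≤ s.bas p := by
  have := rent_le_ent hm1 (s.θ_pos p)
  unfold bas energy
  linarith

lemma mul_grad_le (s : MHD α β T) (hα : 0 ≤ α) {m : ℝ} (hm : 0 < m) (hm1 : m ≤ 1 / 2)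
    (r : ℝ) (p : ℝ × ℝ) : m / 8 * s.grad r p ≤ s.S p / (8 * s.v p) + m / 8 * s.heat r p := by
  have hv0 := s.v_pos p
  have hS : s.ux p ^ 2 + s.tr p ≤ s.S p := by
    have := s.one_le_mu hα p
    unfold S
    nlinarith [sq_nonneg (s.ux p)]
  have h0 : 0 ≤ s.ux p ^ 2 + s.tr p := add_nonneg (sq_nonneg _) (s.tr_nonneg p)
  have : m / 8 * ((s.ux p ^ 2 + s.tr p) / s.v p) ≤ s.S p / (8 * s.v p) := by
    have e : s.S p / (8 * s.v p) = 1 / 8 * (s.S p / s.v p) := by field_simp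
    rw [e]
    have : 0 ≤ s.S p / s.v p := div_nonneg (h0.trans hS) hv0.le
    gcongr
    linarith
  unfold grad
  linarith

lemma cut_sq_mul_rpow_le (s : MHD α β T) {C p : ℝ} (hp : 0 ≤ p) (hC : 0 < C)
    (hE : ∀ t ∈ Icc 0 T, ∀ a b, a ≤ b → sInt s.bas a b t ≤ C) :
    ∃ R₀, ∀ R, 0 < R → R₀ ≤ R → ∀ x ∈ Icc (-R) R, ∀ t ∈ Icc 0 T,
      cut R x ^ 2 * s.θ (x, t) ^ p ≤ (2 * ((2 + 2 * C) ^ (p / 2) + 1) ^ 2 + p ^ 2 * (1 + C))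
        * (1 + sInt (fun q => cut R q.1 ^ 2 * s.heat (p - 2) q) (-R) R t) := by
  obtain ⟨B, hB⟩ := BddStrip.comp (T := T) s.θ_pos s.bdd_θ s.bdd_inv_θ (h := fun z => z ^ (p / 2))
    (continuousOn_id.rpow_const fun z hz => Or.inl (ne_of_gt hz))
  refine ⟨2 * B + 1, fun R hR0 hR x hx t ht => ?_⟩
  have hB0 : 0 ≤ B := (abs_nonneg _).trans (hB 0 t ht)
  set a := max (-R) (x - 1) with ha
  have ha1 : -R ≤ a := le_max_left _ _
  have ha2 : a ≤ x := max_le hx.1 (by linarith)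
  have ha3 : x ≤ a + 1 := by linarith [le_max_right (-R) (x - 1)]
  have ha4 : a + 1 ≤ R := by
    have : a ≤ R - 1 := max_le (by linarith) (by linarith [hx.2])
    linarith
  have hsub : ∀ y ∈ Icc a (a + 1), y ∈ Icc (-R) R := fun y hy => ⟨ha1.trans hy.1, hy.2.trans ha4⟩
  refine (s.weight_sq_mul_rpow_le hp hC (hE t ht a (a + 1) (by linarith)) (hasDerivAt_cut R)
    (by fun_prop) (fun y hy => cut_nonneg hR0 (hsub y hy)) (fun y _ => cut_le_one)
    (fun y hy => ?_) ⟨ha2, ha3⟩).trans ?_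
  · have h1 := (le_abs_self _).trans (hB y t ht)
    have h2 : |-(2 * y / R ^ 2)| ≤ 2 / R := by
      rw [abs_neg, abs_div, abs_mul, abs_of_pos (by positivity : 0 < R ^ 2),
        div_le_div_iff₀ (by positivity) hR0]
      have := abs_le.2 (hsub y hy)
      norm_num
      nlinarith
    calc |-(2 * y / R ^ 2)| * s.θ (y, t) ^ (p / 2) ≤ 2 / R * B := by
          have := Real.rpow_nonneg (s.θ_pos (y, t)).le (p / 2)
          gcongr
      _ ≤ 1 := by
          rw [div_mul_eq_mul_div, div_le_one hR0]
          linarith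
  · have : 0 ≤ 2 * ((2 + 2 * C) ^ (p / 2) + 1) ^ 2 + p ^ 2 * (1 + C) := by positivity
    refine mul_le_mul_of_nonneg_left (add_le_add le_rfl ?_) this
    exact sInt_subset (f := fun q => cut R q.1 ^ 2 * s.heat (p - 2) q) (by fun_prop)
      (fun y => mul_nonneg (sq_nonneg _) (s.heat_nonneg _ _)) ha1 (by linarith) ha4

lemma sInt_source_rent_le (s : MHD α β T) (hα : 0 ≤ α) {m c C A ε Cε r p R t : ℝ} (hm0 : 0 < m)
    (hm1 : m ≤ 1 / 2) (hc : 0 < c) (hA0 : 0 < A) (hε0 : 0 < ε) (hCε : 0 < Cε) (hR0 : 0 < R)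
    (hr : r = β - m - 1) (hv : ∀ x, c ≤ s.v (x, t)) (hE : sInt s.bas (-R) R t ≤ C)
    (hY : ∀ z : ℝ, 0 < z → z ≤ ε * z ^ p + Cε)
    (hθ : ∀ x ∈ Icc (-R) R, cut R x ^ 2 * s.θ (x, t) ^ p
      ≤ A * (1 + sInt (fun q => cut R q.1 ^ 2 * s.heat r q) (-R) R t)) :
    sInt (fun q => cut R q.1 ^ 2 * s.source (fun z => (1 - z ^ (-m)) / 2) q) (-R) R t
      + m / 8 * sInt (fun q => cut R q.1 ^ 2 * s.grad r q) (-R) R t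
      ≤ 1 / 2 * sInt (fun q => cut R q.1 ^ 2 * s.dissip (fun z => (1 - z ^ (-m)) / 2)
          (fun z => m / 2 * z ^ (-m - 1)) q) (-R) R t
        - m / 8 * sInt (fun q => cut R q.1 ^ 2 * s.heat r q) (-R) R t
        + 4 / c * (1 + (ε * (A * (1 + sInt (fun q => cut R q.1 ^ 2 * s.heat r q) (-R) R t)) + Cε))
          * C := by
  have hRle : -R ≤ R := by linarith
  have hw := isWeight_rent hm0 hm1
  set f : ℝ → ℝ := fun z => (1 - z ^ (-m)) / 2 with hf
  set f' : ℝ → ℝ := fun z => m / 2 * z ^ (-m - 1) with hf'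
  have cdis := s.continuous_dissip hw
  have csrc := s.continuous_source hw
  set W := sInt (fun q => cut R q.1 ^ 2 * s.heat r q) (-R) R t with hW
  have hW0 : 0 ≤ W := sInt_nonneg hRle fun x _ => mul_nonneg (sq_nonneg _) (s.heat_nonneg _ _)
  set Λ := 4 / c * (1 + (ε * (A * (1 + W)) + Cε)) with hΛ
  have q1 : sInt (fun q => cut R q.1 ^ 2 * s.source f q
      + m / 8 * (cut R q.1 ^ 2 * s.grad r q)) (-R) R t
      ≤ sInt (fun q => (1 / 2 * (cut R q.1 ^ 2 * s.dissip f f' q) + Λ * s.bas q)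
        - m / 8 * (cut R q.1 ^ 2 * s.heat r q)) (-R) R t := by
    refine sInt_mono hRle (by fun_prop) (by fun_prop) fun x hx => ?_
    have g1 := s.source_rent_le hα hm0 hm1 hc (hv x)
    have g2 := s.le_dissip_rent hα m (x, t)
    have g3 := s.mul_grad_le hα hm0 hm1 r (x, t)
    have g4 := hθ x hx
    have g5 := hY _ (s.θ_pos (x, t))
    have g6 : cut R x ^ 2 ≤ 1 := pow_le_one₀ (cut_nonneg hR0 hx) cut_le_one
    have g7 : cut R x ^ 2 * (1 + s.θ (x, t)) ≤ 1 + (ε * (A * (1 + W)) + Cε) := by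
      have l1 := mul_le_mul_of_nonneg_left g5 (sq_nonneg (cut R x))
      have l2 := mul_le_mul_of_nonneg_left g4 hε0.le
      have l3 := mul_le_mul_of_nonneg_right g6 hCε.le
      linarith
    have g8 : cut R x ^ 2 * (4 / c * ((1 + s.θ (x, t)) * s.bas (x, t))) ≤ Λ * s.bas (x, t) := by
      have := mul_le_mul_of_nonneg_left (mul_le_mul_of_nonneg_right g7 (s.bas_nonneg (x, t)))
        (by positivity : 0 ≤ 4 / c)
      rw [hΛ]
      linarith
    have g9 : s.source f (x, t) + m / 8 * s.grad r (x, t)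
        ≤ 1 / 2 * s.dissip f f' (x, t) - m / 8 * s.heat r (x, t)
          + 4 / c * ((1 + s.θ (x, t)) * s.bas (x, t)) := by
      have e1 : s.S (x, t) / (2 * s.v (x, t)) = 4 * (s.S (x, t) / (8 * s.v (x, t))) := by
        have := (s.v_pos (x, t)).ne'
        field_simp
        ring
      rw [e1] at g2
      rw [← hr] at g2
      change _ + m / 2 * s.heat r (x, t) ≤ _ at g2
      have := mul_nonneg hm0.le (s.heat_nonneg r (x, t))
      linarith
    have g10 := mul_le_mul_of_nonneg_left g9 (sq_nonneg (cut R x))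
    simp only
    linarith
  rw [sInt_add (by fun_prop) (by fun_prop), sInt_const_mul, sInt_sub (by fun_prop) (by fun_prop),
    sInt_add (by fun_prop) (by fun_prop), sInt_const_mul, sInt_const_mul, sInt_const_mul] at q1
  have hΛ0 : 0 ≤ Λ := by positivity
  have q2 := mul_le_mul_of_nonneg_left hE hΛ0
  rw [hΛ] at q2 ⊢
  linarith

/-- Exponent of the temperature weight in the dissipation estimate. -/
def rexp (β : ℝ) : ℝ := β - min β 1 / 2 - 1

lemma exists_grad_le (hα : 0 ≤ α) (hβ : 0 < β) (hT : 0 < T) (hδ : 0 < δ) : ∃ C > 0,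
    ∀ s : MHD α β T, s.Adm K δ → ∀ a b, a ≤ b → dInt (s.grad (rexp β)) a b T ≤ C := by
  obtain ⟨C, hC, hE⟩ := exists_bas_le (α := α) (β := β) (K := K) hα hT hδ
  obtain ⟨C₀, hC₀, hE0⟩ := exists_bas_zero_le (α := α) (β := β) (T := T) (K := K) hδ
  obtain ⟨c, hc, _, -, hv⟩ := exists_le_v (β := β) (K := K) hα hT hδ
  set m := min β 1 / 2 with hm
  have hm0 : 0 < m := half_pos (lt_min hβ one_pos)
  have hm1 : m ≤ 1 / 2 := by
    have := min_le_right β 1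
    linarith
  have hmβ : m ≤ β / 2 := by
    have := min_le_left β 1
    linarith
  set p := β - m - 1 + 2 with hp
  have hp1 : 1 < p := by linarith
  set A := 2 * ((2 + 2 * C) ^ (p / 2) + 1) ^ 2 + p ^ 2 * (1 + C) with hA
  have hA0 : 0 < A := by positivity
  set ε := m * c / (32 * C * A) with hε
  have hε0 : 0 < ε := by positivity
  obtain ⟨Cε, hCε, hY⟩ := exists_le_mul_rpow_add hp1 hε0
  set D := 4 / c * ((1 + ε * A + Cε) * C) with hD
  have hD0 : 0 < D := by positivity
  refine ⟨2 * (8 / m * (C₀ + 1 + D * T)), by positivity, fun s hs a b hab => ?_⟩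
  have hw := isWeight_rent hm0 hm1
  set f : ℝ → ℝ := fun z => (1 - z ^ (-m)) / 2 with hf
  set f' : ℝ → ℝ := fun z => m / 2 * z ^ (-m - 1) with hf'
  have cdis := s.continuous_dissip hw
  have csrc := s.continuous_source hw
  have cen := s.continuous_energy hw
  obtain ⟨R₁, hR₁, hloc⟩ := s.localized_energy hα hT hw
  obtain ⟨R₂, hR₂⟩ := s.cut_sq_mul_rpow_le (p := p) (by linarith) hC (hE s hs)
  refine dInt_le_two_mul_of_cut (R₀ := max R₁ R₂) (s.continuous_grad _) (s.grad_nonneg _) hT.le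
    (fun R hR0 hRR => ?_) hab
  have hRle : -R ≤ R := by linarith
  have h1 := hloc R ((le_max_left _ _).trans hRR) T ⟨hT.le, le_rfl⟩
  have h2 : ∀ t ∈ Icc 0 T, sInt (fun q => cut R q.1 ^ 2 * s.source f q) (-R) R t
      + m / 8 * sInt (fun q => cut R q.1 ^ 2 * s.grad (rexp β) q) (-R) R t
      ≤ 1 / 2 * sInt (fun q => cut R q.1 ^ 2 * s.dissip f f' q) (-R) R t + D := by
    intro t ht
    have hθ := fun x hx => hR₂ R hR0 ((le_max_right _ _).trans hRR) x hx t ht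
    rw [← hA, show p - 2 = rexp β by rw [hp, rexp]; ring] at hθ
    refine (s.sInt_source_rent_le hα hm0 hm1 hc hA0 hε0 hCε hR0 (by rw [rexp])
      (fun x => (hv s hs x t ht).1) (hE s hs t ht (-R) R hRle) hY hθ).trans (le_of_eq ?_)
    generalize sInt (fun q => cut R q.1 ^ 2 * s.heat (rexp β) q) (-R) R t = W
    generalize sInt (fun q => cut R q.1 ^ 2 * s.dissip _ _ q) (-R) R t = V
    have e : 4 / c * (ε * A) * C = m / 8 := by
      rw [hε]
      field_simp
      ring
    rw [hD]
    linear_combination W * e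
  have h3 : dInt (fun q => cut R q.1 ^ 2 * s.source f q) (-R) R T
      + m / 8 * dInt (fun q => cut R q.1 ^ 2 * s.grad (rexp β) q) (-R) R T
      ≤ 1 / 2 * dInt (fun q => cut R q.1 ^ 2 * s.dissip f f' q) (-R) R T + D * T :=
    dInt_add_le hT.le (by fun_prop) (by fun_prop) (by fun_prop) h2
  have h4 : sInt (fun q => cut R q.1 ^ 2 * s.energy (rent m) q) (-R) R 0 ≤ C₀ := by
    refine (sInt_cut_le cen (s.energy_nonneg fun z hz => rent_nonneg hm0 hm1 hz) hR0).trans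
      (le_trans ?_ (hE0 s hs (-R) R hRle))
    exact sInt_mono hRle cen s.continuous_bas fun x _ => s.energy_rent_le hm1 _
  have h5 : 0 ≤ sInt (fun q => cut R q.1 ^ 2 * s.energy (rent m) q) (-R) R T :=
    sInt_nonneg hRle fun x _ =>
      mul_nonneg (sq_nonneg _) (s.energy_nonneg (fun z hz => rent_nonneg hm0 hm1 hz) _)
  have h6 : m / 8 * dInt (fun q => cut R q.1 ^ 2 * s.grad (rexp β) q) (-R) R T
      ≤ C₀ + 1 + D * T := by linarith
  calc _ = 8 / m * (m / 8 * dInt (fun q => cut R q.1 ^ 2 * s.grad (rexp β) q) (-R) R T) := by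
        field_simp
    _ ≤ _ := by gcongr

end MHD

namespace MHD

variable {α β T K δ : ℝ}

lemma θ_le_of_sInt_bas_le (s : MHD α β T) (hβ : 0 < β) {C a t x : ℝ} (hC : 0 < C)
    (hE : sInt s.bas a (a + 1) t ≤ C) {M : ℝ} (hM : ∀ z : ℝ, 0 < z → z ≤ 1 * z ^ (rexp β + 2) + M)
    (hx : x ∈ Icc a (a + 1)) :
    s.θ (x, t) ≤ (2 * ((2 + 2 * C) ^ ((rexp β + 2) / 2) + 1) ^ 2 + (rexp β + 2) ^ 2 * (1 + C))
      * (1 + sInt (s.grad (rexp β)) a (a + 1) t) + M := by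
  have hp : 0 ≤ rexp β + 2 := by
    have := min_le_left β 1
    unfold rexp
    linarith
  have h := s.weight_sq_mul_rpow_le (p := rexp β + 2) hp hC hE (ζ := fun _ => 1) (ζ' := fun _ => 0)
    (fun x => hasDerivAt_const x 1) continuous_const (by simp) (by simp) (by simp) hx
  simp only [one_pow, one_mul, add_sub_cancel_right] at h
  have h1 : sInt (fun q => s.heat (rexp β) q) a (a + 1) t ≤ sInt (s.grad (rexp β)) a (a + 1) t := by
    refine sInt_mono (by linarith) (by fun_prop) (by fun_prop) fun y _ => ?_
    have := s.v_pos (y, t)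
    have := s.tr_nonneg (y, t)
    unfold grad
    have : 0 ≤ (s.ux (y, t) ^ 2 + s.tr (y, t)) / s.v (y, t) := by positivity
    linarith
  have h2 := hM _ (s.θ_pos (x, t))
  rw [one_mul] at h2
  refine h2.trans (add_le_add_left (h.trans ?_) _)
  gcongr

lemma sq_b_le_of_sInt_bas_le (s : MHD α β T) {c C a t x : ℝ} (hc : 0 < c)
    (hv : ∀ x, c ≤ s.v (x, t)) (hE : sInt s.bas a (a + 1) t ≤ C) (r : ℝ)
    (hx : x ∈ Icc a (a + 1)) :
    s.b 0 (x, t) ^ 2 + s.b 1 (x, t) ^ 2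
      ≤ 2 * C / c + 2 * C + sInt (s.grad r) a (a + 1) t := by
  have a1 : a ≤ a + 1 := by linarith
  have h := fun i => sq_le_integral_add (fun y => s.dbx i y t) (by fun_prop) hx
  change ∀ i, _ ≤ sInt (fun p => s.b i p ^ 2) a (a + 1) t
    + sInt (fun p => 2 * |s.b i p| * |s.bx i p|) a (a + 1) t at h
  have h1 : sInt (fun p => (s.b 0 p ^ 2 + 2 * |s.b 0 p| * |s.bx 0 p|)
      + (s.b 1 p ^ 2 + 2 * |s.b 1 p| * |s.bx 1 p|)) a (a + 1) t
      ≤ sInt (fun p => (2 / c + 2) * s.bas p + s.grad r p) a (a + 1) t := by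
    refine sInt_mono a1 (by fun_prop) (by fun_prop) fun y _ => ?_
    have hv0 := s.v_pos (y, t)
    have e1 := s.ent_θ_add_le_bas (y, t)
    have e2 := ent_nonneg (s.θ_pos (y, t))
    have e3 : ∀ i, 2 * |s.b i (y, t)| * |s.bx i (y, t)|
        ≤ s.v (y, t) * s.b i (y, t) ^ 2 + s.bx i (y, t) ^ 2 / s.v (y, t) := by
      intro i
      have : 0 ≤ (s.v (y, t) * |s.b i (y, t)| - |s.bx i (y, t)|) ^ 2 / s.v (y, t) := by positivity
      have e : (s.v (y, t) * |s.b i (y, t)| - |s.bx i (y, t)|) ^ 2 / s.v (y, t)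
          = s.v (y, t) * |s.b i (y, t)| ^ 2 + |s.bx i (y, t)| ^ 2 / s.v (y, t)
            - 2 * |s.b i (y, t)| * |s.bx i (y, t)| := by
        field_simp
        ring
      rw [e, sq_abs, sq_abs] at this
      linarith
    have e4 : c * (s.b 0 (y, t) ^ 2 + s.b 1 (y, t) ^ 2) ≤ 2 * s.bas (y, t) := by
      have := mul_le_mul_of_nonneg_right (hv y)
        (by positivity : 0 ≤ s.b 0 (y, t) ^ 2 + s.b 1 (y, t) ^ 2)
      linarith
    have e5 : s.b 0 (y, t) ^ 2 + s.b 1 (y, t) ^ 2 ≤ 2 / c * s.bas (y, t) := by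
      rw [div_mul_eq_mul_div, le_div_iff₀ hc]
      linarith
    have e6 : (s.bx 0 (y, t) ^ 2 + s.bx 1 (y, t) ^ 2) / s.v (y, t) ≤ s.grad r (y, t) := by
      have := s.heat_nonneg r (y, t)
      have : (s.bx 0 (y, t) ^ 2 + s.bx 1 (y, t) ^ 2) / s.v (y, t)
          ≤ (s.ux (y, t) ^ 2 + s.tr (y, t)) / s.v (y, t) := by
        unfold tr
        refine div_le_div_of_nonneg_right ?_ hv0.le
        nlinarith [sq_nonneg (s.ux (y, t)), sq_nonneg (s.wx 0 (y, t)), sq_nonneg (s.wx 1 (y, t))]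
      unfold grad
      linarith
    rw [add_div] at e6
    linarith [e3 0, e3 1]
  rw [sInt_add (by fun_prop) (by fun_prop), sInt_add (by fun_prop) (by fun_prop),
    sInt_add (by fun_prop) (by fun_prop), sInt_add (by fun_prop) (by fun_prop), sInt_const_mul] at h1
  have h2 : (2 / c + 2) * sInt s.bas a (a + 1) t ≤ (2 / c + 2) * C := by gcongr
  have h3 : (2 / c + 2) * C = 2 * C / c + 2 * C := by ring
  linarith [h 0, h 1]

lemma exists_θ_add_sq_b_le (hα : 0 ≤ α) (hβ : 0 < β) (hT : 0 < T) (hδ : 0 < δ) : ∃ C > 0,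
    ∀ s : MHD α β T, s.Adm K δ → ∀ a, ∀ x ∈ Icc a (a + 1), ∀ t ∈ Icc 0 T,
      s.θ (x, t) + (s.b 0 (x, t) ^ 2 + s.b 1 (x, t) ^ 2)
        ≤ C * (1 + sInt (s.grad (rexp β)) a (a + 1) t) := by
  obtain ⟨C, hC, hE⟩ := exists_bas_le (α := α) (β := β) (K := K) hα hT hδ
  obtain ⟨c, hc, C₁, hC₁, hv⟩ := exists_le_v (β := β) (K := K) hα hT hδ
  have hp : 1 < rexp β + 2 := by
    have := min_le_left β 1
    unfold rexp
    linarith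
  obtain ⟨M, hM0, hM⟩ := exists_le_mul_rpow_add hp one_pos
  set A := 2 * ((2 + 2 * C) ^ ((rexp β + 2) / 2) + 1) ^ 2 + (rexp β + 2) ^ 2 * (1 + C) with hA
  have hA0 : 0 < A := by positivity
  refine ⟨A + M + (2 * C / c + 2 * C + 1), by positivity, fun s hs a x hx t ht => ?_⟩
  have h1 := s.θ_le_of_sInt_bas_le hβ hC (hE s hs t ht a (a + 1) (by linarith)) hM hx
  have h2 := s.sq_b_le_of_sInt_bas_le hc (fun x => (hv s hs x t ht).1)
    (hE s hs t ht a (a + 1) (by linarith)) (rexp β) hx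
  have h3 : 0 ≤ sInt (s.grad (rexp β)) a (a + 1) t :=
    sInt_nonneg (by linarith) fun y _ => s.grad_nonneg _ _
  set G := sInt (s.grad (rexp β)) a (a + 1) t
  have h4 : 0 ≤ 2 * C / c + 2 * C := by positivity
  nlinarith [mul_nonneg hM0.le h3, mul_nonneg h4 h3]

lemma exists_v_le (hα : 0 ≤ α) (hβ : 0 < β) (hT : 0 < T) (hδ : 0 < δ) : ∃ C > 0,
    ∀ s : MHD α β T, s.Adm K δ → ∀ x, ∀ t ∈ Icc 0 T, s.v (x, t) ≤ C := by
  obtain ⟨A, hA, hθ⟩ := exists_θ_add_sq_b_le (α := α) (K := K) hα hβ hT hδ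
  obtain ⟨c, hc, C₁, hC₁, hv⟩ := exists_le_v (β := β) (K := K) hα hT hδ
  obtain ⟨D, hD, hG⟩ := exists_grad_le (K := K) hα hβ hT hδ
  refine ⟨C₁ * Real.exp ((1 / c + 1) * (A * (T + D))), by positivity, fun s hs x t ht => ?_⟩
  refine (hv s hs x t ht).2.trans ?_
  have key : s.Q (x, t) ≤ (1 / c + 1) * (A * (T + D)) := by
    have h1 : s.Q (x, t) ≤ ∫ τ in (0:ℝ)..t,
        (1 / c + 1) * (A * (1 + sInt (s.grad (rexp β)) x (x + 1) τ)) := by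
      have cG := continuous_sInt (a := x) (b := x + 1) (s.continuous_grad (rexp β))
      refine intervalIntegral.integral_mono_on ht.1
        (Continuous.intervalIntegrable (by unfold P; fun_prop (disch := intro; exact (s.v_pos _).ne')) _ _)
        (Continuous.intervalIntegrable (by fun_prop) _ _) fun τ hτ => ?_
      have hτ' : τ ∈ Icc 0 T := ⟨hτ.1, hτ.2.trans ht.2⟩
      have h2 := hθ s hs x x ⟨le_rfl, by linarith⟩ τ hτ'
      have h3 := (hv s hs x τ hτ').1
      have h4 := s.θ_pos (x, τ)
      have h5 : s.θ (x, τ) / s.v (x, τ) ≤ s.θ (x, τ) / c := by gcongr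
      have h6 : 0 ≤ s.b 0 (x, τ) ^ 2 + s.b 1 (x, τ) ^ 2 := by positivity
      calc s.P (x, τ) ≤ s.θ (x, τ) / c + (s.b 0 (x, τ) ^ 2 + s.b 1 (x, τ) ^ 2) := by
            unfold P
            linarith
        _ ≤ (1 / c + 1) * (s.θ (x, τ) + (s.b 0 (x, τ) ^ 2 + s.b 1 (x, τ) ^ 2)) := by
            have : 0 ≤ 1 / c * (s.b 0 (x, τ) ^ 2 + s.b 1 (x, τ) ^ 2) := by positivity
            have e : s.θ (x, τ) / c = 1 / c * s.θ (x, τ) := by ring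
            rw [e]
            linarith
        _ ≤ _ := by gcongr
    rw [intervalIntegral.integral_const_mul, intervalIntegral.integral_const_mul,
      intervalIntegral.integral_add (by simp)
        ((continuous_sInt (s.continuous_grad _)).intervalIntegrable _ _)] at h1
    have h2 : dInt (s.grad (rexp β)) x (x + 1) t ≤ D :=
      (dInt_mono_time (s.continuous_grad _) (by linarith) (s.grad_nonneg _) ht.1 ht.2).trans
        (hG s hs x (x + 1) (by linarith))
    refine h1.trans ?_
    rw [intervalIntegral.integral_const, sub_zero, smul_eq_mul, mul_one]
    change (1 / c + 1) * (A * (t + dInt (s.grad (rexp β)) x (x + 1) t)) ≤ _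
    have := ht.2
    gcongr
  gcongr

end MHD

lemma rpow_neg_le_mul {c r z : ℝ} (hc : 0 < c) (hr : -1 ≤ r) (hz : c ≤ z) :
    z ^ (-r) ≤ c ^ (-r - 1) * z := by
  have hz0 := hc.trans_le hz
  have e : z ^ (-r) = z ^ (-r - 1) * z := by
    rw [← Real.rpow_add_one hz0.ne']
    ring_nf
  rw [e]
  exact mul_le_mul_of_nonneg_right (Real.rpow_le_rpow_of_nonpos hc hz (by linarith)) hz0.le

namespace MHD

variable {α β T K δ : ℝ}

section Effective

variable (s : MHD α β T)

/-- Effective velocity `(log v - v ^ (-α))_x - u`. -/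
def eff (p : ℝ × ℝ) : ℝ := s.mu p / s.v p * s.vx p - s.u p

/-- Spatial derivative of the total pressure. -/
def Px (p : ℝ × ℝ) : ℝ := (s.θx p * s.v p - s.θ p * s.vx p) / s.v p ^ 2
  + (s.b 0 p * s.bx 0 p + s.b 1 p * s.bx 1 p)

@[fun_prop]
lemma continuous_eff : Continuous s.eff := by
  unfold eff
  fun_prop (disch := intro; exact (s.v_pos _).ne')

@[fun_prop]
lemma continuous_Px : Continuous s.Px := by
  unfold Px
  fun_prop (disch := intro; exact (pow_pos (s.v_pos _) 2).ne')

lemma hasDerivAt_P (x t : ℝ) : HasDerivAt (fun y => s.P (y, t)) (s.Px (x, t)) x := by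
  refine (((s.dθx x t).div (s.dvx x t) (s.v_pos _).ne').add ((((s.dbx 0 x t).fun_pow 2).add
    ((s.dbx 1 x t).fun_pow 2)).div_const 2)).congr_deriv ?_
  simp only [Px]
  push_cast
  ring

lemma hasDerivAt_eff (x : ℝ) {t : ℝ} (ht : t ∈ Ioo 0 T) :
    HasDerivAt (fun τ => s.eff (x, τ)) (s.Px (x, t)) t := by
  have hc : ContinuousOn (viscPrim α) (Ioi 0) := fun z hz =>
    (hasDerivAt_viscPrim hz).continuousAt.continuousWithinAt
  have h := hasDerivAt_mixed (T := T) (f := fun p => viscPrim α (s.v p))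
    (fx := fun p => s.mu p / s.v p * s.vx p) (ft := fun p => s.mu p * s.ux p / s.v p)
    (ftx := fun p => s.ut p + s.Px p) (s.continuous_comp_v hc)
    (by fun_prop (disch := intro; exact (s.v_pos _).ne')) (by fun_prop)
    (fun x t => HasDerivAt.comp (h₂ := viscPrim α) x (hasDerivAt_viscPrim (s.v_pos (x, t)))
      (s.dvx x t))
    (fun x t ht => (HasDerivAt.comp (h₂ := viscPrim α) t (hasDerivAt_viscPrim (s.v_pos (x, t)))
      (s.dvt x t ht)).congr_deriv (by unfold mu; ring))
    (fun x t => ((s.dmom x t).add (s.hasDerivAt_P x t)).congr_of_eventuallyEq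
      (Eventually.of_forall fun y => by simp only [Pi.add_apply, P, mu]; ring)) x ht
  exact (h.sub (s.dut x t ht)).congr_deriv (by ring)

lemma vx_eq (hα : 0 ≤ α) (p : ℝ × ℝ) : s.vx p = s.v p * (s.eff p + s.u p) / s.mu p := by
  have := s.v_pos p
  have : 0 < s.mu p := one_pos.trans_le (s.one_le_mu hα p)
  unfold eff
  field_simp
  ring

lemma sq_vx_le (hα : 0 ≤ α) {V : ℝ} {p : ℝ × ℝ} (hV : s.v p ≤ V) :
    s.vx p ^ 2 ≤ V ^ 2 * (2 * s.eff p ^ 2 + 4 * s.bas p) := by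
  have h0 := s.v_pos p
  have h1 := s.one_le_mu hα p
  have h2 := s.sq_u_le_bas p
  have h3 : (s.eff p + s.u p) ^ 2 ≤ 2 * s.eff p ^ 2 + 4 * s.bas p := by
    nlinarith [sq_nonneg (s.eff p - s.u p)]
  calc s.vx p ^ 2 = s.v p ^ 2 * (s.eff p + s.u p) ^ 2 / s.mu p ^ 2 := by
        rw [s.vx_eq hα]
        ring
    _ ≤ s.v p ^ 2 * (s.eff p + s.u p) ^ 2 := div_le_self (by positivity) (one_le_pow₀ h1)
    _ ≤ _ := by gcongr

lemma eff_mul_Px_le (hα : 0 ≤ α) {c V r : ℝ} (hc : 0 < c) (p : ℝ × ℝ) (hv : c ≤ s.v p)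
    (hV : s.v p ≤ V) (hr : -1 ≤ r) (hθ : c ≤ s.θ p) :
    2 * s.eff p * s.Px p ≤ s.θ p / c * s.bas p + 2 * s.grad r p
      + (c ^ (-r - 1) / c * s.θ p + V * (s.b 0 p ^ 2 + s.b 1 p ^ 2)) * s.eff p ^ 2 := by
  have hv0 := s.v_pos p
  have hθ0 := s.θ_pos p
  have hμ := s.one_le_mu hα p
  have hμ0 : 0 < s.mu p := one_pos.trans_le hμ
  have hb := s.sq_u_le_bas p
  set z := s.eff p with hz
  have e : 2 * z * s.Px p = 2 * z * s.θx p / s.v p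
      + s.θ p / (s.v p * s.mu p) * (-2 * z * (z + s.u p))
      + (2 * z * s.b 0 p * s.bx 0 p + 2 * z * s.b 1 p * s.bx 1 p) := by
    unfold Px
    rw [s.vx_eq hα, ← hz]
    field_simp
    ring
  have h1 : 2 * z * s.θx p / s.v p ≤ c ^ (-r - 1) / c * s.θ p * z ^ 2 + s.heat r p := by
    have k1 := rpow_neg_le_mul hc hr hθ
    have k2 := Real.rpow_pos_of_pos hθ0 r
    have k3 : s.θ p ^ r * s.θ p ^ (-r) = 1 := by
      rw [← Real.rpow_add hθ0]
      simp
    have k4 : 2 * z * s.θx p ≤ s.θ p ^ (-r) * z ^ 2 + s.θ p ^ r * s.θx p ^ 2 := by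
      have l1 : 0 ≤ s.θ p ^ (-r) * (z - s.θ p ^ r * s.θx p) ^ 2 := by
        have := Real.rpow_pos_of_pos hθ0 (-r)
        positivity
      have l2 : s.θ p ^ (-r) * (z - s.θ p ^ r * s.θx p) ^ 2 = s.θ p ^ (-r) * z ^ 2
          - 2 * z * s.θx p * (s.θ p ^ r * s.θ p ^ (-r))
          + (s.θ p ^ r * s.θ p ^ (-r)) * (s.θ p ^ r * s.θx p ^ 2) := by ring
      rw [l2, k3] at l1
      linarith
    calc 2 * z * s.θx p / s.v p
        ≤ (s.θ p ^ (-r) * z ^ 2 + s.θ p ^ r * s.θx p ^ 2) / s.v p := by gcongr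
      _ = s.θ p ^ (-r) * z ^ 2 / s.v p + s.heat r p := by
          unfold heat
          ring
      _ ≤ c ^ (-r - 1) * s.θ p * z ^ 2 / c + s.heat r p := by gcongr
      _ = _ := by ring
  have h2 : s.θ p / (s.v p * s.mu p) * (-2 * z * (z + s.u p)) ≤ s.θ p / c * s.bas p := by
    calc _ ≤ s.θ p / (s.v p * s.mu p) * s.bas p := by
          refine mul_le_mul_of_nonneg_left ?_ (by positivity)
          nlinarith [sq_nonneg (2 * z + s.u p)]
      _ ≤ _ := by
          have := s.bas_nonneg p
          gcongr
          nlinarith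
  have h3 : ∀ i, 2 * z * s.b i p * s.bx i p ≤ V * s.b i p ^ 2 * z ^ 2 + s.bx i p ^ 2 / s.v p := by
    intro i
    have l1 : 0 ≤ (s.v p * (z * s.b i p) - s.bx i p) ^ 2 / s.v p := by positivity
    have l2 : (s.v p * (z * s.b i p) - s.bx i p) ^ 2 / s.v p = s.v p * (s.b i p ^ 2 * z ^ 2)
        - 2 * z * s.b i p * s.bx i p + s.bx i p ^ 2 / s.v p := by
      field_simp
      ring
    have l3 := mul_le_mul_of_nonneg_right hV (by positivity : 0 ≤ s.b i p ^ 2 * z ^ 2)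
    rw [l2] at l1
    linarith
  have h4 : s.heat r p ≤ s.grad r p := by
    have := s.tr_nonneg p
    have : 0 ≤ (s.ux p ^ 2 + s.tr p) / s.v p := by positivity
    unfold grad
    linarith
  have h5 : s.bx 0 p ^ 2 / s.v p + s.bx 1 p ^ 2 / s.v p ≤ s.grad r p := by
    have := s.heat_nonneg r p
    have : (s.bx 0 p ^ 2 + s.bx 1 p ^ 2) / s.v p ≤ (s.ux p ^ 2 + s.tr p) / s.v p := by
      unfold tr
      refine div_le_div_of_nonneg_right ?_ hv0.le
      nlinarith [sq_nonneg (s.ux p), sq_nonneg (s.wx 0 p), sq_nonneg (s.wx 1 p)]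
    rw [← add_div]
    unfold grad
    linarith
  rw [e]
  linarith [h3 0, h3 1]

end Effective

lemma exists_eff_zero_le (hα : 0 ≤ α) (hδ : 0 < δ) : ∃ C > 0, ∀ s : MHD α β T, s.Adm K δ →
    ∀ a b, a ≤ b → sInt (fun p => s.eff p ^ 2) a b 0 ≤ C := by
  set M := (1 + α * δ ^ (-α)) / δ with hM
  have hM0 : 0 < M := by positivity
  refine ⟨(2 * M ^ 2 + 2) * K ^ 2 + 1, by positivity, fun s hs a b hab => ?_⟩
  have h1 : sInt (fun p => s.eff p ^ 2) a b 0 ≤ sInt (fun p => (2 * M ^ 2 + 2)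
    * ((s.v p - 1) ^ 2 + s.u p ^ 2 + (s.θ p - 1) ^ 2
    + (s.b 0 p ^ 2 + s.b 1 p ^ 2) + (s.w 0 p ^ 2 + s.w 1 p ^ 2) + s.vx p ^ 2 + s.ux p ^ 2
    + s.θx p ^ 2 + (s.bx 0 p ^ 2 + s.bx 1 p ^ 2) + (s.wx 0 p ^ 2 + s.wx 1 p ^ 2))) a b 0 := by
    refine sInt_mono hab (by fun_prop) (by fun_prop) fun x _ => ?_
    have hv := hs.2.1 x
    have hv0 := s.v_pos (x, 0)
    have hμ := s.one_le_mu hα (x, 0)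
    have h2 : s.mu (x, 0) / s.v (x, 0) ≤ M := by
      have : s.mu (x, 0) ≤ 1 + α * δ ^ (-α) := by
        have := Real.rpow_le_rpow_of_nonpos hδ hv (by linarith : -α ≤ 0)
        unfold mu visc
        gcongr
      rw [hM]
      gcongr
    have h3 : 0 ≤ s.mu (x, 0) / s.v (x, 0) := by positivity
    have h4 : (s.mu (x, 0) / s.v (x, 0)) ^ 2 * s.vx (x, 0) ^ 2 ≤ M ^ 2 * s.vx (x, 0) ^ 2 := by
      gcongr
    have h5 : s.eff (x, 0) ^ 2
        ≤ 2 * ((s.mu (x, 0) / s.v (x, 0)) ^ 2 * s.vx (x, 0) ^ 2) + 2 * s.u (x, 0) ^ 2 := by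
      unfold eff
      nlinarith [sq_nonneg (s.mu (x, 0) / s.v (x, 0) * s.vx (x, 0) + s.u (x, 0))]
    have h6 : s.eff (x, 0) ^ 2 ≤ (2 * M ^ 2 + 2) * (s.vx (x, 0) ^ 2 + s.u (x, 0) ^ 2) := by
      nlinarith [mul_nonneg (sq_nonneg M) (sq_nonneg (s.u (x, 0))), sq_nonneg (s.vx (x, 0))]
    refine h6.trans (mul_le_mul_of_nonneg_left ?_ (by positivity))
    have : 0 ≤ (s.v (x, 0) - 1) ^ 2 + (s.θ (x, 0) - 1) ^ 2
      + (s.b 0 (x, 0) ^ 2 + s.b 1 (x, 0) ^ 2) + (s.w 0 (x, 0) ^ 2 + s.w 1 (x, 0) ^ 2)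
      + s.ux (x, 0) ^ 2 + s.θx (x, 0) ^ 2 + (s.bx 0 (x, 0) ^ 2 + s.bx 1 (x, 0) ^ 2)
      + (s.wx 0 (x, 0) ^ 2 + s.wx 1 (x, 0) ^ 2) := by positivity
    linarith
  rw [sInt_const_mul] at h1
  have h2 := mul_le_mul_of_nonneg_left (hs.1 a b hab) (by positivity : 0 ≤ 2 * M ^ 2 + 2)
  linarith

lemma exists_vx_le (hα : 0 ≤ α) (hβ : 0 < β) (hT : 0 < T) (hδ : 0 < δ) : ∃ C > 0,
    ∀ s : MHD α β T, s.Adm K δ → ∀ t ∈ Icc 0 T, ∀ a b, a ≤ b →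
      sInt (fun p => s.vx p ^ 2) a b t ≤ C := by
  obtain ⟨E, hE0, hE⟩ := exists_bas_le (α := α) (β := β) (K := K) hα hT hδ
  obtain ⟨c₁, hc₁, C₁, hC₁, hv⟩ := exists_le_v (β := β) (K := K) hα hT hδ
  obtain ⟨V, hV0, hV⟩ := exists_v_le (K := K) hα hβ hT hδ
  obtain ⟨c₂, hc₂, hθ⟩ := exists_le_θ (β := β) (K := K) hα hT hδ
  obtain ⟨A, hA, hAb⟩ := exists_θ_add_sq_b_le (K := K) hα hβ hT hδ
  obtain ⟨D, hD, hG⟩ := exists_grad_le (K := K) hα hβ hT hδ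
  obtain ⟨Z, hZ, hZ0⟩ := exists_eff_zero_le (β := β) (T := T) (K := K) hα hδ
  set c := min c₁ c₂ with hc
  have hc0 : 0 < c := lt_min hc₁ hc₂
  set r := rexp β with hr
  have hr1 : -1 ≤ r := by
    have := min_le_left β 1
    rw [hr, rexp]
    linarith
  set L := c ^ (-r - 1) / c + V with hL
  have hL0 : 0 < L := by positivity
  set Y := (Z + (A / c * E * (T + D) + 2 * D)) * Real.exp (L * A * (T + D)) with hY
  have hY0 : 0 < Y := by positivity
  refine ⟨V ^ 2 * (2 * Y + 4 * E), by positivity, fun s hs => ?_⟩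
  have hvθ : ∀ x, ∀ t ∈ Icc 0 T, c ≤ s.v (x, t) ∧ c ≤ s.θ (x, t) := fun x t ht =>
    ⟨(min_le_left _ _).trans (hv s hs x t ht).1, (min_le_right _ _).trans (hθ s hs x t ht)⟩
  intro t₁ ht₁ a b hab
  set m : ℝ → ℝ := fun t => 1 + sInt (s.grad r) a (b + 1) t with hm
  have cm : Continuous m := (continuous_sInt (s.continuous_grad r)).const_add 1
  have hm0 : ∀ t, 0 ≤ m t := fun t =>
    add_nonneg zero_le_one (sInt_nonneg (by linarith) fun x _ => s.grad_nonneg _ _)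
  have hmI : ∀ t ∈ Icc 0 T, ∫ τ in (0:ℝ)..t, m τ ≤ T + D := by
    intro t ht
    rw [hm, intervalIntegral.integral_add (by simp)
      ((continuous_sInt (s.continuous_grad _)).intervalIntegrable _ _)]
    have := (dInt_mono_time (s.continuous_grad r) (by linarith : a ≤ b + 1) (s.grad_nonneg _)
      ht.1 ht.2).trans (hG s hs a (b + 1) (by linarith))
    simp only [intervalIntegral.integral_const, sub_zero, smul_eq_mul, mul_one]
    exact add_le_add ht.2 this
  set y : ℝ → ℝ := fun t => sInt (fun p => s.eff p ^ 2) a b t with hy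
  have cy : Continuous y := continuous_sInt (by fun_prop)
  have point : ∀ t ∈ Icc 0 T, sInt (fun p => 2 * s.eff p * s.Px p) a b t
      ≤ A / c * E * m t + 2 * sInt (s.grad r) a b t + L * A * m t * y t := by
    intro t ht
    have h1 : sInt (fun p => 2 * s.eff p * s.Px p) a b t
        ≤ sInt (fun p => A / c * m t * s.bas p + 2 * s.grad r p + L * A * m t * s.eff p ^ 2)
          a b t := by
      refine sInt_mono hab (by fun_prop) (by fun_prop) fun x hx => ?_
      obtain ⟨hvx, hθx⟩ := hvθ x t ht
      refine (s.eff_mul_Px_le hα hc0 (x, t) hvx (hV s hs x t ht) hr1 hθx).trans ?_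
      have g1 : s.θ (x, t) + (s.b 0 (x, t) ^ 2 + s.b 1 (x, t) ^ 2) ≤ A * m t := by
        refine (hAb s hs x x ⟨le_rfl, by linarith⟩ t ht).trans ?_
        have := sInt_subset (t := t) (s.continuous_grad r) (fun y => s.grad_nonneg r (y, t)) hx.1
          (by linarith : x ≤ x + 1) (by linarith [hx.2] : x + 1 ≤ b + 1)
        exact mul_le_mul_of_nonneg_left (add_le_add le_rfl this) hA.le
      have g2 : 0 ≤ s.b 0 (x, t) ^ 2 + s.b 1 (x, t) ^ 2 := by positivity
      have g3 := s.θ_pos (x, t)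
      have g4 := s.bas_nonneg (x, t)
      have g5 : s.θ (x, t) / c * s.bas (x, t) ≤ A / c * m t * s.bas (x, t) := by
        have : A / c * m t = A * m t / c := by ring
        rw [this]
        gcongr
        linarith
      have g6 : c ^ (-r - 1) / c * s.θ (x, t) + V * (s.b 0 (x, t) ^ 2 + s.b 1 (x, t) ^ 2)
          ≤ L * A * m t := by
        have k1 := mul_le_mul_of_nonneg_left g1 hL0.le
        have k2 : 0 ≤ c ^ (-r - 1) / c := by positivity
        have k3 := mul_nonneg k2 g2
        have k4 := mul_nonneg hV0.le g3.le
        rw [hL] at k1 ⊢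
        linarith
      gcongr
    rw [sInt_add (by fun_prop) (by fun_prop), sInt_add (by fun_prop) (by fun_prop),
      sInt_const_mul, sInt_const_mul, sInt_const_mul] at h1
    have h2 := mul_le_mul_of_nonneg_left (hE s hs t ht a b hab)
      (mul_nonneg (by positivity : 0 ≤ A / c) (hm0 t))
    change _ ≤ _ + _ + L * A * m t * y t at h1
    linarith
  have gr : ∀ t ∈ Icc 0 T, y t ≤ (Z + (A / c * E * (T + D) + 2 * D))
      + ∫ τ in (0:ℝ)..t, L * A * m τ * y τ := by
    intro t ht
    have e1 := sInt_sub_sInt_zero (a := a) (b := b) (N := fun p => s.eff p ^ 2)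
      (Nt := fun p => 2 * s.eff p * s.Px p) (by fun_prop) (by fun_prop)
      (fun x t ht => ((s.hasDerivAt_eff x ht).fun_pow 2).congr_deriv (by push_cast; ring)) ht
    have i1 : IntervalIntegrable (fun τ => A / c * E * m τ) volume 0 t :=
      (cm.const_mul _).intervalIntegrable _ _
    have i2 : IntervalIntegrable (fun τ => 2 * sInt (s.grad r) a b τ) volume 0 t :=
      ((continuous_sInt (s.continuous_grad r)).const_mul _).intervalIntegrable _ _
    have i3 : IntervalIntegrable (fun τ => L * A * m τ * y τ) volume 0 t :=
      ((cm.const_mul _).mul cy).intervalIntegrable _ _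
    have h1 := intervalIntegral.integral_mono_on ht.1
      ((continuous_sInt (by fun_prop : Continuous fun p => 2 * s.eff p * s.Px p)).intervalIntegrable
        _ _) ((i1.add i2).add i3) fun τ hτ => point τ ⟨hτ.1, hτ.2.trans ht.2⟩
    rw [intervalIntegral.integral_add (i1.add i2) i3, intervalIntegral.integral_add i1 i2,
      intervalIntegral.integral_const_mul, intervalIntegral.integral_const_mul] at h1
    change dInt _ a b t ≤ _ + 2 * dInt (s.grad r) a b t + _ at h1
    have h2 := mul_le_mul_of_nonneg_left (hmI t ht) (by positivity : 0 ≤ A / c * E)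
    have h3 := (dInt_mono_time (s.continuous_grad r) hab (s.grad_nonneg _)
      ht.1 ht.2).trans (hG s hs a b hab)
    have h4 := hZ0 s hs a b hab
    change y t - _ = _ at e1
    linarith
  have hyY : y t₁ ≤ Y := by
    refine (gronwall_integral (m := fun τ => L * A * m τ) cy (by fun_prop)
      (fun t _ => mul_nonneg (by positivity) (hm0 t)) gr ht₁).trans ?_
    rw [intervalIntegral.integral_const_mul, hY]
    have := hmI t₁ ht₁
    gcongr
  have h1 : sInt (fun p => s.vx p ^ 2) a b t₁
      ≤ sInt (fun p => V ^ 2 * (2 * s.eff p ^ 2 + 4 * s.bas p)) a b t₁ :=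
    sInt_mono hab (by fun_prop) (by fun_prop) fun x _ => s.sq_vx_le hα (hV s hs x t₁ ht₁)
  rw [sInt_const_mul, sInt_add (by fun_prop) (by fun_prop), sInt_const_mul, sInt_const_mul] at h1
  refine h1.trans ?_
  have := hE s hs t₁ ht₁ a b hab
  change V ^ 2 * (2 * y t₁ + _) ≤ _
  gcongr

end MHD

/-- A one-dimensional Sobolev inequality with cut-off. -/
lemma cut_sq_mul_sq_le {R : ℝ} (hR : 1 ≤ R) {h h' : ℝ → ℝ} (hd : ∀ x, HasDerivAt h (h' x) x)
    (hc : Continuous h') {x : ℝ} (hx : x ∈ Icc (-R) R) :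
    cut R x ^ 2 * h x ^ 2
      ≤ 5 * (∫ z in (-R)..R, h z ^ 2) + ∫ z in (-R)..R, cut R z ^ 2 * h' z ^ 2 := by
  have hR0 : 0 < R := by linarith
  have hh : Continuous h := continuous_iff_continuousAt.2 fun x => (hd x).continuousAt
  have h1 := abs_le_abs_add_integral (h := fun z => cut R z ^ 2 * h z ^ 2)
    (h' := fun z => cutD R z * h z ^ 2 + cut R z ^ 2 * (2 * h z * h' z))
    (fun z => (((hasDerivAt_cut_sq R z).mul ((hd z).fun_pow 2)).congr_deriv (by push_cast; ring)))
    (by fun_prop) hx (⟨le_rfl, by linarith⟩ : -R ∈ Icc (-R) R)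
  rw [cut_neg_self hR0, abs_of_nonneg (by positivity)] at h1
  simp only [ne_eq, OfNat.ofNat_ne_zero, not_false_eq_true, zero_pow, zero_mul, abs_zero,
    zero_add] at h1
  refine h1.trans ?_
  rw [← intervalIntegral.integral_const_mul, ← intervalIntegral.integral_add
    (Continuous.intervalIntegrable (by fun_prop) _ _)
    (Continuous.intervalIntegrable (by fun_prop) _ _)]
  refine intervalIntegral.integral_mono_on (by linarith)
    (Continuous.intervalIntegrable (by fun_prop) _ _)
    (Continuous.intervalIntegrable (by fun_prop) _ _) fun z hz => ?_
  have k0 := cut_nonneg hR0 hz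
  have k1 : cut R z ≤ 1 := cut_le_one
  have k2 : |cutD R z| ≤ 4 := by
    refine (abs_cutD_le hR0 hz).trans ?_
    have : 4 / R ≤ 4 := div_le_self (by norm_num) hR
    have : 0 ≤ 4 / R := by positivity
    nlinarith
  have k3 : cut R z ^ 2 ≤ 1 := pow_le_one₀ k0 k1
  refine abs_le.2 ⟨?_, ?_⟩
  · nlinarith [abs_le.1 k2, sq_nonneg (h z), mul_nonneg (sq_nonneg (cut R z)) (sq_nonneg (h z + h' z))]
  · nlinarith [abs_le.1 k2, sq_nonneg (h z), mul_nonneg (sq_nonneg (cut R z)) (sq_nonneg (h z - h' z))]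

namespace MHD

variable {α β T K δ : ℝ}

/-- A scalar parabolic equation `a f_t = (f_x / v)_x + g`. -/
structure Par (s : MHD α β T) (f fx fxx ft a g : ℝ × ℝ → ℝ) : Prop where
  cfx : Continuous fx
  cfxx : Continuous fxx
  cft : Continuous ft
  ca : Continuous a
  cg : Continuous g
  dx : ∀ x t, HasDerivAt (fun y => f (y, t)) (fx (x, t)) x
  dxx : ∀ x t, HasDerivAt (fun y => fx (y, t)) (fxx (x, t)) x
  dt : ∀ x, ∀ t ∈ Ioo 0 T, HasDerivAt (fun τ => f (x, τ)) (ft (x, t)) t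
  dq : ∀ x t, HasDerivAt (fun y => fx (y, t) / s.v (y, t)) (a (x, t) * ft (x, t) - g (x, t)) x

variable {s : MHD α β T} {f fx fxx ft a g : ℝ × ℝ → ℝ}

lemma Par.fxx_eq (h : s.Par f fx fxx ft a g) (p : ℝ × ℝ) :
    fxx p = s.v p * (a p * ft p - g p) + s.vx p * (fx p / s.v p) := by
  have hv := (s.v_pos p).ne'
  have := (h.dq p.1 p.2).unique ((h.dxx p.1 p.2).div (s.dvx p.1 p.2) hv)
  rw [this]
  field_simp
  ring

lemma Par.hasDerivAt_energy (h : s.Par f fx fxx ft a g) {R : ℝ} (hR : 0 < R) {t : ℝ}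
    (ht : t ∈ Ioo 0 T) :
    HasDerivAt (fun t => sInt (fun q => cut R q.1 ^ 2 * ((s.v q)⁻¹ * fx q ^ 2)) (-R) R t)
      (sInt (fun q => cut R q.1 ^ 2 * (-s.ux q / s.v q ^ 2 * fx q ^ 2)
        - 2 * ((cutD R q.1 * ((s.v q)⁻¹ * fx q)
          + cut R q.1 ^ 2 * (-s.vx q / s.v q ^ 2 * fx q + (s.v q)⁻¹ * fxx q)) * ft q)) (-R) R t) t := by
  have c2 : ∀ p, s.v p ^ 2 ≠ 0 := fun p => (pow_pos (s.v_pos p) 2).ne'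
  have c1 : ∀ p, s.v p ≠ 0 := fun p => (s.v_pos p).ne'
  exact hasDerivAt_dirichlet (p := fun x => cut R x ^ 2) (p' := cutD R) (A := fun q => (s.v q)⁻¹)
    (Ax := fun q => -s.vx q / s.v q ^ 2) (At := fun q => -s.ux q / s.v q ^ 2)
    (hasDerivAt_cut_sq R) (by fun_prop) (by simp [cut_neg_self hR]) (by simp [cut_self hR])
    (by fun_prop (disch := intro p; exact c1 p)) (by fun_prop (disch := intro p; exact c2 p))
    (by fun_prop (disch := intro p; exact c2 p)) h.cfx h.cfxx h.cft
    (fun x t => (s.dvx x t).fun_inv (c1 _)) (fun x t ht => (s.dvt x t ht).fun_inv (c1 _))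
    h.dx h.dxx h.dt ht

lemma Par.sInt_flux_sq_le (h : s.Par f fx fxx ft a g) {L R t : ℝ} (hL : 0 < L) (hRR : -R ≤ R)
    (ha : ∀ x, 1 ≤ L * a (x, t)) (haL : ∀ x, a (x, t) ≤ L) :
    sInt (fun q => cut R q.1 ^ 2 * (a q * ft q - g q) ^ 2) (-R) R t
      ≤ 2 * L ^ 2 * sInt (fun q => cut R q.1 ^ 2 * ft q ^ 2) (-R) R t
        + 2 * sInt (fun q => cut R q.1 ^ 2 * g q ^ 2) (-R) R t := by
  have cft := h.cft
  have ca := h.ca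
  have cg := h.cg
  have : sInt (fun q => cut R q.1 ^ 2 * (a q * ft q - g q) ^ 2) (-R) R t
      ≤ sInt (fun q => 2 * L ^ 2 * (cut R q.1 ^ 2 * ft q ^ 2)
      + 2 * (cut R q.1 ^ 2 * g q ^ 2)) (-R) R t := by
    refine sInt_mono hRR (by fun_prop) (by fun_prop) fun x _ => ?_
    have n1 : a (x, t) ^ 2 ≤ L ^ 2 := by
      have : 0 ≤ a (x, t) := by
        by_contra! hn
        nlinarith [ha x]
      have := haL x
      gcongr
    have n2 : (a (x, t) * ft (x, t) - g (x, t)) ^ 2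
        ≤ 2 * (a (x, t) ^ 2 * ft (x, t) ^ 2) + 2 * g (x, t) ^ 2 := by
      nlinarith [sq_nonneg (a (x, t) * ft (x, t) + g (x, t))]
    have n3 : a (x, t) ^ 2 * ft (x, t) ^ 2 ≤ L ^ 2 * ft (x, t) ^ 2 := by gcongr
    have n4 := mul_le_mul_of_nonneg_left (n2.trans (by linarith :
      _ ≤ 2 * (L ^ 2 * ft (x, t) ^ 2) + 2 * g (x, t) ^ 2)) (sq_nonneg (cut R x))
    linarith
  rwa [sInt_add (by fun_prop) (by fun_prop), sInt_const_mul, sInt_const_mul] at this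

lemma Par.energy_deriv_le (h : s.Par f fx fxx ft a g) {L R t : ℝ} (hL : 1 ≤ L) (hR : 1 ≤ R)
    (ha : ∀ x, 1 ≤ L * a (x, t)) (haL : ∀ x, a (x, t) ≤ L) :
    sInt (fun q => cut R q.1 ^ 2 * (-s.ux q / s.v q ^ 2 * fx q ^ 2)
        - 2 * ((cutD R q.1 * ((s.v q)⁻¹ * fx q)
          + cut R q.1 ^ 2 * (-s.vx q / s.v q ^ 2 * fx q + (s.v q)⁻¹ * fxx q)) * ft q)) (-R) R t
      + 1 / (2 * L) * sInt (fun q => cut R q.1 ^ 2 * ft q ^ 2) (-R) R t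
      ≤ 34 * L ^ 3 * (sInt (fun q => s.ux q ^ 2) (-R) R t
          * sInt (fun q => cut R q.1 ^ 2 * (fx q / s.v q) ^ 2) (-R) R t
        + sInt (fun q => (fx q / s.v q) ^ 2) (-R) R t
        + sInt (fun q => cut R q.1 ^ 2 * g q ^ 2) (-R) R t) := by
  have hR0 : 0 < R := by linarith
  have hL0 : 0 < L := by linarith
  have hRR : -R ≤ R := by linarith
  have c2 : ∀ p, s.v p ^ 2 ≠ 0 := fun p => (pow_pos (s.v_pos p) 2).ne'
  have c1 : ∀ p, s.v p ≠ 0 := fun p => (s.v_pos p).ne'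
  have cfx := h.cfx
  have cfxx := h.cfxx
  have cft := h.cft
  have ca := h.ca
  have cg := h.cg
  have cq : Continuous fun q => fx q / s.v q := by fun_prop (disch := intro p; exact c1 p)
  set Q : ℝ × ℝ → ℝ := fun q => fx q / s.v q with hQ
  have h1 : sInt (fun q => cut R q.1 ^ 2 * (-s.ux q / s.v q ^ 2 * fx q ^ 2)
        - 2 * ((cutD R q.1 * ((s.v q)⁻¹ * fx q)
          + cut R q.1 ^ 2 * (-s.vx q / s.v q ^ 2 * fx q + (s.v q)⁻¹ * fxx q)) * ft q)) (-R) R t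
      ≤ sInt (fun q => (|s.ux q| * (cut R q.1 ^ 2 * Q q ^ 2) + 32 * L * Q q ^ 2
        + 2 * L * (cut R q.1 ^ 2 * g q ^ 2)) - 1 / L * (cut R q.1 ^ 2 * ft q ^ 2)) (-R) R t := by
    refine sInt_mono hRR (by fun_prop (disch := intro p; first | exact c2 p | exact c1 p))
      (by fun_prop) fun x hx => ?_
    have e1 : -s.vx (x, t) / s.v (x, t) ^ 2 * fx (x, t) + (s.v (x, t))⁻¹ * fxx (x, t)
        = a (x, t) * ft (x, t) - g (x, t) := by
      rw [h.fxx_eq]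
      have := c1 (x, t)
      field_simp
      ring
    have e2 : -s.ux (x, t) / s.v (x, t) ^ 2 * fx (x, t) ^ 2 = -s.ux (x, t) * Q (x, t) ^ 2 := by
      simp only [hQ]
      ring
    have e3 : (s.v (x, t))⁻¹ * fx (x, t) = Q (x, t) := by
      simp only [hQ]
      ring
    simp only [e1, e2, e3]
    have k0 := cut_nonneg hR0 hx
    have k1 : |cutD R x| ≤ 4 * cut R x := by
      refine (abs_cutD_le hR0 hx).trans ?_
      have : 4 / R ≤ 4 := div_le_self (by norm_num) hR
      gcongr
    generalize cut R x = ζ at *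
    generalize cutD R x = ζ' at *
    generalize s.ux (x, t) = U
    generalize Q (x, t) = q
    generalize hF : ft (x, t) = F
    generalize g (x, t) = G
    have ha' := ha x
    generalize a (x, t) = A at *
    have m1 : -U * (ζ ^ 2 * q ^ 2) ≤ |U| * (ζ ^ 2 * q ^ 2) := by
      have := neg_le_abs U
      gcongr
    have m2 : -2 * (ζ' * q * F) ≤ 1 / (2 * L) * (ζ ^ 2 * F ^ 2) + 32 * L * q ^ 2 := by
      have n1 : -2 * (ζ' * q * F) ≤ 8 * (ζ * |F|) * |q| := by
        have : -(ζ' * q * F) ≤ |ζ'| * |q| * |F| := by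
          rw [← abs_mul, ← abs_mul]
          exact neg_le_abs _
        have : |ζ'| * |q| * |F| ≤ 4 * ζ * |q| * |F| := by gcongr
        linarith
      have n2 : 0 ≤ 1 / (2 * L) * (ζ * |F| - 8 * L * |q|) ^ 2 := by positivity
      have n3 : 1 / (2 * L) * (ζ * |F| - 8 * L * |q|) ^ 2
          = 1 / (2 * L) * (ζ ^ 2 * |F| ^ 2) + 32 * L * |q| ^ 2 - 8 * (ζ * |F|) * |q| := by
        field_simp
        ring
      rw [n3, sq_abs, sq_abs] at n2
      linarith
    have m3 : 2 * (ζ ^ 2 * (G * F)) ≤ 1 / (2 * L) * (ζ ^ 2 * F ^ 2) + 2 * L * (ζ ^ 2 * G ^ 2) := by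
      have n2 : 0 ≤ 1 / (2 * L) * (ζ ^ 2 * (F - 2 * L * G) ^ 2) := by positivity
      have n3 : 1 / (2 * L) * (ζ ^ 2 * (F - 2 * L * G) ^ 2)
          = 1 / (2 * L) * (ζ ^ 2 * F ^ 2) + 2 * L * (ζ ^ 2 * G ^ 2) - 2 * (ζ ^ 2 * (G * F)) := by
        field_simp
        ring
      linarith
    have m4 : 2 / L * (ζ ^ 2 * F ^ 2) ≤ 2 * (A * (ζ ^ 2 * F ^ 2)) := by
      have : 1 / L ≤ A := by
        rw [div_le_iff₀ hL0]
        linarith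
      have : 1 / L * (ζ ^ 2 * F ^ 2) ≤ A * (ζ ^ 2 * F ^ 2) := by gcongr
      have e : 2 / L = 2 * (1 / L) := by ring
      rw [e]
      linarith
    have e4 : 2 / L = 1 / (2 * L) + 1 / (2 * L) + 1 / L := by
      field_simp
      norm_num
    rw [e4] at m4
    linarith
  refine (add_le_add h1 le_rfl).trans ?_
  clear h1
  rw [sInt_sub (by fun_prop) (by fun_prop), sInt_add (by fun_prop) (by fun_prop),
    sInt_add (by fun_prop) (by fun_prop), sInt_const_mul, sInt_const_mul, sInt_const_mul]
  set I1 := sInt (fun q => |s.ux q| * (cut R q.1 ^ 2 * Q q ^ 2)) (-R) R t with hI1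
  set N := sInt (fun q => s.ux q ^ 2) (-R) R t with hN
  set Z := sInt (fun q => cut R q.1 ^ 2 * Q q ^ 2) (-R) R t with hZ
  set X := sInt (fun q => Q q ^ 2) (-R) R t with hX
  set Gg := sInt (fun q => cut R q.1 ^ 2 * g q ^ 2) (-R) R t with hGg
  set F := sInt (fun q => cut R q.1 ^ 2 * ft q ^ 2) (-R) R t with hF
  set W := sInt (fun q => cut R q.1 ^ 2 * (a q * ft q - g q) ^ 2) (-R) R t with hW
  have nn : ∀ u v : ℝ × ℝ → ℝ, 0 ≤ sInt (fun q => u q ^ 2 * v q ^ 2) (-R) R t := fun u v =>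
    sInt_nonneg hRR fun x _ => by positivity
  have nZ : 0 ≤ Z := nn (fun q => cut R q.1) Q
  have nG : 0 ≤ Gg := nn (fun q => cut R q.1) g
  have nF : 0 ≤ F := nn (fun q => cut R q.1) ft
  have nW : 0 ≤ W := nn (fun q => cut R q.1) (fun q => a q * ft q - g q)
  have nN : 0 ≤ N := sInt_nonneg hRR fun x _ => by positivity
  have nX : 0 ≤ X := sInt_nonneg hRR fun x _ => by positivity
  have h2 : ∀ x ∈ Icc (-R) R, cut R x ^ 2 * Q (x, t) ^ 2 ≤ 5 * X + W := fun x hx =>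
    cut_sq_mul_sq_le hR (fun y => h.dq y t) (by fun_prop) hx
  have h3 : W ≤ 2 * L ^ 2 * F + 2 * Gg := h.sInt_flux_sq_le hL0 hRR ha haL
  have h4 : I1 ≤ 1 / (4 * L ^ 3) * (5 * X + W) + L ^ 3 * (N * Z) := by
    have k1 : I1 ^ 2 ≤ N * (Z * (5 * X + W)) := by
      have := integral_mul_sq_le hRR (f := fun x => |s.ux (x, t)|)
        (g := fun x => cut R x ^ 2 * Q (x, t) ^ 2) (by fun_prop) (by fun_prop)
      simp only [sq_abs] at this
      refine this.trans (mul_le_mul_of_nonneg_left ?_ nN)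
      rw [mul_comm Z, hZ, ← sInt_const_mul]
      refine intervalIntegral.integral_mono_on hRR
        (Continuous.intervalIntegrable (by fun_prop) _ _)
        (Continuous.intervalIntegrable (by fun_prop) _ _) fun x hx => ?_
      have := h2 x hx
      change (cut R x ^ 2 * Q (x, t) ^ 2) ^ 2 ≤ (5 * X + W) * (cut R x ^ 2 * Q (x, t) ^ 2)
      rw [sq (cut R x ^ 2 * Q (x, t) ^ 2)]
      exact mul_le_mul_of_nonneg_right this (by positivity)
    refine abs_le_of_sq_le_sq' (k1.trans ?_) (by positivity) |>.2
    have e : 1 / (4 * L ^ 3) * (5 * X + W) * (L ^ 3 * (N * Z)) = N * (Z * (5 * X + W)) / 4 := by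
      field_simp
    nlinarith [sq_nonneg (1 / (4 * L ^ 3) * (5 * X + W) - L ^ 3 * (N * Z))]
  have h5 : 1 / (4 * L ^ 3) * (5 * X + W) ≤ 2 * L ^ 3 * X + 1 / (2 * L) * F + L ^ 3 * Gg := by
    have k1 : 1 / (4 * L ^ 3) * (5 * X + W) ≤ 1 / (4 * L ^ 3) * (5 * X + (2 * L ^ 2 * F + 2 * Gg)) := by
      gcongr
    have k2 : 1 / (4 * L ^ 3) * (5 * X + (2 * L ^ 2 * F + 2 * Gg))
        = 1 / (4 * L ^ 3) * (5 * X + 2 * Gg) + 1 / (2 * L) * F := by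
      field_simp
      ring
    have k3 : 1 ≤ L ^ 3 := one_le_pow₀ hL
    have k4 : 1 / (4 * L ^ 3) * (5 * X + 2 * Gg) ≤ 1 / 4 * (5 * X + 2 * Gg) := by
      refine mul_le_mul_of_nonneg_right ?_ (by positivity)
      rw [div_le_div_iff₀ (by positivity) (by norm_num)]
      linarith
    nlinarith
  have k3 : L ≤ L ^ 3 := le_self_pow₀ hL (by norm_num)
  have e5 : 1 / L = 1 / (2 * L) + 1 / (2 * L) := by
    field_simp
    norm_num
  rw [e5]
  nlinarith [mul_le_mul_of_nonneg_right k3 nX, mul_le_mul_of_nonneg_right k3 nG,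
    mul_nonneg nN nZ, pow_pos hL0 3, mul_nonneg (pow_pos hL0 3).le (mul_nonneg nN nZ)]

end MHD

namespace MHD

variable {α β T K δ : ℝ}

/-- A scalar parabolic equation together with the bounds on its coefficients that control the
energy of its solution. -/
structure ParBound (s : MHD α β T) (f fx fxx ft a g : ℝ × ℝ → ℝ) (r L D W Y G : ℝ) : Prop where
  par : s.Par f fx fxx ft a g
  le_v : ∀ x, ∀ t ∈ Icc 0 T, 1 ≤ L * s.v (x, t)
  v_le : ∀ x, ∀ t ∈ Icc 0 T, s.v (x, t) ≤ L
  le_a : ∀ x, ∀ t ∈ Icc 0 T, 1 ≤ L * a (x, t)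
  a_le : ∀ x, ∀ t ∈ Icc 0 T, a (x, t) ≤ L
  fx_le : ∀ p, fx p ^ 2 ≤ s.tr p
  grad_le : ∀ x y, x ≤ y → dInt (s.grad r) x y T ≤ D
  vx_le : ∀ t ∈ Icc 0 T, ∀ x y, x ≤ y → sInt (fun p => s.vx p ^ 2) x y t ≤ W
  fx_zero_le : ∀ x y, x ≤ y → sInt (fun p => fx p ^ 2) x y 0 ≤ Y
  g_le : ∀ R, 1 ≤ R → ∀ t ∈ Icc 0 T, sInt (fun q => cut R q.1 ^ 2 * g q ^ 2) (-R) R t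
    ≤ G * sInt (s.grad r) (-R) R t
      * (1 + sInt (fun q => cut R q.1 ^ 2 * ((s.v q)⁻¹ * fx q ^ 2)) (-R) R t)

lemma sq_ux_add_tr_le (s : MHD α β T) {r L : ℝ} {p : ℝ × ℝ} (hL : s.v p ≤ L) :
    s.ux p ^ 2 + s.tr p ≤ L * s.grad r p := by
  have hv := s.v_pos p
  have h1 := s.tr_nonneg p
  have h2 := s.heat_nonneg r p
  have h3 : s.v p * ((s.ux p ^ 2 + s.tr p) / s.v p) = s.ux p ^ 2 + s.tr p := by field_simp
  have h4 : 0 ≤ (s.ux p ^ 2 + s.tr p) / s.v p := by positivity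
  have h5 := mul_le_mul_of_nonneg_right hL h4
  have h6 : 0 ≤ L * s.heat r p := mul_nonneg (hv.le.trans hL) h2
  unfold grad
  linarith

variable {s : MHD α β T} {f fx fxx ft a g : ℝ × ℝ → ℝ} {r L D W Y G : ℝ}

namespace ParBound

lemma inv_v_le (h : s.ParBound f fx fxx ft a g r L D W Y G) (x : ℝ) {t : ℝ} (ht : t ∈ Icc 0 T) :
    (s.v (x, t))⁻¹ ≤ L := by
  have hv := s.v_pos (x, t)
  rw [inv_le_iff_one_le_mul₀ hv]
  exact h.le_v x t ht

lemma sInt_sq_flux_le (h : s.ParBound f fx fxx ft a g r L D W Y G) {R t : ℝ}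
    (hR : -R ≤ R) (ht : t ∈ Icc 0 T) :
    sInt (fun q => (fx q / s.v q) ^ 2) (-R) R t ≤ L * sInt (s.grad r) (-R) R t := by
  have c1 : ∀ p, s.v p ≠ 0 := fun p => (s.v_pos p).ne'
  have cfx := h.par.cfx
  rw [← sInt_const_mul]
  refine sInt_mono hR (by fun_prop (disch := intro p; exact c1 p)) (by fun_prop) fun x _ => ?_
  have hv := s.v_pos (x, t)
  have h1 := h.fx_le (x, t)
  have h2 := s.heat_nonneg r (x, t)
  have h3 := h.inv_v_le x ht
  have h4 : fx (x, t) ^ 2 / s.v (x, t) ≤ s.grad r (x, t) := by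
    have : fx (x, t) ^ 2 / s.v (x, t) ≤ (s.ux (x, t) ^ 2 + s.tr (x, t)) / s.v (x, t) := by
      gcongr
      linarith [sq_nonneg (s.ux (x, t))]
    unfold grad
    linarith
  calc (fx (x, t) / s.v (x, t)) ^ 2 = (s.v (x, t))⁻¹ * (fx (x, t) ^ 2 / s.v (x, t)) := by
        field_simp
    _ ≤ L * s.grad r (x, t) := by
        have := s.grad_nonneg r (x, t)
        gcongr
        exact (inv_nonneg.2 hv.le).trans h3

lemma energy_le (h : s.ParBound f fx fxx ft a g r L D W Y G) (hL : 1 ≤ L)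
    {R : ℝ} (hR : 1 ≤ R) {t : ℝ} (ht : t ∈ Icc 0 T) :
    sInt (fun q => cut R q.1 ^ 2 * ((s.v q)⁻¹ * fx q ^ 2)) (-R) R t
        + 1 / (2 * L) * dInt (fun q => cut R q.1 ^ 2 * ft q ^ 2) (-R) R t
      ≤ L * Y + ∫ τ in (0:ℝ)..t, 34 * L ^ 3 * (L ^ 2 + L + G) * sInt (s.grad r) (-R) R τ
        * (1 + sInt (fun q => cut R q.1 ^ 2 * ((s.v q)⁻¹ * fx q ^ 2)) (-R) R τ) := by
  have hR0 : 0 < R := by linarith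
  have hL0 : 0 < L := by linarith
  have hRR : -R ≤ R := by linarith
  have c1 : ∀ p, s.v p ≠ 0 := fun p => (s.v_pos p).ne'
  have c2 : ∀ p, s.v p ^ 2 ≠ 0 := fun p => (pow_pos (s.v_pos p) 2).ne'
  have cfx := h.par.cfx
  have cfxx := h.par.cfxx
  have cft := h.par.cft
  have ce : Continuous fun q : ℝ × ℝ => cut R q.1 ^ 2 * ((s.v q)⁻¹ * fx q ^ 2) := by
    fun_prop (disch := intro p; exact c1 p)
  have cd : Continuous fun q : ℝ × ℝ => cut R q.1 ^ 2 * (-s.ux q / s.v q ^ 2 * fx q ^ 2)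
        - 2 * ((cutD R q.1 * ((s.v q)⁻¹ * fx q)
          + cut R q.1 ^ 2 * (-s.vx q / s.v q ^ 2 * fx q + (s.v q)⁻¹ * fxx q)) * ft q) := by
    fun_prop (disch := intro p; first | exact c2 p | exact c1 p)
  have cF : Continuous fun q : ℝ × ℝ => cut R q.1 ^ 2 * ft q ^ 2 := by fun_prop
  have h1 := sub_eq_integral_of_hasDerivAt_Ioo (continuous_sInt ce) (continuous_sInt cd)
    (fun τ hτ => h.par.hasDerivAt_energy hR0 hτ) ht
  have h2 : sInt (fun q => cut R q.1 ^ 2 * ((s.v q)⁻¹ * fx q ^ 2)) (-R) R 0 ≤ L * Y := by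
    refine le_trans ?_ (mul_le_mul_of_nonneg_left (h.fx_zero_le (-R) R hRR) hL0.le)
    rw [← sInt_const_mul]
    refine sInt_mono hRR ce (by fun_prop) fun x hx => ?_
    have k1 := cut_nonneg hR0 hx
    have k2 : cut R x ≤ 1 := cut_le_one
    have k3 := h.inv_v_le x (⟨le_rfl, ht.1.trans ht.2⟩ : (0:ℝ) ∈ Icc 0 T)
    have k4 : cut R x ^ 2 ≤ 1 := pow_le_one₀ k1 k2
    have k5 : 0 ≤ (s.v (x, 0))⁻¹ := inv_nonneg.2 (s.v_pos _).le
    calc _ ≤ 1 * ((s.v (x, 0))⁻¹ * fx (x, 0) ^ 2) := by gcongr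
      _ ≤ _ := by
        rw [one_mul]
        gcongr
  set y : ℝ → ℝ := fun τ => sInt (fun q => cut R q.1 ^ 2 * ((s.v q)⁻¹ * fx q ^ 2)) (-R) R τ
    with hy
  set N : ℝ → ℝ := fun τ => sInt (s.grad r) (-R) R τ with hN
  have cy : Continuous y := continuous_sInt ce
  have cN : Continuous N := continuous_sInt (s.continuous_grad r)
  have point : ∀ τ ∈ Icc 0 t, sInt (fun q => cut R q.1 ^ 2 * (-s.ux q / s.v q ^ 2 * fx q ^ 2)
        - 2 * ((cutD R q.1 * ((s.v q)⁻¹ * fx q)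
          + cut R q.1 ^ 2 * (-s.vx q / s.v q ^ 2 * fx q + (s.v q)⁻¹ * fxx q)) * ft q)) (-R) R τ
      + 1 / (2 * L) * sInt (fun q => cut R q.1 ^ 2 * ft q ^ 2) (-R) R τ
      ≤ 34 * L ^ 3 * (L ^ 2 + L + G) * N τ * (1 + y τ) := by
    intro τ hτ
    have hτ' : τ ∈ Icc 0 T := ⟨hτ.1, hτ.2.trans ht.2⟩
    have n0 : 0 ≤ N τ := sInt_nonneg hRR fun x _ => s.grad_nonneg _ _
    have y0 : 0 ≤ y τ := sInt_nonneg hRR fun x _ => by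
      have : 0 ≤ (s.v (x, τ))⁻¹ := inv_nonneg.2 (s.v_pos _).le
      positivity
    have k1 : sInt (fun q => s.ux q ^ 2) (-R) R τ ≤ L * N τ := by
      rw [hN, ← sInt_const_mul]
      refine sInt_mono hRR (by fun_prop) (by fun_prop) fun x _ => ?_
      have := s.sq_ux_add_tr_le (r := r) (h.v_le x τ hτ')
      linarith [s.tr_nonneg (x, τ)]
    have k2 : sInt (fun q => cut R q.1 ^ 2 * (fx q / s.v q) ^ 2) (-R) R τ ≤ L * y τ := by
      rw [hy, ← sInt_const_mul]
      refine sInt_mono hRR (by fun_prop (disch := intro p; exact c1 p)) (ce.const_mul _)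
        fun x _ => ?_
      have l1 := h.inv_v_le x hτ'
      have l2 : 0 ≤ (s.v (x, τ))⁻¹ := inv_nonneg.2 (s.v_pos _).le
      calc cut R x ^ 2 * (fx (x, τ) / s.v (x, τ)) ^ 2
          = (s.v (x, τ))⁻¹ * (cut R x ^ 2 * ((s.v (x, τ))⁻¹ * fx (x, τ) ^ 2)) := by ring
        _ ≤ _ := by gcongr
    refine (h.par.energy_deriv_le hL hR (fun x => h.le_a x τ hτ')
      fun x => h.a_le x τ hτ').trans ?_
    have k3 := h.sInt_sq_flux_le hRR hτ'
    have k4 := h.g_le R hR τ hτ'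
    change _ ≤ L * N τ at k3
    change _ ≤ G * N τ * (1 + y τ) at k4
    have k5 : sInt (fun q => s.ux q ^ 2) (-R) R τ
        * sInt (fun q => cut R q.1 ^ 2 * (fx q / s.v q) ^ 2) (-R) R τ ≤ L * N τ * (L * y τ) :=
      mul_le_mul k1 k2 (sInt_nonneg hRR fun x _ => by positivity) (by positivity)
    have k6 : L * N τ * (L * y τ) + L * N τ + G * N τ * (1 + y τ)
        ≤ (L ^ 2 + L + G) * N τ * (1 + y τ) := by
      have e1 : 0 ≤ L ^ 2 * N τ := by positivity
      have e2 : 0 ≤ L * N τ * y τ := by positivity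
      linarith
    calc _ ≤ 34 * L ^ 3 * ((L ^ 2 + L + G) * N τ * (1 + y τ)) := by
          refine mul_le_mul_of_nonneg_left ?_ (by positivity)
          linarith
      _ = _ := by ring
  have h3 := intervalIntegral.integral_mono_on (μ := volume) ht.1
    (((continuous_sInt cd).intervalIntegrable 0 t).add
      (((continuous_sInt cF).const_mul _).intervalIntegrable 0 t))
    ((by fun_prop : Continuous fun τ => 34 * L ^ 3 * (L ^ 2 + L + G) * N τ
      * (1 + y τ)).intervalIntegrable 0 t) point
  rw [intervalIntegral.integral_add ((continuous_sInt cd).intervalIntegrable 0 t)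
    (((continuous_sInt cF).const_mul _).intervalIntegrable 0 t),
    intervalIntegral.integral_const_mul] at h3
  change _ + _ * dInt _ (-R) R t ≤ _ at h3
  change y t + _ ≤ _
  change y t - y 0 = _ at h1
  change y 0 ≤ _ at h2
  linarith

lemma integral_grad_le (h : s.ParBound f fx fxx ft a g r L D W Y G) {R : ℝ} (hR : -R ≤ R)
    {t : ℝ} (ht : t ∈ Icc 0 T) : ∫ τ in (0:ℝ)..t, sInt (s.grad r) (-R) R τ ≤ D :=
  (dInt_mono_time (s.continuous_grad r) hR (s.grad_nonneg r) ht.1 ht.2).trans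
    (h.grad_le (-R) R hR)

lemma one_add_energy_le (h : s.ParBound f fx fxx ft a g r L D W Y G) (hL : 1 ≤ L)
    (hY : 0 ≤ Y) (hG : 0 ≤ G) {R : ℝ} (hR : 1 ≤ R) {t : ℝ} (ht : t ∈ Icc 0 T) :
    1 + sInt (fun q => cut R q.1 ^ 2 * ((s.v q)⁻¹ * fx q ^ 2)) (-R) R t
      ≤ (1 + L * Y) * Real.exp (34 * L ^ 3 * (L ^ 2 + L + G) * D) := by
  have hRR : -R ≤ R := by linarith
  have hL0 : 0 < L := by linarith
  have c1 : ∀ p, s.v p ≠ 0 := fun p => (s.v_pos p).ne'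
  have cfx := h.par.cfx
  have ce : Continuous fun q : ℝ × ℝ => cut R q.1 ^ 2 * ((s.v q)⁻¹ * fx q ^ 2) := by
    fun_prop (disch := intro p; exact c1 p)
  have cm : Continuous fun τ => 34 * L ^ 3 * (L ^ 2 + L + G) * sInt (s.grad r) (-R) R τ := by
    fun_prop
  refine (gronwall_integral (m := fun τ => 34 * L ^ 3 * (L ^ 2 + L + G)
    * sInt (s.grad r) (-R) R τ) (A := 1 + L * Y) ((continuous_sInt ce).const_add 1) cm
    (fun τ _ => mul_nonneg (by positivity) (sInt_nonneg hRR fun x _ => s.grad_nonneg r _))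
    (fun τ hτ => ?_) ht).trans ?_
  · have h1 := h.energy_le hL hR hτ
    have h2 : 0 ≤ dInt (fun q => cut R q.1 ^ 2 * ft q ^ 2) (-R) R τ :=
      dInt_nonneg hRR hτ.1 fun x _ σ _ => by positivity
    have h3 : 0 ≤ 1 / (2 * L) * dInt (fun q => cut R q.1 ^ 2 * ft q ^ 2) (-R) R τ := by positivity
    linarith
  · rw [intervalIntegral.integral_const_mul]
    have := h.integral_grad_le hRR ht
    gcongr

lemma dInt_sq_ft_le (h : s.ParBound f fx fxx ft a g r L D W Y G) (hT : 0 < T) (hL : 1 ≤ L)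
    (hG : 0 ≤ G) {M : ℝ} {R : ℝ} (hR : 1 ≤ R)
    (hM : ∀ t ∈ Icc 0 T,
      1 + sInt (fun q => cut R q.1 ^ 2 * ((s.v q)⁻¹ * fx q ^ 2)) (-R) R t ≤ M) :
    dInt (fun q => cut R q.1 ^ 2 * ft q ^ 2) (-R) R T
      ≤ 2 * L * (L * Y + 34 * L ^ 3 * (L ^ 2 + L + G) * M * D) := by
  have hRR : -R ≤ R := by linarith
  have hL0 : 0 < L := by linarith
  have hT' : T ∈ Icc 0 T := ⟨hT.le, le_rfl⟩
  have c1 : ∀ p, s.v p ≠ 0 := fun p => (s.v_pos p).ne'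
  have cfx := h.par.cfx
  have ce : Continuous fun q : ℝ × ℝ => cut R q.1 ^ 2 * ((s.v q)⁻¹ * fx q ^ 2) := by
    fun_prop (disch := intro p; exact c1 p)
  have cy := continuous_sInt (a := -R) (b := R) ce
  have cN := continuous_sInt (a := -R) (b := R) (s.continuous_grad r)
  have y0 : ∀ t, 0 ≤ sInt (fun q => cut R q.1 ^ 2 * ((s.v q)⁻¹ * fx q ^ 2)) (-R) R t :=
    fun t => sInt_nonneg hRR fun x _ => by
      have : 0 ≤ (s.v (x, t))⁻¹ := inv_nonneg.2 (s.v_pos _).le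
      positivity
  have M0 : 0 ≤ M := by linarith [hM T hT', y0 T]
  have h1 := h.energy_le hL hR hT'
  have h2 : ∫ τ in (0:ℝ)..T, 34 * L ^ 3 * (L ^ 2 + L + G) * sInt (s.grad r) (-R) R τ
        * (1 + sInt (fun q => cut R q.1 ^ 2 * ((s.v q)⁻¹ * fx q ^ 2)) (-R) R τ)
      ≤ ∫ τ in (0:ℝ)..T, 34 * L ^ 3 * (L ^ 2 + L + G) * M * sInt (s.grad r) (-R) R τ := by
    refine intervalIntegral.integral_mono_on hT.le (Continuous.intervalIntegrable (by fun_prop) _ _)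
      (Continuous.intervalIntegrable (by fun_prop) _ _) fun τ hτ => ?_
    have k1 : 0 ≤ sInt (s.grad r) (-R) R τ := sInt_nonneg hRR fun x _ => s.grad_nonneg r _
    have k2 := mul_le_mul_of_nonneg_left (hM τ hτ)
      (by positivity : 0 ≤ 34 * L ^ 3 * (L ^ 2 + L + G) * sInt (s.grad r) (-R) R τ)
    linarith
  rw [intervalIntegral.integral_const_mul] at h2
  have h3 := mul_le_mul_of_nonneg_left (h.integral_grad_le hRR hT')
    (by positivity : 0 ≤ 34 * L ^ 3 * (L ^ 2 + L + G) * M)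
  have h4 : 1 / (2 * L) * dInt (fun q => cut R q.1 ^ 2 * ft q ^ 2) (-R) R T
      ≤ L * Y + 34 * L ^ 3 * (L ^ 2 + L + G) * M * D := by
    linarith [y0 T]
  have h5 := mul_le_mul_of_nonneg_left h4 (by positivity : 0 ≤ 2 * L)
  have e : 2 * L * (1 / (2 * L) * dInt (fun q => cut R q.1 ^ 2 * ft q ^ 2) (-R) R T)
      = dInt (fun q => cut R q.1 ^ 2 * ft q ^ 2) (-R) R T := by field_simp
  rwa [e] at h5

lemma sInt_sq_fxx_le (h : s.ParBound f fx fxx ft a g r L D W Y G) (hL : 1 ≤ L)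
    (hG : 0 ≤ G) {M : ℝ} {R : ℝ} (hR : 1 ≤ R) {t : ℝ} (ht : t ∈ Icc 0 T)
    (hM : 1 + sInt (fun q => cut R q.1 ^ 2 * ((s.v q)⁻¹ * fx q ^ 2)) (-R) R t ≤ M) :
    sInt (fun q => cut R q.1 ^ 2 * fxx q ^ 2) (-R) R t
      ≤ (2 * L ^ 2 + 2 * W) * (2 * L ^ 2 * sInt (fun q => cut R q.1 ^ 2 * ft q ^ 2) (-R) R t
        + (2 * G * M + 5 * L) * sInt (s.grad r) (-R) R t) := by
  have hRR : -R ≤ R := by linarith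
  have hL0 : 0 < L := by linarith
  have c1 : ∀ p, s.v p ≠ 0 := fun p => (s.v_pos p).ne'
  have cfx := h.par.cfx
  have cfxx := h.par.cfxx
  have cft := h.par.cft
  have ca := h.par.ca
  have cg := h.par.cg
  have cq : Continuous fun q => fx q / s.v q := by fun_prop (disch := intro p; exact c1 p)
  set Z := sInt (fun q => cut R q.1 ^ 2 * (a q * ft q - g q) ^ 2) (-R) R t with hZ
  set X := sInt (fun q => (fx q / s.v q) ^ 2) (-R) R t with hX
  set N := sInt (s.grad r) (-R) R t with hN
  have Z0 : 0 ≤ Z := sInt_nonneg hRR fun x _ => by positivity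
  have X0 : 0 ≤ X := sInt_nonneg hRR fun x _ => by positivity
  have N0 : 0 ≤ N := sInt_nonneg hRR fun x _ => s.grad_nonneg r _
  have hW := h.vx_le t ht (-R) R hRR
  have W0 : 0 ≤ W := (sInt_nonneg hRR fun x _ => by positivity).trans hW
  have h1 : ∀ x ∈ Icc (-R) R, cut R x ^ 2 * (fx (x, t) / s.v (x, t)) ^ 2 ≤ 5 * X + Z :=
    fun x hx => cut_sq_mul_sq_le hR (fun y => h.par.dq y t) (by fun_prop) hx
  have h2 : sInt (fun q => cut R q.1 ^ 2 * fxx q ^ 2) (-R) R t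
      ≤ sInt (fun q => 2 * L ^ 2 * (cut R q.1 ^ 2 * (a q * ft q - g q) ^ 2)
        + 2 * (5 * X + Z) * s.vx q ^ 2) (-R) R t := by
    refine sInt_mono hRR (by fun_prop) (by fun_prop) fun x hx => ?_
    have k1 := h1 x hx
    have k2 : s.v (x, t) ^ 2 ≤ L ^ 2 := pow_le_pow_left₀ (s.v_pos _).le (h.v_le x t ht) 2
    rw [h.par.fxx_eq]
    simp only
    set A := a (x, t) * ft (x, t) - g (x, t)
    set q := fx (x, t) / s.v (x, t)
    have k3 : (s.v (x, t) * A + s.vx (x, t) * q) ^ 2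
        ≤ 2 * (s.v (x, t) ^ 2 * A ^ 2) + 2 * (s.vx (x, t) ^ 2 * q ^ 2) := by
      nlinarith [sq_nonneg (s.v (x, t) * A - s.vx (x, t) * q)]
    have k4 : s.v (x, t) ^ 2 * (cut R x ^ 2 * A ^ 2) ≤ L ^ 2 * (cut R x ^ 2 * A ^ 2) := by gcongr
    have k5 : s.vx (x, t) ^ 2 * (cut R x ^ 2 * q ^ 2) ≤ s.vx (x, t) ^ 2 * (5 * X + Z) := by gcongr
    have k6 := mul_le_mul_of_nonneg_left k3 (sq_nonneg (cut R x))
    linarith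
  rw [sInt_add (by fun_prop) (by fun_prop), sInt_const_mul, sInt_const_mul] at h2
  have h3 := h.par.sInt_flux_sq_le hL0 hRR (fun x => h.le_a x t ht) fun x => h.a_le x t ht
  have h4 := h.g_le R hR t ht
  have h5 := h.sInt_sq_flux_le hRR ht
  have h6 := mul_le_mul_of_nonneg_left hM (mul_nonneg hG N0)
  have h7 := mul_le_mul_of_nonneg_left hW (by positivity : 0 ≤ 2 * (5 * X + Z))
  refine h2.trans ?_
  change Z ≤ _ at h3
  have h8 : 5 * X + Z ≤ 2 * L ^ 2 * sInt (fun q => cut R q.1 ^ 2 * ft q ^ 2) (-R) R t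
      + (2 * G * M + 5 * L) * N := by
    linarith
  have h9 := mul_le_mul_of_nonneg_left h8 (by positivity : 0 ≤ 2 * L ^ 2 + 2 * W)
  change 2 * L ^ 2 * Z + _ ≤ _
  have h10 : 0 ≤ L ^ 2 * X := by positivity
  linarith

end ParBound

lemma exists_parBound_le (hT : 0 < T) (hL : 1 ≤ L) (hD : 0 ≤ D) (hW : 0 ≤ W) (hY : 0 ≤ Y)
    (hG : 0 ≤ G) : ∃ C > 0, ∀ (s : MHD α β T) (f fx fxx ft a g : ℝ × ℝ → ℝ),
      s.ParBound f fx fxx ft a g r L D W Y G → ∀ x y, x ≤ y →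
        (∀ t ∈ Icc 0 T, sInt (fun p => fx p ^ 2) x y t ≤ C) ∧
        dInt (fun p => ft p ^ 2) x y T ≤ C ∧ dInt (fun p => fxx p ^ 2) x y T ≤ C := by
  have hL0 : 0 < L := by linarith
  set M := (1 + L * Y) * Real.exp (34 * L ^ 3 * (L ^ 2 + L + G) * D) with hM
  have hM0 : 0 < M := by positivity
  set F := 2 * L * (L * Y + 34 * L ^ 3 * (L ^ 2 + L + G) * M * D) with hF
  have hF0 : 0 ≤ F := by positivity
  set H := (2 * L ^ 2 + 2 * W) * (2 * L ^ 2 * F + (2 * G * M + 5 * L) * D) with hH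
  have hH0 : 0 ≤ H := by positivity
  refine ⟨2 * (L * M) + 2 * F + 2 * H, by positivity,
    fun s f fx fxx ft a g h x y hxy => ⟨fun t ht => ?_, ?_, ?_⟩⟩
  · have cfx := h.par.cfx
    refine (sInt_le_two_mul_of_cut (R₀ := 1) (C := L * M) (by fun_prop)
      (fun p => sq_nonneg _) (fun R hR0 hR => ?_) hxy).trans (by linarith)
    have hRR : -R ≤ R := by linarith
    have c1 : ∀ p, s.v p ≠ 0 := fun p => (s.v_pos p).ne'
    have h1 := h.one_add_energy_le hL hY hG hR ht
    have h2 : sInt (fun p => cut R p.1 ^ 2 * fx p ^ 2) (-R) R t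
        ≤ sInt (fun q => L * (cut R q.1 ^ 2 * ((s.v q)⁻¹ * fx q ^ 2))) (-R) R t := by
      refine sInt_mono hRR (by fun_prop) (by fun_prop (disch := intro p; exact c1 p))
        fun z _ => ?_
      have hv := s.v_pos (z, t)
      have k1 : 1 ≤ L * (s.v (z, t))⁻¹ := by
        rw [← div_eq_mul_inv, le_div_iff₀ hv, one_mul]
        exact h.v_le z t ht
      have k2 := mul_le_mul_of_nonneg_right k1
        (by positivity : 0 ≤ cut R z ^ 2 * fx (z, t) ^ 2)
      linarith
    rw [sInt_const_mul] at h2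
    refine h2.trans (mul_le_mul_of_nonneg_left ?_ hL0.le)
    linarith
  · have cft := h.par.cft
    refine (dInt_le_two_mul_of_cut (R₀ := 1) (C := F) (by fun_prop)
      (fun p => sq_nonneg _) hT.le (fun R hR0 hR => ?_) hxy).trans
      (by linarith [mul_pos hL0 hM0])
    exact h.dInt_sq_ft_le hT hL hG hR fun t ht => h.one_add_energy_le hL hY hG hR ht
  · have cft := h.par.cft
    have cfxx := h.par.cfxx
    refine (dInt_le_two_mul_of_cut (R₀ := 1) (C := H) (by fun_prop)
      (fun p => sq_nonneg _) hT.le (fun R hR0 hR => ?_) hxy).trans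
      (by linarith [mul_pos hL0 hM0])
    have hRR : -R ≤ R := by linarith
    have h1 := h.dInt_sq_ft_le hT hL hG hR fun t ht => h.one_add_energy_le hL hY hG hR ht
    have h2 := h.integral_grad_le hRR (⟨hT.le, le_rfl⟩ : T ∈ Icc 0 T)
    have cF : Continuous fun q : ℝ × ℝ => cut R q.1 ^ 2 * ft q ^ 2 := by fun_prop
    have i1 : IntervalIntegrable (fun t => 2 * L ^ 2
        * sInt (fun q => cut R q.1 ^ 2 * ft q ^ 2) (-R) R t) volume 0 T :=
      ((continuous_sInt cF).const_mul _).intervalIntegrable _ _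
    have i2 : IntervalIntegrable (fun t => (2 * G * M + 5 * L) * sInt (s.grad r) (-R) R t)
        volume 0 T := ((continuous_sInt (s.continuous_grad r)).const_mul _).intervalIntegrable _ _
    have h3 := intervalIntegral.integral_mono_on hT.le
      ((continuous_sInt (by fun_prop : Continuous fun q : ℝ × ℝ =>
        cut R q.1 ^ 2 * fxx q ^ 2)).intervalIntegrable 0 T)
      ((i1.add i2).const_mul (2 * L ^ 2 + 2 * W))
      fun t ht => h.sInt_sq_fxx_le hL hG hR ht (h.one_add_energy_le hL hY hG hR ht)
    rw [intervalIntegral.integral_const_mul, intervalIntegral.integral_add i1 i2,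
      intervalIntegral.integral_const_mul, intervalIntegral.integral_const_mul] at h3
    refine h3.trans ?_
    change (2 * L ^ 2 + 2 * W) * (2 * L ^ 2 * dInt (fun q => cut R q.1 ^ 2 * ft q ^ 2) (-R) R T
      + (2 * G * M + 5 * L) * ∫ t in (0:ℝ)..T, sInt (s.grad r) (-R) R t) ≤ _
    rw [hH]
    gcongr

end MHD

namespace MHD

variable {α β T K δ : ℝ}

lemma par_w (s : MHD α β T) (i : Fin 2) :
    s.Par (s.w i) (s.wx i) (s.wxx i) (s.wt i) (fun _ => 1) (s.bx i) where
  cfx := s.hwx i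
  cfxx := s.hwxx i
  cft := s.hwt i
  ca := continuous_const
  cg := s.hbx i
  dx := s.dwx i
  dxx := s.dwxx i
  dt := s.dwt i
  dq x t := (s.dflux_w i x t).congr_deriv (by ring)

lemma par_b (s : MHD α β T) (i : Fin 2) :
    s.Par (s.b i) (s.bx i) (s.bxx i) (s.bt i) s.v (fun p => s.wx i p - s.ux p * s.b i p) where
  cfx := s.hbx i
  cfxx := s.hbxx i
  cft := s.hbt i
  ca := s.hv
  cg := by fun_prop
  dx := s.dbx i
  dxx := s.dbxx i
  dt := s.dbt i
  dq x t := (s.dflux_b i x t).congr_deriv (by ring)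

lemma sq_wx_le_tr (s : MHD α β T) (i : Fin 2) (p : ℝ × ℝ) : s.wx i p ^ 2 ≤ s.tr p := by
  unfold tr
  fin_cases i
  · simp only [Fin.zero_eta]
    linarith [sq_nonneg (s.wx 1 p), sq_nonneg (s.bx 0 p), sq_nonneg (s.bx 1 p)]
  · simp only [Fin.mk_one]
    linarith [sq_nonneg (s.wx 0 p), sq_nonneg (s.bx 0 p), sq_nonneg (s.bx 1 p)]

lemma sq_bx_le_tr (s : MHD α β T) (i : Fin 2) (p : ℝ × ℝ) : s.bx i p ^ 2 ≤ s.tr p := by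
  unfold tr
  fin_cases i
  · simp only [Fin.zero_eta]
    linarith [sq_nonneg (s.bx 1 p), sq_nonneg (s.wx 0 p), sq_nonneg (s.wx 1 p)]
  · simp only [Fin.mk_one]
    linarith [sq_nonneg (s.bx 0 p), sq_nonneg (s.wx 0 p), sq_nonneg (s.wx 1 p)]

lemma v_mul_sq_b_le_bas (s : MHD α β T) (i : Fin 2) (p : ℝ × ℝ) :
    s.v p * s.b i p ^ 2 ≤ 2 * s.bas p := by
  have h1 := s.ent_θ_add_le_bas p
  have h2 := ent_nonneg (s.θ_pos p)
  have h3 := mul_nonneg (s.v_pos p).le (sq_nonneg (s.b 0 p))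
  have h4 := mul_nonneg (s.v_pos p).le (sq_nonneg (s.b 1 p))
  fin_cases i
  · simp only [Fin.zero_eta]
    linarith
  · simp only [Fin.mk_one]
    linarith

lemma sInt_tr_zero_le {s : MHD α β T} (hs : s.Adm K δ) {x y : ℝ} (hxy : x ≤ y) :
    sInt s.tr x y 0 ≤ K ^ 2 := by
  refine le_trans (sInt_mono hxy (by unfold tr; fun_prop) (by fun_prop) fun z _ => ?_)
    (hs.1 x y hxy)
  unfold tr
  have : 0 ≤ (s.v (z, 0) - 1) ^ 2 + s.u (z, 0) ^ 2 + (s.θ (z, 0) - 1) ^ 2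
    + (s.b 0 (z, 0) ^ 2 + s.b 1 (z, 0) ^ 2) + (s.w 0 (z, 0) ^ 2 + s.w 1 (z, 0) ^ 2)
    + s.vx (z, 0) ^ 2 + s.ux (z, 0) ^ 2 + s.θx (z, 0) ^ 2 := by positivity
  linarith

lemma exists_transverse_le (hα : 0 ≤ α) (hβ : 0 < β) (hT : 0 < T) (hδ : 0 < δ) : ∃ C > 0,
    ∀ s : MHD α β T, s.Adm K δ → ∀ i x y, x ≤ y →
      ((∀ t ∈ Icc 0 T, sInt (fun p => s.bx i p ^ 2) x y t ≤ C) ∧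
        dInt (fun p => s.bt i p ^ 2) x y T ≤ C ∧ dInt (fun p => s.bxx i p ^ 2) x y T ≤ C) ∧
      ((∀ t ∈ Icc 0 T, sInt (fun p => s.wx i p ^ 2) x y t ≤ C) ∧
        dInt (fun p => s.wt i p ^ 2) x y T ≤ C ∧ dInt (fun p => s.wxx i p ^ 2) x y T ≤ C) := by
  obtain ⟨E, hE0, hE⟩ := exists_bas_le (α := α) (β := β) (K := K) hα hT hδ
  obtain ⟨c, hc, _, -, hv⟩ := exists_le_v (β := β) (K := K) hα hT hδ
  obtain ⟨V, hV0, hV⟩ := exists_v_le (K := K) hα hβ hT hδ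
  obtain ⟨D, hD, hG⟩ := exists_grad_le (K := K) hα hβ hT hδ
  obtain ⟨W, hW, hvx⟩ := exists_vx_le (K := K) hα hβ hT hδ
  set L := 1 + c⁻¹ + V with hL
  have hci : 0 < c⁻¹ := inv_pos.2 hc
  have hL1 : 1 ≤ L := by linarith
  have hL0 : 0 < L := by linarith
  set G := 2 * L * (1 + 10 * L * E + L) with hGd
  have hLG : 2 * L ≤ G := by
    rw [hGd]
    refine le_mul_of_one_le_right (by positivity) ?_
    have : 0 < 10 * L * E := by positivity
    linarith
  obtain ⟨C, hC, H⟩ := exists_parBound_le (α := α) (β := β) (r := rexp β) hT hL1 hD.le hW.le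
    (sq_nonneg K) (by positivity : 0 ≤ G)
  refine ⟨C, hC, fun s hs i => ?_⟩
  have le_v : ∀ x, ∀ t ∈ Icc 0 T, 1 ≤ L * s.v (x, t) := fun x t ht => by
    have h1 := (hv s hs x t ht).1
    have h2 : c⁻¹ ≤ L := by linarith
    calc (1:ℝ) = c⁻¹ * c := (inv_mul_cancel₀ hc.ne').symm
      _ ≤ _ := by gcongr
  have v_le : ∀ x, ∀ t ∈ Icc 0 T, s.v (x, t) ≤ L := fun x t ht => by
    have := hV s hs x t ht
    linarith
  have tr_le : ∀ t ∈ Icc 0 T, ∀ x, s.ux (x, t) ^ 2 + s.tr (x, t) ≤ L * s.grad (rexp β) (x, t) :=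
    fun t ht x => s.sq_ux_add_tr_le (v_le x t ht)
  have c1 : ∀ p, s.v p ≠ 0 := fun p => (s.v_pos p).ne'
  have cgr := s.continuous_grad (rexp β)
  have ini : ∀ h : ℝ × ℝ → ℝ, Continuous h → (∀ p, h p ^ 2 ≤ s.tr p) → ∀ x y, x ≤ y →
      sInt (fun p => h p ^ 2) x y 0 ≤ K ^ 2 := fun h ch hh x y hxy =>
    (sInt_mono hxy (by fun_prop) (by unfold tr; fun_prop) fun z _ => hh _).trans
      (sInt_tr_zero_le hs hxy)
  have N0 : ∀ R t, 1 ≤ R → 0 ≤ sInt (s.grad (rexp β)) (-R) R t := fun R t hR =>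
    sInt_nonneg (by linarith) fun x _ => s.grad_nonneg _ _
  have hpos : ∀ (h : ℝ × ℝ → ℝ) (R t : ℝ), 1 ≤ R →
      0 ≤ sInt (fun q => cut R q.1 ^ 2 * ((s.v q)⁻¹ * h q ^ 2)) (-R) R t := fun h R t hR =>
    sInt_nonneg (by linarith) fun x _ => by
      have : 0 ≤ (s.v (x, t))⁻¹ := inv_nonneg.2 (s.v_pos _).le
      positivity
  have hcut : ∀ h : ℝ × ℝ → ℝ, Continuous h → (∀ p, h p ^ 2 ≤ s.tr p) → ∀ R, 1 ≤ R →
      ∀ t ∈ Icc 0 T, sInt (fun p => cut R p.1 ^ 2 * h p ^ 2) (-R) R t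
        ≤ L * sInt (s.grad (rexp β)) (-R) R t := fun h ch hh R hR t ht => by
    refine (sInt_cut_le (g := fun p => h p ^ 2) (by fun_prop) (fun p => sq_nonneg _)
      (by linarith)).trans ?_
    rw [← sInt_const_mul]
    refine sInt_mono (by linarith) (by fun_prop) (by fun_prop) fun x _ => ?_
    have := tr_le t ht x
    linarith [hh (x, t), sq_nonneg (s.ux (x, t))]
  refine fun x y hxy => ⟨H s _ _ _ _ _ _ ⟨s.par_b i, le_v, v_le, le_v, v_le, s.sq_bx_le_tr i,
    hG s hs, hvx s hs, ini _ (s.hbx i) (s.sq_bx_le_tr i), fun R hR t ht => ?_⟩ x y hxy,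
    H s _ _ _ _ _ _ ⟨s.par_w i, le_v, v_le, fun _ _ _ => by rwa [mul_one], fun _ _ _ => hL1,
    s.sq_wx_le_tr i, hG s hs, hvx s hs, ini _ (s.hwx i) (s.sq_wx_le_tr i),
    fun R hR t ht => ?_⟩ x y hxy⟩
  · have hRR : -R ≤ R := by linarith
    set y := sInt (fun q => cut R q.1 ^ 2 * ((s.v q)⁻¹ * s.bx i q ^ 2)) (-R) R t with hy
    set N := sInt (s.grad (rexp β)) (-R) R t with hN
    have y0 : 0 ≤ y := hpos _ R t hR
    have n0 : 0 ≤ N := N0 R t hR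
    have h1 : sInt (fun q => cut R q.1 ^ 2 * s.bx i q ^ 2) (-R) R t ≤ L * y := by
      rw [hy, ← sInt_const_mul]
      refine sInt_mono hRR (by fun_prop) (by fun_prop (disch := intro p; exact c1 p))
        fun z _ => ?_
      have k1 : 1 ≤ L * (s.v (z, t))⁻¹ := by
        rw [← div_eq_mul_inv, le_div_iff₀ (s.v_pos _), one_mul]
        exact v_le z t ht
      have k2 := mul_le_mul_of_nonneg_right k1
        (by positivity : 0 ≤ cut R z ^ 2 * s.bx i (z, t) ^ 2)
      linarith
    have h2 : sInt (fun q => s.b i q ^ 2) (-R) R t ≤ 2 * L * E := by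
      refine le_trans ?_ (mul_le_mul_of_nonneg_left (hE s hs t ht (-R) R hRR)
        (by positivity : 0 ≤ 2 * L))
      rw [← sInt_const_mul]
      refine sInt_mono hRR (by fun_prop) (by fun_prop) fun z _ => ?_
      have k1 := mul_le_mul_of_nonneg_left (s.v_mul_sq_b_le_bas i (z, t)) hL0.le
      have k2 := mul_le_mul_of_nonneg_right (le_v z t ht) (sq_nonneg (s.b i (z, t)))
      linarith
    have h3 : ∀ z ∈ Icc (-R) R, cut R z ^ 2 * s.b i (z, t) ^ 2 ≤ 10 * L * E + L * y := by
      intro z hz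
      have := cut_sq_mul_sq_le hR (fun x => s.dbx i x t) (by fun_prop) hz
      change _ ≤ 5 * sInt (fun q => s.b i q ^ 2) (-R) R t
        + sInt (fun q => cut R q.1 ^ 2 * s.bx i q ^ 2) (-R) R t at this
      linarith
    have h4 : sInt (fun q => cut R q.1 ^ 2 * (s.wx i q - s.ux q * s.b i q) ^ 2) (-R) R t
        ≤ sInt (fun q => 2 * (cut R q.1 ^ 2 * s.wx i q ^ 2)
          + 2 * (10 * L * E + L * y) * (L * s.grad (rexp β) q)) (-R) R t := by
      refine sInt_mono hRR (by fun_prop) (by fun_prop) fun z hz => ?_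
      have k1 : (s.wx i (z, t) - s.ux (z, t) * s.b i (z, t)) ^ 2 ≤ 2 * s.wx i (z, t) ^ 2
          + 2 * (s.b i (z, t) ^ 2 * s.ux (z, t) ^ 2) := by
        nlinarith [sq_nonneg (s.wx i (z, t) + s.ux (z, t) * s.b i (z, t))]
      have k2 := mul_le_mul_of_nonneg_left k1 (sq_nonneg (cut R z))
      have k3 : s.ux (z, t) ^ 2 ≤ L * s.grad (rexp β) (z, t) := by
        linarith [tr_le t ht z, s.tr_nonneg (z, t)]
      have k4 := mul_le_mul (h3 z hz) k3 (sq_nonneg _) (by positivity)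
      linarith
    rw [sInt_add (by fun_prop) (by fun_prop), sInt_const_mul, sInt_const_mul, sInt_const_mul] at h4
    have h5 := hcut _ (s.hwx i) (s.sq_wx_le_tr i) R hR t ht
    have e : G * N * (1 + y) = 2 * (L * N) + 2 * (10 * L * E + L * y) * (L * N)
        + 2 * (L * N) * y * (1 + 10 * L * E) + 2 * (L * N) * L := by
      rw [hGd]
      ring
    have e1 : 0 ≤ 2 * (L * N) * y * (1 + 10 * L * E) + 2 * (L * N) * L := by positivity
    change _ ≤ _ + _ * (L * N) at h4
    change _ ≤ L * N at h5
    linarith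
  · have h1 := hcut _ (s.hbx i) (s.sq_bx_le_tr i) R hR t ht
    have h2 := N0 R t hR
    have h3 := hpos (s.wx i) R t hR
    have h4 : L ≤ G := by linarith
    refine h1.trans ((mul_le_mul_of_nonneg_right h4 h2).trans ?_)
    exact le_mul_of_one_le_right (by positivity) (by linarith)

end MHD

lemma integral_le_of_forall_interval {f : ℝ → ℝ} {C : ℝ} (hC : 0 ≤ C)
    (h : ∀ n : ℕ, ∫ x in (-n : ℝ)..n, f x ≤ C) : ∫ x, f x ≤ C := by
  by_cases hf : Integrable f
  · exact le_of_tendsto' (intervalIntegral_tendsto_integral hf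
      (tendsto_neg_atTop_atBot.comp tendsto_natCast_atTop_atTop) tendsto_natCast_atTop_atTop) h
  · rwa [integral_undef hf]

lemma integral_integral_le_of_forall_dInt {F : ℝ × ℝ → ℝ} {C T : ℝ} (hF : Continuous F)
    (h0 : ∀ p, 0 ≤ F p) (hT : 0 ≤ T) (hC : 0 ≤ C) (h : ∀ n : ℕ, dInt F (-n) n T ≤ C) :
    ∫ s in (0:ℝ)..T, ∫ x, F (x, s) ≤ C := by
  rw [intervalIntegral.integral_of_le hT]
  by_cases hi : IntegrableOn (fun s => ∫ x, F (x, s)) (Ioc 0 T)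
  swap
  · rwa [integral_undef hi]
  have hn : ∀ n : ℕ, -(n : ℝ) ≤ n := fun n => by linarith [(Nat.cast_nonneg n : (0:ℝ) ≤ n)]
  rw [← ENNReal.ofReal_le_ofReal_iff hC, ofReal_integral_eq_lintegral_ofReal hi
    (Eventually.of_forall fun s => integral_nonneg fun x => h0 _)]
  have h1 : ∀ s, ENNReal.ofReal (∫ x, F (x, s))
      ≤ liminf (fun n : ℕ => ENNReal.ofReal (sInt F (-n) n s)) atTop := by
    intro s
    by_cases hf : Integrable fun x => F (x, s)
    · refine (Tendsto.liminf_eq ?_).ge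
      exact (ENNReal.continuous_ofReal.tendsto _).comp (intervalIntegral_tendsto_integral hf
        (tendsto_neg_atTop_atBot.comp tendsto_natCast_atTop_atTop) tendsto_natCast_atTop_atTop)
    · simp [integral_undef hf]
  refine (lintegral_mono h1).trans ((lintegral_liminf_le fun n =>
    ((continuous_sInt hF).measurable.ennreal_ofReal)).trans ?_)
  have h2 : ∀ n : ℕ, ∫⁻ s in Ioc 0 T, ENNReal.ofReal (sInt F (-n) n s) ≤ ENNReal.ofReal C := by
    intro n
    rw [← ofReal_integral_eq_lintegral_ofReal
      ((continuous_sInt hF).continuousOn.integrableOn_Icc.mono_set Ioc_subset_Icc_self)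
      (Eventually.of_forall fun s => sInt_nonneg (hn n) fun x _ => h0 _),
      ← intervalIntegral.integral_of_le hT]
    exact ENNReal.ofReal_le_ofReal (h n)
  exact liminf_le_of_le (by isBoundedDefault) fun b hb => by
    obtain ⟨n, hn⟩ := hb.exists
    exact hn.trans (h2 n)

/-- Lemma 2.6 of the paper: first-order energy estimates for the
transverse fields `b` and `w`. -/
theorem b_w_higher_order_bound (α β T K δ : ℝ) (hα : 0 ≤ α) (hβ : 0 < β) (hT : 0 < T)
    (hK : 0 < K) (hδ₀ : 0 < δ) (hδ₁ : δ ≤ 1) :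
    ∃ C : ℝ, 0 < C ∧
      ∀ (v u θ : ℝ → ℝ → ℝ) (w b : ℝ → ℝ → ℝ × ℝ),
        IsClassicalSolution α β T v u θ w b → Admissible K δ v u θ w b →
        ∀ t ∈ Icc (0:ℝ) T,
          (∫ x : ℝ, (sq2 (pdx b x t) + sq2 (pdx w x t)))
            + (∫ s in (0:ℝ)..T, ∫ x : ℝ,
                (sq2 (pdt T b x s) + sq2 (pdx (pdx b) x s)
                  + sq2 (pdt T w x s) + sq2 (pdx (pdx w) x s))) ≤ C := by
  obtain ⟨C, hC, H⟩ := MHD.exists_transverse_le (α := α) (β := β) (K := K) hα hβ hT hδ₀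
  refine ⟨4 * C + 8 * C, by positivity, fun v u θ w b h ha t ht => ?_⟩
  set s := h.toMHD hT with hs
  have Hs := H s (h.adm_toMHD hT ha)
  have hn : ∀ n : ℕ, -(n : ℝ) ≤ n := fun n => by linarith [(Nat.cast_nonneg n : (0:ℝ) ≤ n)]
  refine add_le_add ?_ ?_
  · refine integral_le_of_forall_interval (by positivity) fun n => ?_
    have e : ∫ x in (-n : ℝ)..n, (sq2 (pdx b x t) + sq2 (pdx w x t))
        = sInt (fun p => (s.bx 0 p ^ 2 + s.bx 1 p ^ 2) + (s.wx 0 p ^ 2 + s.wx 1 p ^ 2))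
          (-n) n t := by
      simp only [sInt, hs, IsClassicalSolution.toMHD, clampTime_eq ht, comp_zero, comp_one, sq2]
    rw [e, sInt_add (by fun_prop) (by fun_prop), sInt_add (by fun_prop) (by fun_prop),
      sInt_add (by fun_prop) (by fun_prop)]
    have h0 := Hs 0 (-n) n (hn n)
    have h1 := Hs 1 (-n) n (hn n)
    linarith [h0.1.1 t ht, h0.2.1 t ht, h1.1.1 t ht, h1.2.1 t ht]
  · have e : ∫ τ in (0:ℝ)..T, ∫ x : ℝ, (sq2 (pdt T b x τ) + sq2 (pdx (pdx b) x τ)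
          + sq2 (pdt T w x τ) + sq2 (pdx (pdx w) x τ))
        = ∫ τ in (0:ℝ)..T, ∫ x : ℝ, (fun p => (s.bt 0 p ^ 2 + s.bt 1 p ^ 2)
          + (s.bxx 0 p ^ 2 + s.bxx 1 p ^ 2) + (s.wt 0 p ^ 2 + s.wt 1 p ^ 2)
          + (s.wxx 0 p ^ 2 + s.wxx 1 p ^ 2)) (x, τ) := by
      refine intervalIntegral.integral_congr fun τ hτ => ?_
      rw [uIcc_of_le hT.le] at hτ
      simp only [hs, IsClassicalSolution.toMHD, clampTime_eq hτ, comp_zero, comp_one, sq2]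
    rw [e]
    refine integral_integral_le_of_forall_dInt (F := fun p => (s.bt 0 p ^ 2 + s.bt 1 p ^ 2)
          + (s.bxx 0 p ^ 2 + s.bxx 1 p ^ 2) + (s.wt 0 p ^ 2 + s.wt 1 p ^ 2)
          + (s.wxx 0 p ^ 2 + s.wxx 1 p ^ 2))
      (by fun_prop) (fun p => by positivity) hT.le
      (by positivity) fun n => ?_
    rw [dInt_add (by fun_prop) (by fun_prop), dInt_add (by fun_prop) (by fun_prop),
      dInt_add (by fun_prop) (by fun_prop), dInt_add (by fun_prop) (by fun_prop),
      dInt_add (by fun_prop) (by fun_prop), dInt_add (by fun_prop) (by fun_prop),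
      dInt_add (by fun_prop) (by fun_prop)]
    have h0 := Hs 0 (-n) n (hn n)
    have h1 := Hs 1 (-n) n (hn n)
    linarith [h0.1.2.1, h0.1.2.2, h0.2.2.1, h0.2.2.2, h1.1.2.1, h1.1.2.2, h1.2.2.1, h1.2.2.2]
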